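/- Let n ≥ 2 and let (u,v) be a solution of Δu = u v², Δv = v u², u > 0, v > 0 on ℝⁿ satisfying the linear growth condition u(x) + v(x) ≤ C₀(1 + |x|) for some constant C₀ > 0. Then there exists a constant C > 0 such that for every x ∈ ℝⁿ with u(x) = v(x), both ∫_{B₁(x)} u² ≥ C and ∫_{B₁(x)} v² ≥ C. -/

import Mathlib

open MeasureTheory Metric
open scoped RealInnerProductSpace

noncomputable section

/-- The Laplacian of a function on Euclidean space, as the trace of the second derivative. -/
def lap {n : ℕ} (u : EuclideanSpace ℝ (Fin n) → ℝ) (x : EuclideanSpace ℝ (Fin n)) : ℝ :=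
  ∑ i : Fin n, iteratedFDeriv ℝ 2 u x (fun _ => EuclideanSpace.single i 1)

/-- A (positive classical) solution of the system Δu = u v², Δv = v u², u,v > 0 on ℝⁿ. -/
def IsSolution {n : ℕ} (u v : EuclideanSpace ℝ (Fin n) → ℝ) : Prop :=
  ContDiff ℝ (⊤ : ℕ∞) u ∧ ContDiff ℝ (⊤ : ℕ∞) v ∧ (∀ x, 0 < u x) ∧ (∀ x, 0 < v x) ∧
    (∀ x, lap u x = u x * v x ^ 2) ∧ (∀ x, lap v x = v x * u x ^ 2)

set_option linter.unusedSectionVars false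

section Growth

variable {X Y F : Type*} [NormedAddCommGroup X] [NormedSpace ℝ X] [NormedAddCommGroup Y]
  [NormedSpace ℝ Y] [NormedAddCommGroup F] [NormedSpace ℝ F]

/-- Functions of at most polynomial growth. -/
def PolyGrowth (f : X → F) : Prop := ∃ C : ℝ, ∃ m : ℕ, 0 ≤ C ∧ ∀ x, ‖f x‖ ≤ C * (1 + ‖x‖) ^ m

theorem PolyGrowth.of_le {f : X → F} {g : X → Y} (hg : PolyGrowth g) (h : ∀ x, ‖f x‖ ≤ ‖g x‖) :
    PolyGrowth f := by
  obtain ⟨C, m, hC, hb⟩ := hg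
  exact ⟨C, m, hC, fun x => (h x).trans (hb x)⟩

theorem polyGrowth_const (c : F) : PolyGrowth (fun _ : X => c) :=
  ⟨‖c‖, 0, norm_nonneg _, fun x => by simp⟩

theorem PolyGrowth.add {f g : X → F} (hf : PolyGrowth f) (hg : PolyGrowth g) :
    PolyGrowth (fun x => f x + g x) := by
  obtain ⟨C, m, hC, hf⟩ := hf
  obtain ⟨D, k, hD, hg⟩ := hg
  refine ⟨C + D, m + k, by positivity, fun x => ?_⟩
  have h1 : (1 : ℝ) ≤ 1 + ‖x‖ := by linarith [norm_nonneg x]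
  calc ‖f x + g x‖ ≤ C * (1 + ‖x‖) ^ m + D * (1 + ‖x‖) ^ k :=
        (norm_add_le _ _).trans (add_le_add (hf x) (hg x))
    _ ≤ C * (1 + ‖x‖) ^ (m + k) + D * (1 + ‖x‖) ^ (m + k) := by
        gcongr <;> first | exact h1 | omega
    _ = _ := by ring

theorem PolyGrowth.smul {f : X → ℝ} {g : X → F} (hf : PolyGrowth f) (hg : PolyGrowth g) :
    PolyGrowth (fun x => f x • g x) := by
  obtain ⟨C, m, hC, hf⟩ := hf
  obtain ⟨D, k, hD, hg⟩ := hg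
  refine ⟨C * D, m + k, by positivity, fun x => ?_⟩
  rw [norm_smul]
  calc ‖f x‖ * ‖g x‖ ≤ (C * (1 + ‖x‖) ^ m) * (D * (1 + ‖x‖) ^ k) := by
        gcongr
        · exact hf x
        · exact hg x
    _ = _ := by ring

theorem PolyGrowth.mul {f g : X → ℝ} (hf : PolyGrowth f) (hg : PolyGrowth g) :
    PolyGrowth (fun x => f x * g x) := hf.smul hg

theorem PolyGrowth.norm {f : X → F} (hf : PolyGrowth f) : PolyGrowth (fun x => ‖f x‖) :=
  hf.of_le (by simp)

theorem PolyGrowth.sum {ι : Type*} {s : Finset ι} {f : ι → X → F} (hf : ∀ i ∈ s, PolyGrowth (f i)) :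
    PolyGrowth (fun x => ∑ i ∈ s, f i x) := by
  classical
  induction s using Finset.induction_on with
  | empty => simpa using polyGrowth_const (0 : F)
  | insert a s ha ih =>
    simp_rw [Finset.sum_insert ha]
    exact (hf a (by simp)).add (ih fun i hi => hf i (by simp [hi]))

theorem PolyGrowth.comp {f : Y → F} {g : X → Y} (hf : PolyGrowth f) (hg : PolyGrowth g) :
    PolyGrowth (fun x => f (g x)) := by
  obtain ⟨C, m, hC, hf⟩ := hf
  obtain ⟨D, k, hD, hg⟩ := hg
  refine ⟨C * (1 + D) ^ m, k * m, by positivity, fun x => ?_⟩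
  have h1 : (1 : ℝ) ≤ (1 + ‖x‖) ^ k := one_le_pow₀ (by linarith [norm_nonneg x])
  calc ‖f (g x)‖ ≤ C * (1 + ‖g x‖) ^ m := hf _
    _ ≤ C * ((1 + D) * (1 + ‖x‖) ^ k) ^ m := by
        gcongr
        linarith [hg x]
    _ = _ := by rw [mul_pow, ← pow_mul]; ring

theorem polyGrowth_id : PolyGrowth (fun x : X => x) :=
  ⟨1, 1, zero_le_one, fun x => by simp⟩

theorem polyGrowth_clm (L : X →L[ℝ] F) : PolyGrowth (fun x => L x) :=
  ⟨‖L‖, 1, norm_nonneg _, fun x => (L.le_opNorm x).trans (by gcongr; linarith)⟩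

/-- Continuous functions of polynomial growth. -/
structure Temp0 (f : X → F) : Prop where
  cont : Continuous f
  growth : PolyGrowth f

/-- Continuously differentiable functions which grow polynomially with their derivative. -/
structure Temp1 (f : X → F) : Prop where
  contDiff : ContDiff ℝ 1 f
  growth : PolyGrowth f
  growth' : PolyGrowth (fderiv ℝ f)

theorem temp0_const (c : F) : Temp0 (fun _ : X => c) := ⟨continuous_const, polyGrowth_const c⟩

theorem temp0_id : Temp0 (fun x : X => x) := ⟨continuous_id, polyGrowth_id⟩

theorem temp0_clm (L : X →L[ℝ] F) : Temp0 (fun x => L x) := ⟨L.continuous, polyGrowth_clm L⟩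

theorem Temp0.add {f g : X → F} (hf : Temp0 f) (hg : Temp0 g) : Temp0 (fun x => f x + g x) :=
  ⟨hf.cont.add hg.cont, hf.growth.add hg.growth⟩

theorem Temp0.smul {f : X → ℝ} {g : X → F} (hf : Temp0 f) (hg : Temp0 g) :
    Temp0 (fun x => f x • g x) :=
  ⟨hf.cont.smul hg.cont, hf.growth.smul hg.growth⟩

theorem Temp0.mul {f g : X → ℝ} (hf : Temp0 f) (hg : Temp0 g) : Temp0 (fun x => f x * g x) :=
  hf.smul hg

theorem Temp0.neg {f : X → F} (hf : Temp0 f) : Temp0 (fun x => - f x) :=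
  ⟨hf.cont.neg, hf.growth.of_le (by simp)⟩

theorem Temp0.sub {f g : X → F} (hf : Temp0 f) (hg : Temp0 g) : Temp0 (fun x => f x - g x) := by
  simpa [sub_eq_add_neg] using hf.add hg.neg

theorem Temp0.pow {f : X → ℝ} (hf : Temp0 f) (k : ℕ) : Temp0 (fun x => f x ^ k) := by
  induction k with
  | zero => simpa using temp0_const (1 : ℝ)
  | succ k ih => simpa [pow_succ] using ih.mul hf

theorem Temp0.norm {f : X → F} (hf : Temp0 f) : Temp0 (fun x => ‖f x‖) :=
  ⟨hf.cont.norm, hf.growth.norm⟩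

theorem Temp0.sum {ι : Type*} {s : Finset ι} {f : ι → X → F} (hf : ∀ i ∈ s, Temp0 (f i)) :
    Temp0 (fun x => ∑ i ∈ s, f i x) :=
  ⟨continuous_finsetSum _ fun i hi => (hf i hi).cont, .sum fun i hi => (hf i hi).growth⟩

theorem Temp0.comp {f : Y → F} {g : X → Y} (hf : Temp0 f) (hg : Temp0 g) :
    Temp0 (fun x => f (g x)) :=
  ⟨hf.cont.comp hg.cont, hf.growth.comp hg.growth⟩

theorem Temp0.clm_apply {f : X → Y →L[ℝ] F} {g : X → Y} (hf : Temp0 f) (hg : Temp0 g) :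
    Temp0 (fun x => f x (g x)) :=
  ⟨hf.cont.clm_apply hg.cont, (hf.growth.norm.mul hg.growth.norm).of_le fun x => by
    simpa using (f x).le_opNorm (g x)⟩

theorem Temp1.temp0 {f : X → F} (hf : Temp1 f) : Temp0 f := ⟨hf.contDiff.continuous, hf.growth⟩

theorem Temp1.differentiable {f : X → F} (hf : Temp1 f) : Differentiable ℝ f :=
  hf.contDiff.differentiable (by norm_num)

theorem Temp1.hasFDerivAt {f : X → F} (hf : Temp1 f) (x : X) : HasFDerivAt f (fderiv ℝ f x) x :=
  (hf.differentiable x).hasFDerivAt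

theorem Temp1.temp0_fderiv {f : X → F} (hf : Temp1 f) : Temp0 (fderiv ℝ f) :=
  ⟨hf.contDiff.continuous_fderiv (by norm_num), hf.growth'⟩

theorem temp1_const (c : F) : Temp1 (fun _ : X => c) :=
  ⟨contDiff_const, polyGrowth_const c,
    (polyGrowth_const (0 : X →L[ℝ] F)).of_le fun x => by simp⟩

theorem temp1_clm (L : X →L[ℝ] F) : Temp1 (fun x => L x) :=
  ⟨L.contDiff, polyGrowth_clm L, (polyGrowth_const L).of_le fun x => by
    rw [ContinuousLinearMap.fderiv]⟩

theorem Temp1.add {f g : X → F} (hf : Temp1 f) (hg : Temp1 g) : Temp1 (fun x => f x + g x) :=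
  ⟨hf.contDiff.add hg.contDiff, hf.growth.add hg.growth, (hf.growth'.add hg.growth').of_le
    fun x => by rw [fderiv_fun_add (hf.differentiable x) (hg.differentiable x)]⟩

theorem Temp1.neg {f : X → F} (hf : Temp1 f) : Temp1 (fun x => - f x) :=
  ⟨hf.contDiff.neg, hf.temp0.neg.growth, hf.growth'.of_le fun x => by simp [fderiv_fun_neg]⟩

theorem Temp1.sub {f g : X → F} (hf : Temp1 f) (hg : Temp1 g) : Temp1 (fun x => f x - g x) := by
  simpa [sub_eq_add_neg] using hf.add hg.neg

theorem Temp1.smul {f : X → ℝ} {g : X → F} (hf : Temp1 f) (hg : Temp1 g) :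
    Temp1 (fun x => f x • g x) := by
  refine ⟨hf.contDiff.smul hg.contDiff, hf.growth.smul hg.growth,
    ((hf.growth.norm.mul hg.growth'.norm).add (hf.growth'.norm.mul hg.growth.norm)).of_le
      fun x => ?_⟩
  rw [fderiv_fun_smul (hf.differentiable x) (hg.differentiable x)]
  refine (norm_add_le _ _).trans (le_trans ?_ (le_abs_self _))
  rw [norm_smul, ContinuousLinearMap.norm_smulRight_apply]

theorem Temp1.mul {f g : X → ℝ} (hf : Temp1 f) (hg : Temp1 g) : Temp1 (fun x => f x * g x) :=
  hf.smul hg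

theorem Temp1.const_mul {f : X → ℝ} (c : ℝ) (hf : Temp1 f) : Temp1 (fun x => c * f x) :=
  (temp1_const c).mul hf

theorem Temp1.pow {f : X → ℝ} (hf : Temp1 f) (k : ℕ) : Temp1 (fun x => f x ^ k) := by
  induction k with
  | zero => simpa using temp1_const (1 : ℝ)
  | succ k ih => simpa [pow_succ] using ih.mul hf

theorem Temp1.sum {ι : Type*} {s : Finset ι} {f : ι → X → F} (hf : ∀ i ∈ s, Temp1 (f i)) :
    Temp1 (fun x => ∑ i ∈ s, f i x) := by
  classical
  induction s using Finset.induction_on with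
  | empty => simpa using temp1_const (0 : F)
  | insert a s ha ih =>
    simp_rw [Finset.sum_insert ha]
    exact (hf a (by simp)).add (ih fun i hi => hf i (by simp [hi]))

theorem Temp1.comp {f : Y → F} {g : X → Y} (hf : Temp1 f) (hg : Temp1 g) :
    Temp1 (fun x => f (g x)) :=
  ⟨hf.contDiff.comp hg.contDiff, hf.growth.comp hg.growth,
    ((hf.growth'.comp hg.growth).norm.mul hg.growth'.norm).of_le fun x => by
      rw [fderiv_fun_comp x (hf.differentiable _) (hg.differentiable x)]
      simpa using ContinuousLinearMap.opNorm_comp_le _ _⟩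

theorem temp1_fst : Temp1 (fun p : X × Y => p.1) := temp1_clm (ContinuousLinearMap.fst ℝ X Y)

theorem temp1_snd : Temp1 (fun p : X × Y => p.2) := temp1_clm (ContinuousLinearMap.snd ℝ X Y)

theorem temp1_affine (x : X) (r : ℝ) : Temp1 (fun z : X => x + r • z) :=
  (temp1_const x).add (temp1_clm (r • ContinuousLinearMap.id ℝ X))

end Growth

section Integrability

open ProbabilityTheory

variable {X F : Type*} [NormedAddCommGroup X] [NormedSpace ℝ X] [NormedAddCommGroup F]
  [NormedSpace ℝ F] [MeasurableSpace X] [BorelSpace X] [SecondCountableTopology X] [CompleteSpace X]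

theorem integrable_one_add_norm_pow (ν : Measure X) [IsGaussian ν] (m : ℕ) :
    Integrable (fun x => (1 + ‖x‖) ^ m) ν := by
  have h0 : MemLp (fun x : X => ‖x‖) (m : ENNReal) ν :=
    (IsGaussian.memLp_id ν (m : ENNReal) (ENNReal.natCast_ne_top m)).norm
  have h : MemLp (fun x : X => 1 + ‖x‖) (m : ENNReal) ν := (memLp_const (1 : ℝ)).add h0
  refine h.integrable_norm_pow'.congr (Filter.Eventually.of_forall fun x => ?_)
  simp only [Real.norm_eq_abs]
  rw [abs_of_nonneg (by positivity)]

theorem Temp0.integrable {f : X → F} (hf : Temp0 f) {ν : Measure X}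
    [IsGaussian ν] : Integrable f ν := by
  obtain ⟨C, m, hC, hb⟩ := hf.growth
  exact ((integrable_one_add_norm_pow ν m).const_mul C).mono' hf.cont.aestronglyMeasurable
    (Filter.Eventually.of_forall hb)

end Integrability

/-- The Euclidean space on which the system is posed. -/
abbrev Eucl (n : ℕ) := EuclideanSpace ℝ (Fin n)

/-- The standard Gaussian probability measure. -/
abbrev gauss (n : ℕ) : Measure (Eucl n) := ProbabilityTheory.stdGaussian (Eucl n)

/-- The density of the standard Gaussian measure. -/
def gdens {n : ℕ} (z : Eucl n) : ℝ := (2 * Real.pi) ^ (-(n : ℝ) / 2) * Real.exp (-(1 / 2) * ‖z‖ ^ 2)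

/-- The `i`-th partial derivative. -/
def pd {n : ℕ} (i : Fin n) (f : Eucl n → ℝ) (x : Eucl n) : ℝ :=
  fderiv ℝ f x (EuclideanSpace.single i 1)

section Gaussian

variable {n : ℕ}

theorem gdens_pos (z : Eucl n) : 0 < gdens z := by unfold gdens; positivity

theorem continuous_gdens : Continuous (gdens (n := n)) := by unfold gdens; fun_prop

theorem integrable_exp_neg_sq {b : ℝ} (hb : 0 < b) :
    Integrable (fun z : Eucl n => Real.exp (-b * ‖z‖ ^ 2)) := by
  have h := (GaussianFourier.integrable_cexp_neg_mul_sq_norm_add (V := Eucl n)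
    (b := (b : ℂ)) (by simpa using hb) 0 0).norm
  refine h.congr (Filter.Eventually.of_forall fun z => ?_)
  simp only [Complex.norm_exp]
  norm_cast
  simp

theorem integrable_gdens : Integrable (gdens (n := n)) :=
  (integrable_exp_neg_sq (by norm_num)).const_mul _

theorem gauss_eq_withDensity :
    gauss n = volume.withDensity fun z => ENNReal.ofReal (gdens z) := by
  have hm : Measurable fun z : Eucl n => ENNReal.ofReal (gdens z) :=
    continuous_gdens.measurable.ennreal_ofReal
  have hfin : IsFiniteMeasure ((volume : Measure (Eucl n)).withDensity
      fun z => ENNReal.ofReal (gdens z)) :=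
    isFiniteMeasure_withDensity_ofReal integrable_gdens.2
  refine Measure.ext_of_charFun ?_
  ext t
  rw [ProbabilityTheory.charFun_stdGaussian, charFun_apply,
    integral_withDensity_eq_integral_toReal_smul hm (by simp)]
  have h := GaussianFourier.integral_cexp_neg_mul_sq_norm_add (V := Eucl n)
    (b := (1 / 2 : ℂ)) (by norm_num) Complex.I t
  have hc : ((2 * Real.pi : ℝ) : ℂ) ^ (-(n : ℂ) / 2) * ((Real.pi : ℂ) / (1 / 2)) ^ ((n : ℂ) / 2) = 1 := by
    have : (Real.pi : ℂ) / (1 / 2) = ((2 * Real.pi : ℝ) : ℂ) := by push_cast; ring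
    rw [this, ← Complex.cpow_add _ _ (by norm_cast; positivity), neg_div, neg_add_cancel,
      Complex.cpow_zero]
  have e : ∀ z : Eucl n, (ENNReal.ofReal (gdens z)).toReal • Complex.exp (⟪z, t⟫ * Complex.I)
      = ((2 * Real.pi : ℝ) : ℂ) ^ (-(n : ℂ) / 2) *
        Complex.exp (-(1 / 2) * ‖z‖ ^ 2 + Complex.I * ⟪t, z⟫) := by
    intro z
    rw [ENNReal.toReal_ofReal (gdens_pos z).le, Complex.real_smul, Complex.exp_add, gdens,
      real_inner_comm t z]
    push_cast
    rw [Complex.ofReal_cpow (by positivity)]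
    push_cast
    rw [mul_comm Complex.I, mul_assoc]
  simp_rw [e]
  rw [integral_const_mul, h, ← mul_assoc]
  simp only [finrank_euclideanSpace, Fintype.card_fin]
  rw [hc, one_mul, Complex.I_sq]
  congr 1
  ring

theorem integral_gauss (f : Eucl n → ℝ) : ∫ z, f z ∂(gauss n) = ∫ z, gdens z * f z := by
  rw [gauss_eq_withDensity, integral_withDensity_eq_integral_toReal_smul
    continuous_gdens.measurable.ennreal_ofReal (by simp)]
  simp_rw [ENNReal.toReal_ofReal (gdens_pos _).le, smul_eq_mul]

theorem integrable_gdens_mul {f : Eucl n → ℝ} (hf : Integrable f (gauss n)) :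
    Integrable (fun z => gdens z * f z) := by
  rw [gauss_eq_withDensity, integrable_withDensity_iff_integrable_smul'
    continuous_gdens.measurable.ennreal_ofReal (by simp)] at hf
  simpa only [ENNReal.toReal_ofReal (gdens_pos _).le, smul_eq_mul] using hf

theorem hasFDerivAt_gdens (z : Eucl n) :
    HasFDerivAt gdens (gdens z • (-(innerSL ℝ z))) z := by
  have h1 : HasFDerivAt (fun z : Eucl n => ‖z‖ ^ 2) (2 • (innerSL ℝ z)) z :=
    (hasStrictFDerivAt_norm_sq z).hasFDerivAt
  have h2 := ((h1.const_mul (-(1 / 2))).exp.const_mul ((2 * Real.pi) ^ (-(n : ℝ) / 2)))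
  refine h2.congr_fderiv ?_
  ext w
  simp [gdens]
  ring

theorem pd_gdens (i : Fin n) (z : Eucl n) : pd i gdens z = - (z i * gdens z) := by
  rw [pd, (hasFDerivAt_gdens z).fderiv]
  simp [EuclideanSpace.inner_single_right]
  ring

theorem Temp1.temp0_pd {f : Eucl n → ℝ} (hf : Temp1 f) (i : Fin n) : Temp0 (pd i f) :=
  hf.temp0_fderiv.clm_apply (temp0_const _)

theorem temp1_coord (i : Fin n) : Temp1 (fun z : Eucl n => z i) :=
  temp1_clm (EuclideanSpace.proj i : Eucl n →L[ℝ] ℝ)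

theorem integral_mul_coord_gauss {f : Eucl n → ℝ} (hf : Temp1 f) (i : Fin n) :
    ∫ z, f z * z i ∂(gauss n) = ∫ z, pd i f z ∂(gauss n) := by
  have hd : Differentiable ℝ (gdens (n := n)) := fun z => (hasFDerivAt_gdens z).differentiableAt
  have e : ∀ z : Eucl n, fderiv ℝ gdens z (EuclideanSpace.single i 1) = - (z i * gdens z) :=
    fun z => pd_gdens i z
  have h := integral_mul_fderiv_eq_neg_fderiv_mul_of_integrable (μ := (volume : Measure (Eucl n)))
    (f := f) (g := gdens) (v := EuclideanSpace.single i 1) ?_ ?_ ?_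
    (fun x _ => hf.differentiable x) (fun x _ => hd x)
  · rw [integral_gauss, integral_gauss]
    simp_rw [e] at h
    rw [← neg_inj, ← integral_neg]
    calc _ = ∫ x, f x * -(x i * gdens x) := by congr 1; ext x; ring
      _ = _ := by rw [h]; congr 2; ext x; rw [pd, mul_comm]
  · simpa only [mul_comm, pd] using integrable_gdens_mul ((hf.temp0_pd i).integrable (ν := gauss n))
  · simp_rw [e]
    refine (integrable_gdens_mul (((temp1_coord i).temp0.mul hf.temp0).neg.integrable
      (ν := gauss n))).congr (Filter.Eventually.of_forall fun z => ?_)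
    ring
  · simpa only [mul_comm] using integrable_gdens_mul (hf.temp0.integrable (ν := gauss n))

theorem integral_weight_le {F W : Eucl n → ℝ} (hF : Temp0 F) (hF0 : ∀ z, 0 ≤ F z)
    (hW : Temp0 W) {s K : ℝ} (hs : 0 < s)
    (hK : ∀ z, W z ≤ K * Real.exp ((1 - (s ^ 2)⁻¹) / 2 * ‖z‖ ^ 2)) :
    ∫ z, F z * W z ∂(gauss n) ≤ K * s ^ n * ∫ z, F (s • z) ∂(gauss n) := by
  have hc : ∫ z, F (s • z) ∂(gauss n) = (s ^ n)⁻¹ * ∫ z, gdens (s⁻¹ • z) * F z := by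
    rw [integral_gauss]
    have := Measure.integral_comp_smul (volume : Measure (Eucl n))
      (fun z => gdens (s⁻¹ • z) * F z) s
    simp only [smul_smul, inv_mul_cancel₀ hs.ne', one_smul, finrank_euclideanSpace,
      Fintype.card_fin, smul_eq_mul] at this
    rw [this, abs_of_pos (by positivity)]
  have hFs : Integrable (fun z => F (s • z)) (gauss n) :=
    (hF.comp (temp0_clm (s • ContinuousLinearMap.id ℝ (Eucl n)))).integrable
  have hi : Integrable (fun z : Eucl n => gdens (s⁻¹ • z) * F z) := by
    have := (integrable_gdens_mul hFs).comp_smul (R := s⁻¹) (by positivity)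
    simpa only [smul_smul, mul_inv_cancel₀ hs.ne', one_smul] using this
  rw [hc, integral_gauss]
  have : K * s ^ n * ((s ^ n)⁻¹ * ∫ z, gdens (s⁻¹ • z) * F z) =
      ∫ z, K * (gdens (s⁻¹ • z) * F z) := by
    rw [integral_const_mul]; field_simp
  rw [this]
  refine integral_mono (integrable_gdens_mul (hF.mul hW).integrable) (hi.const_mul K) fun z => ?_
  have e : gdens (s⁻¹ • z) = Real.exp ((1 - (s ^ 2)⁻¹) / 2 * ‖z‖ ^ 2) * gdens z := by
    unfold gdens
    rw [mul_left_comm, ← Real.exp_add, norm_smul, Real.norm_of_nonneg (by positivity)]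
    congr 2
    field_simp
    ring
  simp only [e]
  have := mul_le_mul_of_nonneg_right (hK z) (mul_nonneg (gdens_pos z).le (hF0 z))
  nlinarith [this]

theorem integral_le_dilate {F : Eucl n → ℝ} (hF : Temp0 F) (hF0 : ∀ z, 0 ≤ F z) {s : ℝ}
    (hs : 1 ≤ s) : ∫ z, F z ∂(gauss n) ≤ s ^ n * ∫ z, F (s • z) ∂(gauss n) := by
  have := integral_weight_le (K := 1) hF hF0 (temp0_const 1) (zero_lt_one.trans_le hs) fun z => by
    rw [one_mul]
    refine Real.one_le_exp (mul_nonneg (div_nonneg ?_ (by norm_num)) (by positivity))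
    have : (s ^ 2)⁻¹ ≤ 1 := inv_le_one_of_one_le₀ (by nlinarith)
    linarith
  simpa using this

theorem exists_pow_le_exp (k : ℕ) : ∃ K : ℝ, 0 < K ∧ ∀ t : ℝ, 0 ≤ t →
    (1 + t) ^ k ≤ K * Real.exp (3 / 8 * t ^ 2) := by
  refine ⟨k.factorial * Real.exp 2, by positivity, fun t ht => ?_⟩
  have h1 : (1 + t) ^ k ≤ k.factorial * Real.exp (1 + t) := by
    have := Real.pow_div_factorial_le_exp (1 + t) (by linarith) k
    rwa [div_le_iff₀ (by positivity), mul_comm] at this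
  refine h1.trans ?_
  rw [mul_assoc, ← Real.exp_add]
  refine mul_le_mul_of_nonneg_left (Real.exp_le_exp.2 ?_) (by positivity)
  nlinarith [sq_nonneg (t - 4 / 3)]

theorem exists_integral_poly_weight_le (n k : ℕ) : ∃ K : ℝ, 0 < K ∧ ∀ F : Eucl n → ℝ, Temp0 F →
    (∀ z, 0 ≤ F z) → ∫ z, F z * (1 + ‖z‖) ^ k ∂(gauss n) ≤ K * ∫ z, F ((2 : ℝ) • z) ∂(gauss n) := by
  obtain ⟨K, hK, h⟩ := exists_pow_le_exp k
  refine ⟨K * 2 ^ n, by positivity, fun F hF hF0 => ?_⟩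
  refine integral_weight_le hF hF0 (((temp0_const 1).add temp0_id.norm).pow k) (by norm_num)
    fun z => ?_
  convert h ‖z‖ (norm_nonneg z) using 3
  norm_num

end Gaussian

open ProbabilityTheory in
theorem Temp1.hasDerivAt_integral {Z : Type*} [NormedAddCommGroup Z] [NormedSpace ℝ Z]
    [MeasurableSpace Z] [BorelSpace Z] [SecondCountableTopology Z] [CompleteSpace Z]
    {ν : Measure Z} [IsGaussian ν] {Φ : ℝ × Z → ℝ} (hΦ : Temp1 Φ) {Φ' : ℝ → Z → ℝ}
    (hd : ∀ t z, HasDerivAt (fun t => Φ (t, z)) (Φ' t z) t) (t₀ : ℝ) :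
    HasDerivAt (fun t => ∫ z, Φ (t, z) ∂ν) (∫ z, Φ' t₀ z ∂ν) t₀ := by
  have hslice : ∀ t : ℝ, Temp0 (fun z : Z => ((t, z) : ℝ × Z)) := fun t =>
    ⟨by fun_prop, ⟨1 + |t|, 1, by positivity, fun z => by
      rw [Prod.norm_mk, pow_one]
      have h0 := mul_nonneg (abs_nonneg t) (norm_nonneg z)
      refine max_le ?_ ?_
      · rw [Real.norm_eq_abs]; nlinarith [norm_nonneg z]
      · nlinarith [abs_nonneg t]⟩⟩
  have he : ∀ t z, Φ' t z = fderiv ℝ Φ (t, z) (1, 0) := fun t z => by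
    have h1 : HasDerivAt (fun t : ℝ => ((t, z) : ℝ × Z)) (1, 0) t :=
      (hasDerivAt_id t).prodMk (hasDerivAt_const t z)
    exact (hd t z).unique ((hΦ.hasFDerivAt (t, z)).comp_hasDerivAt t h1)
  have hΦ'0 : Temp0 (fun p : ℝ × Z => fderiv ℝ Φ p (1, 0)) := hΦ.temp0_fderiv.clm_apply (temp0_const _)
  obtain ⟨C, m, hC, hb⟩ := hΦ'0.growth
  have hbd : Temp0 (fun z : Z => C * (2 + |t₀| + ‖z‖) ^ m) :=
    (temp0_const C).mul (((temp0_const _).add temp0_id.norm).pow m)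
  refine (hasDerivAt_integral_of_dominated_loc_of_deriv_le (μ := ν)
    (F := fun t z => Φ (t, z)) (F' := Φ') (ball_mem_nhds t₀ one_pos)
    (bound := fun z => C * (2 + |t₀| + ‖z‖) ^ m) ?_ ?_ ?_ ?_ hbd.integrable ?_).2
  · exact Filter.Eventually.of_forall fun t =>
      (hΦ.temp0.comp (hslice t)).cont.aestronglyMeasurable
  · exact (hΦ.temp0.comp (hslice t₀)).integrable
  · rw [funext (he t₀)]
    exact (hΦ'0.comp (hslice t₀)).cont.aestronglyMeasurable
  · refine Filter.Eventually.of_forall fun z t ht => ?_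
    rw [he]
    refine (hb (t, z)).trans ?_
    have h1 : |t| ≤ 1 + |t₀| := by
      have := abs_sub_abs_le_abs_sub t t₀
      rw [mem_ball, Real.dist_eq] at ht
      linarith
    have h2 : ‖((t, z) : ℝ × Z)‖ ≤ 1 + |t₀| + ‖z‖ := by
      rw [Prod.norm_mk]
      refine max_le ?_ ?_
      · rw [Real.norm_eq_abs]; linarith [norm_nonneg z]
      · linarith [abs_nonneg t₀]
    exact mul_le_mul_of_nonneg_left (pow_le_pow_left₀ (by positivity) (by linarith) m) hC
  · exact Filter.Eventually.of_forall fun z t _ => hd t z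

section Heat

variable {n : ℕ}

/-- The Gaussian average of `f` around `x` at scale `r`. -/
def heat (r : ℝ) (f : Eucl n → ℝ) (x : Eucl n) : ℝ := ∫ z, f (x + r • z) ∂(gauss n)

/-- Functions of class `C²` growing polynomially together with their derivatives. -/
def Temp2 (f : Eucl n → ℝ) : Prop := Temp1 f ∧ ∀ i, Temp1 (pd i f)

/-- The Laplacian as the sum of the pure second partial derivatives. -/
def plap (f : Eucl n → ℝ) (x : Eucl n) : ℝ := ∑ i, pd i (pd i f) x

/-- The squared norm of the gradient. -/
def gradSq (f : Eucl n → ℝ) (x : Eucl n) : ℝ := ∑ i, pd i f x ^ 2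

theorem gradSq_nonneg (f : Eucl n → ℝ) (x : Eucl n) : 0 ≤ gradSq f x :=
  Finset.sum_nonneg fun _ _ => sq_nonneg _

theorem Temp1.temp0_gradSq {f : Eucl n → ℝ} (hf : Temp1 f) : Temp0 (gradSq f) :=
  Temp0.sum fun i _ => (hf.temp0_pd i).pow 2

theorem Temp2.temp0_plap {f : Eucl n → ℝ} (hf : Temp2 f) : Temp0 (plap f) :=
  Temp0.sum fun i _ => (hf.2 i).temp0_pd i

theorem Temp0.affine {f : Eucl n → ℝ} (hf : Temp0 f) (x : Eucl n) (r : ℝ) :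
    Temp0 (fun z => f (x + r • z)) := hf.comp (temp1_affine x r).temp0

theorem Temp1.affine {f : Eucl n → ℝ} (hf : Temp1 f) (x : Eucl n) (r : ℝ) :
    Temp1 (fun z => f (x + r • z)) := hf.comp (temp1_affine x r)

theorem Temp0.integrable_affine {f : Eucl n → ℝ} (hf : Temp0 f) (x : Eucl n) (r : ℝ) :
    Integrable (fun z => f (x + r • z)) (gauss n) := (hf.affine x r).integrable

theorem fderiv_eq_sum (f : Eucl n → ℝ) (x z : Eucl n) : fderiv ℝ f x z = ∑ i, pd i f x * z i := by
  conv_lhs => rw [← (EuclideanSpace.basisFun (Fin n) ℝ).sum_repr z]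
  rw [map_sum]
  refine Finset.sum_congr rfl fun i _ => ?_
  rw [map_smul, smul_eq_mul, mul_comm]
  simp [pd]

theorem hasDerivAt_comp_line {f : Eucl n → ℝ} (hf : Temp1 f) (x e : Eucl n) (t : ℝ) :
    HasDerivAt (fun t => f (x + t • e)) (fderiv ℝ f (x + t • e) e) t := by
  have h1 : HasDerivAt (fun t : ℝ => x + t • e) e t := by
    simpa using ((hasDerivAt_id t).smul_const e).const_add x
  exact (hf.hasFDerivAt _).comp_hasDerivAt t h1

theorem pd_affine {f : Eucl n → ℝ} (hf : Temp1 f) (x : Eucl n) (r : ℝ) (i : Fin n) (z : Eucl n) :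
    pd i (fun z => f (x + r • z)) z = r * pd i f (x + r • z) := by
  have h1 : HasFDerivAt (fun z : Eucl n => x + r • z) (r • ContinuousLinearMap.id ℝ (Eucl n)) z :=
    ((r • ContinuousLinearMap.id ℝ (Eucl n)).hasFDerivAt).const_add x
  have := ((hf.hasFDerivAt (x + r • z)).comp z h1).fderiv
  rw [pd, show (fun z => f (x + r • z)) = f ∘ (fun z : Eucl n => x + r • z) from rfl, this]
  simp [pd]

theorem hasDerivAt_heat_scale {f : Eucl n → ℝ} (hf : Temp1 f) (x : Eucl n) (r : ℝ) :
    HasDerivAt (fun r => heat r f x) (∫ z, fderiv ℝ f (x + r • z) z ∂(gauss n)) r := by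
  refine Temp1.hasDerivAt_integral (Φ := fun p : ℝ × Eucl n => f (x + p.1 • p.2)) ?_
    (Φ' := fun r z => fderiv ℝ f (x + r • z) z) (fun t z => hasDerivAt_comp_line hf x z t) r
  exact hf.comp ((temp1_const x).add ((temp1_clm (ContinuousLinearMap.fst ℝ ℝ (Eucl n))).smul
    (temp1_clm (ContinuousLinearMap.snd ℝ ℝ (Eucl n)))))

theorem hasDerivAt_heat_line {f : Eucl n → ℝ} (hf : Temp1 f) (r : ℝ) (x e : Eucl n) (t : ℝ) :
    HasDerivAt (fun t => heat r f (x + t • e))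
      (∫ z, fderiv ℝ f (x + t • e + r • z) e ∂(gauss n)) t := by
  refine Temp1.hasDerivAt_integral (Φ := fun p : ℝ × Eucl n => f (x + p.1 • e + r • p.2)) ?_
    (Φ' := fun t z => fderiv ℝ f (x + t • e + r • z) e) (fun t z => ?_) t
  · exact hf.comp (((temp1_const x).add ((temp1_clm (ContinuousLinearMap.fst ℝ ℝ (Eucl n))).smul
      (temp1_const e))).add (temp1_clm (r • ContinuousLinearMap.snd ℝ ℝ (Eucl n))))
  · have := hasDerivAt_comp_line hf (x + r • z) e t
    simpa only [add_right_comm x (r • z)] using this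

theorem integral_fderiv_mul_affine {f g : Eucl n → ℝ} (hf : ∀ i, Temp1 (pd i f)) (hg : Temp1 g)
    (x : Eucl n) (r : ℝ) :
    ∫ z, g z * fderiv ℝ f (x + r • z) z ∂(gauss n) =
      ∫ z, (∑ i, pd i g z * pd i f (x + r • z) + r * (g z * plap f (x + r • z))) ∂(gauss n) := by
  simp_rw [fderiv_eq_sum, Finset.mul_sum, ← mul_assoc]
  have h1 : ∀ i, Temp1 (fun z => g z * pd i f (x + r • z)) := fun i => hg.mul ((hf i).affine x r)
  rw [integral_finsetSum _ fun i _ => ((h1 i).temp0.mul (temp1_coord i).temp0).integrable]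
  simp_rw [fun i => integral_mul_coord_gauss (h1 i) i]
  rw [← integral_finsetSum _ fun i _ => ((h1 i).temp0_pd i).integrable]
  congr 1
  ext z
  simp only [plap, Finset.mul_sum, ← Finset.sum_add_distrib]
  refine Finset.sum_congr rfl fun i _ => ?_
  rw [pd, fderiv_fun_mul (hg.differentiable z) (((hf i).affine x r).differentiable z)]
  have := pd_affine (hf i) x r i z
  rw [pd] at this
  simp only [add_apply, smul_apply, smul_eq_mul, this]
  simp only [pd]
  ring

theorem Temp2.hasDerivAt_heat {f : Eucl n → ℝ} (hf : Temp2 f) (x : Eucl n) (r : ℝ) :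
    HasDerivAt (fun r => heat r f x) (r * heat r (plap f) x) r := by
  convert hasDerivAt_heat_scale hf.1 x r using 1
  have := integral_fderiv_mul_affine hf.2 (temp1_const 1) x r
  simp only [one_mul] at this
  rw [this, heat, ← integral_const_mul]
  congr 1
  ext z
  simp [pd]

theorem heat_mono {f g : Eucl n → ℝ} (hf : Temp0 f) (hg : Temp0 g) (h : ∀ z, f z ≤ g z) (r : ℝ)
    (x : Eucl n) : heat r f x ≤ heat r g x :=
  integral_mono (hf.integrable_affine x r) (hg.integrable_affine x r) fun _ => h _

theorem heat_nonneg {f : Eucl n → ℝ} (h : ∀ z, 0 ≤ f z) (r : ℝ) (x : Eucl n) : 0 ≤ heat r f x :=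
  integral_nonneg fun _ => h _

theorem heat_zero (f : Eucl n → ℝ) (x : Eucl n) : heat 0 f x = f x := by simp [heat]

theorem heat_const (r c : ℝ) (x : Eucl n) : heat r (fun _ => c) x = c := by simp [heat]

theorem heat_add {f g : Eucl n → ℝ} (hf : Temp0 f) (hg : Temp0 g) (r : ℝ) (x : Eucl n) :
    heat r (fun z => f z + g z) x = heat r f x + heat r g x :=
  integral_add (hf.integrable_affine x r) (hg.integrable_affine x r)

theorem heat_sub {f g : Eucl n → ℝ} (hf : Temp0 f) (hg : Temp0 g) (r : ℝ) (x : Eucl n) :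
    heat r (fun z => f z - g z) x = heat r f x - heat r g x :=
  integral_sub (hf.integrable_affine x r) (hg.integrable_affine x r)

theorem heat_const_mul (c : ℝ) (f : Eucl n → ℝ) (r : ℝ) (x : Eucl n) :
    heat r (fun z => c * f z) x = c * heat r f x := integral_const_mul _ _

theorem heat_monotoneOn {f : Eucl n → ℝ} (hf : Temp2 f) (h : ∀ x, 0 ≤ plap f x) (x : Eucl n) :
    MonotoneOn (fun r => heat r f x) (Set.Ici 0) := by
  refine monotoneOn_of_deriv_nonneg (convex_Ici 0)
    (fun r _ => (hf.hasDerivAt_heat x r).continuousAt.continuousWithinAt)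
    (fun r _ => (hf.hasDerivAt_heat x r).differentiableAt.differentiableWithinAt) fun r hr => ?_
  rw [interior_Ici, Set.mem_Ioi] at hr
  rw [(hf.hasDerivAt_heat x r).deriv]
  exact mul_nonneg hr.le (heat_nonneg h _ _)

theorem le_heat {f : Eucl n → ℝ} (hf : Temp2 f) (h : ∀ x, 0 ≤ plap f x) (x : Eucl n) {r : ℝ}
    (hr : 0 ≤ r) : f x ≤ heat r f x := by
  simpa [heat_zero] using heat_monotoneOn hf h x (Set.mem_Ici.2 le_rfl) (Set.mem_Ici.2 hr) hr

theorem heat_le_heat {f : Eucl n → ℝ} (hf : Temp0 f) (h : ∀ x, 0 ≤ f x) (x : Eucl n) {r s : ℝ}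
    {c : ℝ} (hc : 1 ≤ c) (hs : s = c * r) : heat r f x ≤ c ^ n * heat s f x := by
  have := integral_le_dilate (hf.affine x r) (fun z => h _) hc
  simpa only [heat, hs, smul_smul, mul_comm] using this

theorem heat_cauchy_schwarz {f g : Eucl n → ℝ} (hf : Temp0 f) (hg : Temp0 g) (r : ℝ) (x : Eucl n) :
    heat r (fun z => f z * g z) x ^ 2 ≤ heat r (fun z => f z ^ 2) x * heat r (fun z => g z ^ 2) x := by
  have h : ∀ t : ℝ, 0 ≤ heat r (fun z => g z ^ 2) x * (t * t) +
      2 * heat r (fun z => f z * g z) x * t + heat r (fun z => f z ^ 2) x := fun t => by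
    have e : heat r (fun z => (t * t) * g z ^ 2 + (2 * t) * (f z * g z) + f z ^ 2) x =
      heat r (fun z => g z ^ 2) x * (t * t) +
      2 * heat r (fun z => f z * g z) x * t + heat r (fun z => f z ^ 2) x := by
      rw [heat_add (((temp0_const _).mul (hg.pow 2)).add ((temp0_const _).mul (hf.mul hg)))
        (hf.pow 2), heat_add ((temp0_const _).mul (hg.pow 2)) ((temp0_const _).mul (hf.mul hg)),
        heat_const_mul, heat_const_mul]
      ring
    rw [← e]
    refine heat_nonneg (fun z => ?_) _ _
    nlinarith [sq_nonneg (t * g z + f z)]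
  have := discrim_le_zero h
  rw [discrim] at this
  nlinarith

end Heat

section Poincare

variable {n : ℕ}

theorem integral_rotation {h : Eucl n × Eucl n → ℝ} (hh : Continuous h) (θ : ℝ) :
    ∫ p, h (Real.cos θ • p.1 + Real.sin θ • p.2, -Real.sin θ • p.1 + Real.cos θ • p.2)
      ∂((gauss n).prod (gauss n)) = ∫ p, h p ∂((gauss n).prod (gauss n)) := by
  have h1 := ProbabilityTheory.IsGaussian.map_rotation_eq_self (μ := gauss n)
    (by simp) θ
  conv_rhs => rw [← h1]
  rw [integral_map (ContinuousLinearMap.rotation θ).continuous.aemeasurable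
    hh.aestronglyMeasurable]
  rfl

theorem integral_prod_fst (h : Eucl n → ℝ) :
    ∫ p, h p.1 ∂((gauss n).prod (gauss n)) = ∫ z, h z ∂(gauss n) := by
  have := integral_fun_fst (μ := gauss n) (ν := gauss n) h
  simpa using this

theorem temp1_cos : Temp1 Real.cos := by
  refine ⟨Real.contDiff_cos, ⟨1, 0, zero_le_one, fun x => by simpa using Real.abs_cos_le_one x⟩,
    ⟨1, 0, zero_le_one, fun x => ?_⟩⟩
  rw [(Real.hasDerivAt_cos x).hasFDerivAt.fderiv]
  simpa [ContinuousLinearMap.norm_toSpanSingleton] using Real.abs_sin_le_one x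

theorem temp1_sin : Temp1 Real.sin := by
  refine ⟨Real.contDiff_sin, ⟨1, 0, zero_le_one, fun x => by simpa using Real.abs_sin_le_one x⟩,
    ⟨1, 0, zero_le_one, fun x => ?_⟩⟩
  rw [(Real.hasDerivAt_sin x).hasFDerivAt.fderiv]
  simpa [ContinuousLinearMap.norm_toSpanSingleton] using Real.abs_cos_le_one x

theorem integral_rotation_deriv_ge {f : Eucl n → ℝ} (hf : Temp1 f) {θ : ℝ} (hθ : 0 ≤ Real.sin θ) :
    - Real.sin θ * ∫ z, gradSq f z ∂(gauss n) ≤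
      ∫ p, f p.1 * fderiv ℝ f (Real.cos θ • p.1 + Real.sin θ • p.2)
        (-Real.sin θ • p.1 + Real.cos θ • p.2) ∂((gauss n).prod (gauss n)) := by
  set c := Real.cos θ with hc
  set s := Real.sin θ with hs
  have hcs : c ^ 2 + s ^ 2 = 1 := Real.cos_sq_add_sin_sq θ
  have t1 : Temp1 (fun p : Eucl n × Eucl n => p.1) := temp1_fst
  have t2 : Temp1 (fun p : Eucl n × Eucl n => p.2) := temp1_snd
  have t3 : Temp1 (fun p : Eucl n × Eucl n => c • p.1 + (-s) • p.2) :=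
    ((temp1_const c).smul t1).add ((temp1_const (-s)).smul t2)
  let h : Eucl n × Eucl n → ℝ := fun q => f (c • q.1 + (-s) • q.2) * fderiv ℝ f q.1 q.2
  have hh : Temp0 h := (hf.comp t3).temp0.mul
    ((hf.temp0_fderiv.comp t1.temp0).clm_apply t2.temp0)
  let k : Eucl n × Eucl n → ℝ := fun q => -s * ∑ i, pd i f q.1 * pd i f (c • q.1 + (-s) • q.2)
  have hk : Temp0 k := (temp0_const _).mul (.sum fun i _ => ((hf.temp0_pd i).comp t1.temp0).mul
    ((hf.temp0_pd i).comp t3.temp0))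
  have e1 : ∫ p, f p.1 * fderiv ℝ f (c • p.1 + s • p.2) (-s • p.1 + c • p.2)
      ∂((gauss n).prod (gauss n)) = ∫ q, h q ∂((gauss n).prod (gauss n)) := by
    rw [← integral_rotation hh.cont θ]
    congr 1
    ext p
    have : c • (c • p.1 + s • p.2) + (-s) • (-s • p.1 + c • p.2) = p.1 := by
      have : c • (c • p.1 + s • p.2) + (-s) • (-s • p.1 + c • p.2) = (c ^ 2 + s ^ 2) • p.1 := by
        module
      rw [this, hcs, one_smul]
    simp only [h, ← hc, ← hs, this]
  have e2 : ∫ q, h q ∂((gauss n).prod (gauss n)) = ∫ q, k q ∂((gauss n).prod (gauss n)) := by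
    rw [integral_prod _ hh.integrable, integral_prod _ hk.integrable]
    congr 1
    ext p
    simp only [h, k, fderiv_eq_sum, Finset.mul_sum]
    have g1 : Temp1 (fun z : Eucl n => f (c • p + (-s) • z)) := hf.affine _ _
    have : ∀ i, ∫ z, f (c • p + (-s) • z) * (pd i f p * z i) ∂(gauss n) =
        ∫ z, -s * (pd i f p * pd i f (c • p + (-s) • z)) ∂(gauss n) := fun i => by
      have e := integral_mul_coord_gauss g1 i
      simp_rw [pd_affine hf] at e
      calc _ = pd i f p * ∫ z, f (c • p + (-s) • z) * z i ∂(gauss n) := by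
            rw [← integral_const_mul]; congr 1; ext z; ring
        _ = _ := by rw [e, ← integral_const_mul]; congr 1; ext z; ring
    rw [integral_finsetSum, integral_finsetSum]
    · exact Finset.sum_congr rfl fun i _ => this i
    · exact fun i _ => ((temp0_const _).mul ((temp0_const _).mul
        ((hf.temp0_pd i).affine _ _))).integrable
    · exact fun i _ => (g1.temp0.mul ((temp0_const _).mul (temp1_coord i).temp0)).integrable
  let l : Eucl n × Eucl n → ℝ := fun q =>
    -s * (1 / 2 * gradSq f q.1 + 1 / 2 * gradSq f (c • q.1 + (-s) • q.2))
  have G1 : Temp0 (fun q : Eucl n × Eucl n => 1 / 2 * gradSq f q.1) :=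
    (temp0_const _).mul (hf.temp0_gradSq.comp t1.temp0)
  have G2 : Temp0 (fun q : Eucl n × Eucl n => 1 / 2 * gradSq f (c • q.1 + (-s) • q.2)) :=
    (temp0_const _).mul (hf.temp0_gradSq.comp t3.temp0)
  have e3 : ∫ q, l q ∂((gauss n).prod (gauss n)) = -s * ∫ z, gradSq f z ∂(gauss n) := by
    have r : ∫ q, gradSq f (c • q.1 + (-s) • q.2) ∂((gauss n).prod (gauss n)) =
        ∫ z, gradSq f z ∂(gauss n) := by
      rw [← integral_prod_fst, ← integral_rotation (h := fun q => gradSq f q.1)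
        (hf.temp0_gradSq.comp t1.temp0).cont (-θ)]
      simp only [Real.cos_neg, Real.sin_neg, hc, hs]
    simp only [l]
    rw [integral_const_mul, integral_add G1.integrable G2.integrable, integral_const_mul,
      integral_const_mul, r, integral_prod_fst]
    ring
  rw [e1, e2, ← e3]
  refine integral_mono ((temp0_const _).mul (G1.add G2)).integrable hk.integrable fun q => ?_
  simp only [l, k]
  refine mul_le_mul_of_nonpos_left ?_ (by linarith)
  simp only [gradSq, Finset.mul_sum, ← Finset.sum_add_distrib]
  refine Finset.sum_le_sum fun i _ => ?_
  nlinarith [sq_nonneg (pd i f q.1 - pd i f (c • q.1 + (-s) • q.2))]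

/-- The Gaussian Poincaré inequality. -/
theorem gauss_poincare {f : Eucl n → ℝ} (hf : Temp1 f) :
    ∫ z, f z ^ 2 ∂(gauss n) - (∫ z, f z ∂(gauss n)) ^ 2 ≤ ∫ z, gradSq f z ∂(gauss n) := by
  set D := ∫ z, gradSq f z ∂(gauss n) with hD
  let φ : ℝ → ℝ := fun θ => ∫ p, f p.1 * f (Real.cos θ • p.1 + Real.sin θ • p.2)
    ∂((gauss n).prod (gauss n))
  let φ' : ℝ → ℝ := fun θ => ∫ p, f p.1 * fderiv ℝ f (Real.cos θ • p.1 + Real.sin θ • p.2)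
    (-Real.sin θ • p.1 + Real.cos θ • p.2) ∂((gauss n).prod (gauss n))
  have hφ : ∀ θ, HasDerivAt φ (φ' θ) θ := by
    intro θ
    have t0 : Temp1 (fun q : ℝ × (Eucl n × Eucl n) => q.1) :=
      temp1_fst
    have t1 : Temp1 (fun q : ℝ × (Eucl n × Eucl n) => q.2.1) :=
      temp1_fst.comp temp1_snd
    have t2 : Temp1 (fun q : ℝ × (Eucl n × Eucl n) => q.2.2) :=
      temp1_snd.comp temp1_snd
    refine Temp1.hasDerivAt_integral (ν := (gauss n).prod (gauss n))
      (Φ' := fun θ p => f p.1 * fderiv ℝ f (Real.cos θ • p.1 + Real.sin θ • p.2)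
        (-Real.sin θ • p.1 + Real.cos θ • p.2))
      (Φ := fun q : ℝ × (Eucl n × Eucl n) =>
        f q.2.1 * f (Real.cos q.1 • q.2.1 + Real.sin q.1 • q.2.2))
      ((hf.comp t1).mul (hf.comp (((temp1_cos.comp t0).smul t1).add
        ((temp1_sin.comp t0).smul t2)))) (fun t z => ?_) θ
    have h1 : HasDerivAt (fun t => Real.cos t • z.1 + Real.sin t • z.2)
        (-Real.sin t • z.1 + Real.cos t • z.2) t :=
      ((Real.hasDerivAt_cos t).smul_const _).add ((Real.hasDerivAt_sin t).smul_const _)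
    have h2 := ((hf.hasFDerivAt _).comp_hasDerivAt t h1).const_mul (f z.1)
    exact h2
  have hg : ∀ θ, HasDerivAt (fun θ => φ θ - D * Real.cos θ) (φ' θ + D * Real.sin θ) θ := fun θ => by
    have := (hφ θ).sub ((Real.hasDerivAt_cos θ).const_mul D)
    rwa [mul_neg, sub_neg_eq_add] at this
  have hm : MonotoneOn (fun θ => φ θ - D * Real.cos θ) (Set.Icc 0 (Real.pi / 2)) := by
    refine monotoneOn_of_deriv_nonneg (convex_Icc _ _)
      (fun θ _ => (hg θ).continuousAt.continuousWithinAt)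
      (fun θ _ => (hg θ).differentiableAt.differentiableWithinAt) fun θ hθ => ?_
    rw [interior_Icc] at hθ
    rw [(hg θ).deriv]
    have := integral_rotation_deriv_ge hf
      (Real.sin_nonneg_of_nonneg_of_le_pi hθ.1.le (by linarith [hθ.2, Real.pi_pos]))
    simp only [φ']
    linarith
  have h01 := hm (Set.left_mem_Icc.2 (by positivity)) (Set.right_mem_Icc.2 (by positivity))
    (by positivity)
  have a0 : φ 0 = ∫ z, f z ^ 2 ∂(gauss n) := by
    simp only [φ, Real.cos_zero, Real.sin_zero, one_smul, zero_smul, add_zero]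
    rw [← integral_prod_fst (fun z => f z ^ 2)]
    simp only [sq]
  have a1 : φ (Real.pi / 2) = (∫ z, f z ∂(gauss n)) ^ 2 := by
    simp only [φ, Real.cos_pi_div_two, Real.sin_pi_div_two, one_smul, zero_smul, zero_add]
    rw [integral_prod_mul, sq]
  simp only [a0, a1, Real.cos_zero, Real.cos_pi_div_two] at h01
  linarith

theorem gradSq_affine {f : Eucl n → ℝ} (hf : Temp1 f) (x : Eucl n) (r : ℝ) (z : Eucl n) :
    gradSq (fun z => f (x + r • z)) z = r ^ 2 * gradSq f (x + r • z) := by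
  simp only [gradSq, pd_affine hf, mul_pow, Finset.mul_sum]

theorem heat_poincare {f : Eucl n → ℝ} (hf : Temp1 f) (r : ℝ) (x : Eucl n) :
    heat r (fun z => f z ^ 2) x - heat r f x ^ 2 ≤ r ^ 2 * heat r (gradSq f) x := by
  have := gauss_poincare (hf.affine x r)
  simp only [gradSq_affine hf, integral_const_mul] at this
  exact this

end Poincare

section Truncation

theorem hasDerivAt_max_pow (k : ℕ) (t : ℝ) :
    HasDerivAt (fun t : ℝ => max t 0 ^ (k + 2)) ((k + 2) * max t 0 ^ (k + 1)) t := by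
  have hne : ∀ t : ℝ, t ≠ 0 →
      HasDerivAt (fun t : ℝ => max t 0 ^ (k + 2)) ((k + 2) * max t 0 ^ (k + 1)) t := by
    intro t ht
    rcases lt_or_gt_of_ne ht with h | h
    · have : (fun t : ℝ => max t 0 ^ (k + 2)) =ᶠ[nhds t] fun _ => 0 := by
        filter_upwards [gt_mem_nhds h] with s hs
        rw [max_eq_right hs.le, zero_pow (by omega)]
      rw [max_eq_right h.le, zero_pow (by omega), mul_zero]
      exact (hasDerivAt_const t 0).congr_of_eventuallyEq this
    · have : (fun t : ℝ => max t 0 ^ (k + 2)) =ᶠ[nhds t] fun s => s ^ (k + 2) := by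
        filter_upwards [lt_mem_nhds h] with s hs
        rw [max_eq_left hs.le]
      rw [max_eq_left h.le]
      have := (hasDerivAt_pow (k + 2) t).congr_of_eventuallyEq this
      simpa using this
  rcases eq_or_ne t 0 with rfl | h
  · refine hasDerivAt_of_hasDerivAt_of_ne (g := fun t : ℝ => (k + 2) * max t 0 ^ (k + 1))
      (fun y hy => hne y hy) ?_ ?_ <;> fun_prop
  · exact hne t h

theorem contDiff_max_pow (k : ℕ) : ContDiff ℝ 1 (fun t : ℝ => max t 0 ^ (k + 2)) := by
  rw [contDiff_one_iff_deriv]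
  refine ⟨fun t => (hasDerivAt_max_pow k t).differentiableAt, ?_⟩
  rw [funext fun t => (hasDerivAt_max_pow k t).deriv]
  fun_prop

end Truncation

section Kernel

variable {n : ℕ}

theorem integrable_mul_of_support {F η : Eucl n → ℝ} (hF : Continuous F) (hη : Continuous η)
    (h0 : ∀ h, 1 ≤ ‖h‖ → η h = 0) : Integrable (fun h => F h * η h) := by
  refine (hF.mul hη).integrable_of_hasCompactSupport ?_
  refine HasCompactSupport.intro (isCompact_closedBall (0 : Eucl n) 1) fun h hh => ?_
  rw [mem_closedBall, dist_zero_right, not_le] at hh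
  simp [h0 h hh.le]

theorem hasDerivAt_integral_kernel {f η : Eucl n → ℝ} (hf : ContDiff ℝ 1 f) (hη : Continuous η)
    (h0 : ∀ h, 1 ≤ ‖h‖ → η h = 0) (x : Eucl n) (r : ℝ) :
    HasDerivAt (fun r : ℝ => ∫ h, f (x + r • h) * η h) (∫ h, fderiv ℝ f (x + r • h) h * η h) r := by
  have hd : Continuous (fderiv ℝ f) := hf.continuous_fderiv (by norm_num)
  have hc : Continuous (fun p : ℝ × Eucl n => ‖fderiv ℝ f (x + p.1 • p.2) p.2‖) := by
    exact ((hd.comp (by fun_prop)).clm_apply (by fun_prop)).norm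
  obtain ⟨C, hC⟩ := ((isCompact_Icc (a := r - 1) (b := r + 1)).prod
    (isCompact_closedBall (0 : Eucl n) 1)).bddAbove_image hc.continuousOn
  have hcd : ∀ t : ℝ, Continuous fun h : Eucl n => fderiv ℝ f (x + t • h) h := fun t =>
    (hd.comp (by fun_prop)).clm_apply (by fun_prop)
  have hcf : ∀ t : ℝ, Continuous fun h : Eucl n => f (x + t • h) := fun t =>
    hf.continuous.comp (by fun_prop)
  refine (hasDerivAt_integral_of_dominated_loc_of_deriv_le (μ := (volume : Measure (Eucl n)))
    (F := fun (t : ℝ) h => f (x + t • h) * η h) (F' := fun t h => fderiv ℝ f (x + t • h) h * η h)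
    (bound := fun h => C * ‖η h‖) (ball_mem_nhds r one_pos) ?_ ?_ ?_ ?_ ?_ ?_).2
  · exact Filter.Eventually.of_forall fun t => ((hcf t).mul hη).aestronglyMeasurable
  · exact integrable_mul_of_support (hcf r) hη h0
  · exact ((hcd r).mul hη).aestronglyMeasurable
  · refine Filter.Eventually.of_forall fun h t ht => ?_
    rw [norm_mul]
    rcases le_or_gt 1 ‖h‖ with hh | hh
    · simp [h0 h hh]
    · rw [Real.ball_eq_Ioo] at ht
      have hm : ((t, h) : ℝ × Eucl n) ∈ Set.Icc (r - 1) (r + 1) ×ˢ closedBall (0 : Eucl n) 1 :=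
        ⟨⟨ht.1.le, ht.2.le⟩, by simpa using hh.le⟩
      exact mul_le_mul_of_nonneg_right (hC (Set.mem_image_of_mem _ hm)) (norm_nonneg _)
  · exact integrable_mul_of_support continuous_const hη.norm fun h hh => by simp [h0 h hh]
  · refine Filter.Eventually.of_forall fun h t _ => ?_
    have h1 : HasDerivAt (fun t : ℝ => x + t • h) h t := by
      simpa using ((hasDerivAt_id t).smul_const h).const_add x
    have h2 := ((hf.differentiable (by norm_num) (x + t • h)).hasFDerivAt).comp_hasDerivAt t h1
    exact h2.mul_const (η h)

theorem integral_mul_pd_kernel {f η : Eucl n → ℝ} (hf : ContDiff ℝ 1 f) (hη : ContDiff ℝ 1 η)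
    (h0 : ∀ h, 1 ≤ ‖h‖ → η h = 0) (i : Fin n) :
    ∫ h, f h * pd i η h = - ∫ h, pd i f h * η h := by
  have hd : Continuous (pd i f) :=
    (hf.continuous_fderiv (by norm_num)).clm_apply continuous_const
  have hcs : HasCompactSupport η := HasCompactSupport.intro (isCompact_closedBall (0 : Eucl n) 1)
    fun h hh => h0 h (by
      rw [mem_closedBall, dist_zero_right, not_le] at hh
      exact hh.le)
  have hdη : Continuous (pd i η) :=
    (hη.continuous_fderiv (by norm_num)).clm_apply continuous_const
  have hsη : HasCompactSupport (pd i η) := hcs.fderiv_apply ℝ _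
  exact integral_mul_fderiv_eq_neg_fderiv_mul_of_integrable
    (integrable_mul_of_support hd hη.continuous h0)
    ((hf.continuous.mul hdη).integrable_of_hasCompactSupport hsη.mul_left)
    (integrable_mul_of_support hf.continuous hη.continuous h0)
    (fun h _ => hf.differentiable (by norm_num) h)
    (fun h _ => hη.differentiable (by norm_num) h)

/-- The radial kernel `max(1 - |h|², 0) ^ k`. -/
def kern (k : ℕ) (h : Eucl n) : ℝ := max (1 - ‖h‖ ^ 2) 0 ^ k

theorem kern_nonneg (k : ℕ) (h : Eucl n) : 0 ≤ kern k h := pow_nonneg (le_max_right _ _) _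

theorem kern_eq_zero {k : ℕ} (hk : k ≠ 0) (h : Eucl n) (hh : 1 ≤ ‖h‖) : kern k h = 0 := by
  rw [kern, max_eq_right (by nlinarith), zero_pow hk]

theorem contDiff_kern (k : ℕ) : ContDiff ℝ 1 (kern (n := n) (k + 2)) :=
  (contDiff_max_pow k).comp (contDiff_const.sub (contDiff_norm_sq ℝ))

theorem pd_kern (k : ℕ) (i : Fin n) (h : Eucl n) :
    pd i (kern (k + 2)) h = - (2 * (k + 2)) * (h i * kern (k + 1) h) := by
  have h1 : HasFDerivAt (fun h : Eucl n => 1 - ‖h‖ ^ 2) (-(2 • innerSL ℝ h)) h :=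
    (hasStrictFDerivAt_norm_sq h).hasFDerivAt.const_sub 1
  have h2 := (hasDerivAt_max_pow k (1 - ‖h‖ ^ 2)).comp_hasFDerivAt h h1
  have e : kern (k + 2) = (fun t : ℝ => max t 0 ^ (k + 2)) ∘ fun h : Eucl n => 1 - ‖h‖ ^ 2 := rfl
  rw [pd, e, h2.fderiv]
  simp [EuclideanSpace.inner_single_right, kern]
  ring

theorem continuous_kern (k : ℕ) : Continuous (kern (n := n) k) := by
  unfold kern; fun_prop

theorem integrable_kern : Integrable (kern (n := n) 2) := by
  simpa using integrable_mul_of_support (F := fun _ => 1) continuous_const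
    (continuous_kern (n := n) 2) (kern_eq_zero (by norm_num))

theorem integral_kern_pos : 0 < ∫ h : Eucl n, kern 2 h := by
  rw [integral_pos_iff_support_of_nonneg (kern_nonneg 2) integrable_kern]
  refine (measure_ball_pos volume (0 : Eucl n) one_pos).trans_le (measure_mono fun h hh => ?_)
  rw [mem_ball, dist_zero_right] at hh
  rw [Function.mem_support, kern, max_eq_left (by nlinarith [norm_nonneg h])]
  have : 0 < 1 - ‖h‖ ^ 2 := by nlinarith [norm_nonneg h]
  positivity

theorem contDiff_pd {f : Eucl n → ℝ} (hf : ContDiff ℝ (⊤ : ℕ∞) f) (i : Fin n) :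
    ContDiff ℝ (⊤ : ℕ∞) (pd i f) :=
  (hf.fderiv_right (m := (⊤ : ℕ∞)) (by simp)).clm_apply contDiff_const

theorem contDiff_plap {f : Eucl n → ℝ} (hf : ContDiff ℝ (⊤ : ℕ∞) f) :
    ContDiff ℝ (⊤ : ℕ∞) (plap f) :=
  ContDiff.sum fun i _ => contDiff_pd (contDiff_pd hf i) i

theorem ContDiff.one_of_top {f : Eucl n → ℝ} (hf : ContDiff ℝ (⊤ : ℕ∞) f) : ContDiff ℝ 1 f :=
  hf.of_le (by exact_mod_cast le_top)

theorem pd_pd {f : Eucl n → ℝ} (hf : ContDiff ℝ (⊤ : ℕ∞) f) (i j : Fin n) (x : Eucl n) :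
    pd i (pd j f) x = fderiv ℝ (fderiv ℝ f) x (EuclideanSpace.single i 1)
      (EuclideanSpace.single j 1) := by
  have h1 : DifferentiableAt ℝ (fderiv ℝ f) x :=
    (hf.fderiv_right (m := (⊤ : ℕ∞)) (by simp)).differentiable (by simp) x
  have := fderiv_clm_apply h1 (differentiableAt_const (EuclideanSpace.single j (1 : ℝ)))
  rw [pd]
  unfold pd
  rw [this]
  simp

theorem pd_comm {f : Eucl n → ℝ} (hf : ContDiff ℝ (⊤ : ℕ∞) f) (i j : Fin n) (x : Eucl n) :
    pd i (pd j f) x = pd j (pd i f) x := by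
  rw [pd_pd hf, pd_pd hf]
  exact (hf.contDiffAt.isSymmSndFDerivAt (by
    rw [minSmoothness_of_isRCLikeNormedField]
    exact WithTop.coe_le_coe.2 (le_top (a := (2 : ℕ∞))))).eq _ _

theorem pd_sum {ι : Type*} (s : Finset ι) {f : ι → Eucl n → ℝ} (hf : ∀ j ∈ s, Differentiable ℝ (f j))
    (i : Fin n) (x : Eucl n) : pd i (fun x => ∑ j ∈ s, f j x) x = ∑ j ∈ s, pd i (f j) x := by
  rw [pd, fderiv_fun_sum fun j hj => hf j hj x]
  simp [pd]

theorem plap_pd {f : Eucl n → ℝ} (hf : ContDiff ℝ (⊤ : ℕ∞) f) (i : Fin n) (x : Eucl n) :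
    plap (pd i f) x = pd i (plap f) x := by
  unfold plap
  rw [pd_sum _ fun j _ => (contDiff_pd (contDiff_pd hf j) j).differentiable (by simp)]
  refine Finset.sum_congr rfl fun j _ => ?_
  rw [pd_comm (contDiff_pd hf j) i j, funext fun y => pd_comm hf i j y]

theorem lap_eq_plap {f : Eucl n → ℝ} (hf : ContDiff ℝ (⊤ : ℕ∞) f) (x : Eucl n) :
    lap f x = plap f x := by
  simp only [lap, plap, iteratedFDeriv_two_apply, pd_pd hf]

theorem pd_affine' {f : Eucl n → ℝ} (hf : ContDiff ℝ 1 f) (x : Eucl n) (r : ℝ) (i : Fin n)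
    (z : Eucl n) : pd i (fun z => f (x + r • z)) z = r * pd i f (x + r • z) := by
  have h1 : HasFDerivAt (fun z : Eucl n => x + r • z) (r • ContinuousLinearMap.id ℝ (Eucl n)) z :=
    ((r • ContinuousLinearMap.id ℝ (Eucl n)).hasFDerivAt).const_add x
  have := ((hf.differentiable (by norm_num) (x + r • z)).hasFDerivAt.comp z h1).fderiv
  rw [pd, show (fun z => f (x + r • z)) = f ∘ (fun z : Eucl n => x + r • z) from rfl, this]
  simp [pd]

theorem integral_fderiv_kern {f : Eucl n → ℝ} (hf : ContDiff ℝ (⊤ : ℕ∞) f) (x : Eucl n) (r : ℝ) :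
    ∫ h, fderiv ℝ f (x + r • h) h * kern 2 h = r / 6 * ∫ h, plap f (x + r • h) * kern 3 h := by
  have ha : ContDiff ℝ 1 (fun z : Eucl n => x + r • z) := by fun_prop
  have hpf : ∀ i, ContDiff ℝ 1 (pd i f) := fun i => (contDiff_pd hf i).one_of_top
  have hpp : ∀ i, Continuous (pd i (pd i f)) :=
    fun i => (contDiff_pd (contDiff_pd hf i) i).continuous
  have h1 : ∀ i, ∫ h : Eucl n, pd i f (x + r • h) * (h i * kern 2 h) =
      r / 6 * ∫ h, pd i (pd i f) (x + r • h) * kern 3 h := fun i => by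
    have := integral_mul_pd_kernel ((hpf i).comp ha) (contDiff_kern 1) (kern_eq_zero (by norm_num)) i
    simp only [pd_kern, Function.comp_def, pd_affine' (hpf i)] at this
    have e1 : ∀ h : Eucl n, pd i f (x + r • h) * (-(2 * (((1 : ℕ) : ℝ) + 2)) * (h i * kern (1 + 1) h)) =
        -6 * (pd i f (x + r • h) * (h i * kern 2 h)) := fun h => by push_cast; ring
    simp only [e1, integral_const_mul, mul_assoc] at this
    norm_num at this
    linarith
  simp_rw [fderiv_eq_sum, plap, Finset.sum_mul, mul_assoc]
  rw [integral_finsetSum, integral_finsetSum, Finset.mul_sum]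
  · exact Finset.sum_congr rfl fun i _ => h1 i
  · exact fun i _ => integrable_mul_of_support ((hpp i).comp ha.continuous) (continuous_kern 3)
      (kern_eq_zero (by norm_num))
  · intro i _
    refine integrable_mul_of_support ((hpf i).continuous.comp ha.continuous)
      (η := fun h : Eucl n => h i * kern 2 h)
      ((temp1_coord i).temp0.cont.mul (continuous_kern 2)) fun h hh => ?_
    rw [kern_eq_zero (by norm_num) h hh, mul_zero]

theorem exists_kern_mean {f : Eucl n → ℝ} (hf : ContDiff ℝ (⊤ : ℕ∞) f) (x : Eucl n) :
    ∃ ρ ∈ Set.Ioo (0 : ℝ) 1, (∫ h, f (x + h) * kern 2 h) - f x * ∫ h : Eucl n, kern 2 h =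
      ρ / 6 * ∫ h, plap f (x + ρ • h) * kern 3 h := by
  have hd := fun r => hasDerivAt_integral_kernel hf.one_of_top (continuous_kern 2)
    (kern_eq_zero (by norm_num)) x r
  obtain ⟨ρ, hρ, e⟩ := exists_hasDerivAt_eq_slope _ _ (zero_lt_one (α := ℝ))
    (fun r _ => (hd r).continuousAt.continuousWithinAt) (fun r _ => hd r)
  refine ⟨ρ, hρ, ?_⟩
  rw [← integral_fderiv_kern hf, e]
  simp [integral_const_mul]

theorem kern_mean_value {f : Eucl n → ℝ} (hf : ContDiff ℝ (⊤ : ℕ∞) f) (h0 : ∀ x, 0 ≤ plap f x)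
    (x : Eucl n) : f x * ∫ h : Eucl n, kern 2 h ≤ ∫ h, f (x + h) * kern 2 h := by
  obtain ⟨ρ, hρ, e⟩ := exists_kern_mean hf x
  have : 0 ≤ ρ / 6 * ∫ h, plap f (x + ρ • h) * kern 3 h :=
    mul_nonneg (by linarith [hρ.1]) (integral_nonneg fun h => mul_nonneg (h0 _) (kern_nonneg _ _))
  linarith

theorem kern_le_one (k : ℕ) (h : Eucl n) : kern k h ≤ 1 :=
  pow_le_one₀ (le_max_right _ _) (max_le (by nlinarith [sq_nonneg ‖h‖]) zero_le_one)

theorem abs_integral_coord_kern_le {F : Eucl n → ℝ} {A : ℝ} {k : ℕ}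
    (hk : k ≠ 0) (hA : ∀ h, ‖h‖ ≤ 1 → |F h| ≤ A) (i : Fin n) :
    |∫ h, F h * (h i * kern k h)| ≤ A * (volume (closedBall (0 : Eucl n) 1)).toReal := by
  rw [← setIntegral_eq_integral_of_forall_compl_eq_zero (s := closedBall (0 : Eucl n) 1)]
  · have := norm_setIntegral_le_of_norm_le_const (μ := volume) (s := closedBall (0 : Eucl n) 1)
      (f := fun h => F h * (h i * kern k h)) (C := A)
      (isCompact_closedBall _ _).measure_lt_top fun h hh => ?_
    · exact this
    · rw [mem_closedBall, dist_zero_right] at hh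
      rw [norm_mul, norm_mul, Real.norm_eq_abs]
      have h1 : ‖h i‖ ≤ 1 := (PiLp.norm_apply_le h i).trans hh
      have h2 : ‖kern k h‖ ≤ 1 := by
        rw [Real.norm_of_nonneg (kern_nonneg _ _)]; exact kern_le_one k h
      calc _ ≤ A * (1 * 1) := mul_le_mul (hA h hh) (mul_le_mul h1 h2 (norm_nonneg _) zero_le_one)
            (by positivity) ((abs_nonneg _).trans (hA h hh))
        _ = A := by ring
  · intro h hh
    rw [mem_closedBall, dist_zero_right, not_le] at hh
    rw [kern_eq_zero hk h hh.le]
    ring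

theorem abs_pd_le {f : Eucl n → ℝ} (hf : ContDiff ℝ (⊤ : ℕ∞) f) {x : Eucl n} {A : ℝ}
    (hA : ∀ h, ‖h‖ ≤ 1 → |f (x + h)| ≤ A) (hB : ∀ h, ‖h‖ ≤ 1 → |plap f (x + h)| ≤ A) (i : Fin n) :
    |pd i f x| * ∫ h : Eucl n, kern 2 h ≤ 5 * A * (volume (closedBall (0 : Eucl n) 1)).toReal := by
  obtain ⟨ρ, hρ, e⟩ := exists_kern_mean (contDiff_pd hf i) x
  have ha : ∀ r : ℝ, ContDiff ℝ 1 (fun z : Eucl n => x + r • z) := fun r => by fun_prop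
  have e1 : ∫ h, pd i f (x + h) * kern 2 h = 4 * ∫ h, f (x + h) * (h i * kern 1 h) := by
    have := integral_mul_pd_kernel (hf.one_of_top.comp (ha 1)) (contDiff_kern 0)
      (kern_eq_zero (by norm_num)) i
    simp only [pd_kern, Function.comp_def, pd_affine' hf.one_of_top] at this
    have e2 : ∀ h : Eucl n, f (x + h) * (-(2 * (((0 : ℕ) : ℝ) + 2)) * (h i * kern (0 + 1) h)) =
        -4 * (f (x + h) * (h i * kern 1 h)) := fun h => by push_cast; ring
    simp only [one_mul, one_smul, e2, integral_const_mul] at this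
    linarith
  have e3 : ρ * ∫ h, plap (pd i f) (x + ρ • h) * kern 3 h =
      6 * ∫ h, plap f (x + ρ • h) * (h i * kern 2 h) := by
    have hp := (contDiff_plap hf).one_of_top
    have := integral_mul_pd_kernel (hp.comp (ha ρ)) (contDiff_kern 1)
      (kern_eq_zero (by norm_num)) i
    simp only [pd_kern, Function.comp_def, pd_affine' hp] at this
    have e2 : ∀ h : Eucl n, plap f (x + ρ • h) * (-(2 * (((1 : ℕ) : ℝ) + 2)) * (h i * kern (1 + 1) h)) =
        -6 * (plap f (x + ρ • h) * (h i * kern 2 h)) := fun h => by push_cast; ring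
    simp only [e2, integral_const_mul, mul_assoc] at this
    simp only [plap_pd hf]
    norm_num at this
    linarith
  have b1 := abs_integral_coord_kern_le one_ne_zero hA i
  have b2 := abs_integral_coord_kern_le (F := fun h => plap f (x + ρ • h)) (k := 2) two_ne_zero
    (fun h hh => hB (ρ • h) (by
      rw [norm_smul, Real.norm_of_nonneg hρ.1.le]
      nlinarith [hρ.1, hρ.2, norm_nonneg h])) i
  rw [← abs_of_pos (integral_kern_pos (n := n)), ← abs_mul]
  have : pd i f x * ∫ h : Eucl n, kern 2 h = 4 * (∫ h, f (x + h) * (h i * kern 1 h)) -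
      ∫ h, plap f (x + ρ • h) * (h i * kern 2 h) := by
    rw [← e1]
    linarith
  rw [this]
  refine (abs_sub _ _).trans ?_
  rw [abs_mul, abs_of_pos (by norm_num : (0 : ℝ) < 4)]
  linarith

theorem polyGrowth_pd {f : Eucl n → ℝ} (hf : ContDiff ℝ (⊤ : ℕ∞) f) (h0 : PolyGrowth f)
    (h1 : PolyGrowth (plap f)) (i : Fin n) : PolyGrowth (pd i f) := by
  obtain ⟨C, m, hC, hb⟩ := h0.norm.add h1.norm
  have hb' : ∀ x, |f x| + |plap f x| ≤ C * (1 + ‖x‖) ^ m := fun x => (le_abs_self _).trans (hb x)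
  set V := (volume (closedBall (0 : Eucl n) 1)).toReal
  have hc := integral_kern_pos (n := n)
  refine ⟨5 * (C * 2 ^ m) * V / ∫ h : Eucl n, kern 2 h, m, by positivity, fun x => ?_⟩
  have hx : ∀ h : Eucl n, ‖h‖ ≤ 1 → C * (1 + ‖x + h‖) ^ m ≤ C * 2 ^ m * (1 + ‖x‖) ^ m := by
    intro h hh
    rw [mul_assoc, ← mul_pow]
    gcongr
    linarith [norm_add_le x h, norm_nonneg x]
  have := abs_pd_le hf (x := x) (A := C * 2 ^ m * (1 + ‖x‖) ^ m)
    (fun h hh => ((le_add_of_nonneg_right (abs_nonneg _)).trans (hb' _)).trans (hx h hh))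
    (fun h hh => ((le_add_of_nonneg_left (abs_nonneg _)).trans (hb' _)).trans (hx h hh)) i
  rw [Real.norm_eq_abs, div_mul_eq_mul_div, le_div_iff₀ hc]
  linarith

theorem temp1_of_polyGrowth_pd {f : Eucl n → ℝ} (hf : ContDiff ℝ (⊤ : ℕ∞) f) (h0 : PolyGrowth f)
    (h1 : ∀ i, PolyGrowth (pd i f)) : Temp1 f := by
  refine ⟨hf.one_of_top, h0, (PolyGrowth.sum (s := Finset.univ) fun i _ => (h1 i).norm).of_le
    fun x => ?_⟩
  refine (ContinuousLinearMap.opNorm_le_bound _ (Finset.sum_nonneg fun i _ => norm_nonneg _)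
    fun z => ?_).trans (le_abs_self _)
  rw [fderiv_eq_sum, Finset.sum_mul]
  refine (norm_sum_le _ _).trans (Finset.sum_le_sum fun i _ => ?_)
  rw [norm_mul]
  exact mul_le_mul_of_nonneg_left (PiLp.norm_apply_le z i) (norm_nonneg _)

theorem temp2_of_polyGrowth {f : Eucl n → ℝ} (hf : ContDiff ℝ (⊤ : ℕ∞) f) (h0 : PolyGrowth f)
    (h1 : PolyGrowth (plap f)) (h2 : ∀ i, PolyGrowth (pd i (plap f))) : Temp2 f := by
  have hp := fun i => polyGrowth_pd hf h0 h1 i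
  refine ⟨temp1_of_polyGrowth_pd hf h0 hp, fun i => ?_⟩
  refine temp1_of_polyGrowth_pd (contDiff_pd hf i) (hp i) fun j => ?_
  refine polyGrowth_pd (contDiff_pd hf i) (hp i) ?_ j
  rw [funext fun x => plap_pd hf i x]
  exact h2 i

end Kernel

section Solution

variable {n : ℕ}

/-- A positive solution of the system with linear growth, together with the growth of its
derivatives. -/
structure TempSol (C : ℝ) (u v : Eucl n → ℝ) : Prop where
  smooth_u : ContDiff ℝ (⊤ : ℕ∞) u
  smooth_v : ContDiff ℝ (⊤ : ℕ∞) v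
  temp_u : Temp2 u
  temp_v : Temp2 v
  pos_u : ∀ x, 0 < u x
  pos_v : ∀ x, 0 < v x
  eq_u : ∀ x, plap u x = u x * v x ^ 2
  eq_v : ∀ x, plap v x = v x * u x ^ 2
  linear : ∀ x, u x + v x ≤ C * (1 + ‖x‖)

theorem TempSol.symm {C : ℝ} {u v : Eucl n → ℝ} (h : TempSol C u v) : TempSol C v u :=
  ⟨h.smooth_v, h.smooth_u, h.temp_v, h.temp_u, h.pos_v, h.pos_u, h.eq_v, h.eq_u, fun x => by linarith [h.linear x]⟩

theorem IsSolution.tempSol {C : ℝ} (hC : 0 < C) {u v : Eucl n → ℝ} (h : IsSolution u v)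
    (hg : ∀ x, u x + v x ≤ C * (1 + ‖x‖)) : TempSol C u v := by
  obtain ⟨su, sv, pu, pv, eu, ev⟩ := h
  simp_rw [lap_eq_plap su] at eu
  simp_rw [lap_eq_plap sv] at ev
  have gu : PolyGrowth u := ⟨C, 1, hC.le, fun x => by
    rw [Real.norm_of_nonneg (pu x).le, pow_one]; linarith [hg x, pv x]⟩
  have gv : PolyGrowth v := ⟨C, 1, hC.le, fun x => by
    rw [Real.norm_of_nonneg (pv x).le, pow_one]; linarith [hg x, pu x]⟩
  have hpu : plap u = fun x => u x * v x ^ 2 := funext eu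
  have hpv : plap v = fun x => v x * u x ^ 2 := funext ev
  have gpu : PolyGrowth (plap u) := by
    rw [hpu]; simpa only [sq] using gu.mul (gv.mul gv)
  have gpv : PolyGrowth (plap v) := by
    rw [hpv]; simpa only [sq] using gv.mul (gu.mul gu)
  have tu : Temp1 u := temp1_of_polyGrowth_pd su gu (polyGrowth_pd su gu gpu)
  have tv : Temp1 v := temp1_of_polyGrowth_pd sv gv (polyGrowth_pd sv gv gpv)
  refine ⟨su, sv, temp2_of_polyGrowth su gu gpu fun i => ?_, temp2_of_polyGrowth sv gv gpv fun i => ?_,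
    pu, pv, eu, ev, hg⟩
  · rw [hpu]; exact ((tu.mul (tv.pow 2)).temp0_pd i).growth
  · rw [hpv]; exact ((tv.mul (tu.pow 2)).temp0_pd i).growth

end Solution

section Pohozaev

variable {n : ℕ}

theorem gauss_cauchy_schwarz_pair {a b c d : Eucl n → ℝ} (ha : Temp0 a) (hb : Temp0 b)
    (hc : Temp0 c) (hd : Temp0 d) :
    (∫ z, (a z * b z + c z * d z) ∂(gauss n)) ^ 2 ≤
      (∫ z, (a z ^ 2 + c z ^ 2) ∂(gauss n)) * ∫ z, (b z ^ 2 + d z ^ 2) ∂(gauss n) := by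
  set A := ∫ z, (a z ^ 2 + c z ^ 2) ∂(gauss n)
  set B := ∫ z, (b z ^ 2 + d z ^ 2) ∂(gauss n)
  set M := ∫ z, (a z * b z + c z * d z) ∂(gauss n)
  have h : ∀ t : ℝ, 0 ≤ B * (t * t) + 2 * M * t + A := fun t => by
    have e : ∫ z, ((t * t) * (b z ^ 2 + d z ^ 2) + (2 * t) * (a z * b z + c z * d z) +
        (a z ^ 2 + c z ^ 2)) ∂(gauss n) = B * (t * t) + 2 * M * t + A := by
      rw [integral_add, integral_add, integral_const_mul, integral_const_mul]
      · ring
      · exact ((temp0_const (t * t)).mul ((hb.pow 2).add (hd.pow 2))).integrable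
      · exact ((temp0_const (2 * t)).mul ((ha.mul hb).add (hc.mul hd))).integrable
      · exact (((temp0_const (t * t)).mul ((hb.pow 2).add (hd.pow 2))).add
          ((temp0_const (2 * t)).mul ((ha.mul hb).add (hc.mul hd)))).integrable
      · exact ((ha.pow 2).add (hc.pow 2)).integrable
    rw [← e]
    refine integral_nonneg fun z => ?_
    show (0 : ℝ) ≤ _
    nlinarith [sq_nonneg (t * b z + a z), sq_nonneg (t * d z + c z)]
  have := discrim_le_zero h
  rw [discrim] at this
  nlinarith

theorem pd_mul {f g : Eucl n → ℝ} (hf : Temp1 f) (hg : Temp1 g) (i : Fin n) (x : Eucl n) :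
    pd i (fun z => f z * g z) x = f x * pd i g x + g x * pd i f x := by
  rw [pd, fderiv_fun_mul (hf.differentiable x) (hg.differentiable x)]
  simp [pd]

theorem pd_sq {f : Eucl n → ℝ} (hf : Temp1 f) (i : Fin n) :
    pd i (fun z => f z ^ 2) = fun x => 2 * (f x * pd i f x) := by
  ext x
  simp_rw [sq]
  rw [pd_mul hf hf]
  ring

theorem pd_const_mul {f : Eucl n → ℝ} (hf : Temp1 f) (c : ℝ) (i : Fin n) (x : Eucl n) :
    pd i (fun z => c * f z) x = c * pd i f x := by
  rw [pd_mul (temp1_const c) hf]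
  simp [pd]

theorem Temp2.sq {f : Eucl n → ℝ} (hf : Temp2 f) : Temp2 (fun z => f z ^ 2) :=
  ⟨hf.1.pow 2, fun i => by rw [pd_sq hf.1]; exact (hf.1.mul (hf.2 i)).const_mul 2⟩

theorem Temp2.plap_sq {f : Eucl n → ℝ} (hf : Temp2 f) (x : Eucl n) :
    plap (fun z => f z ^ 2) x = 2 * (gradSq f x + f x * plap f x) := by
  simp only [plap, gradSq, Finset.mul_sum, ← Finset.sum_add_distrib]
  refine Finset.sum_congr rfl fun i _ => ?_
  rw [pd_sq hf.1, pd_const_mul (hf.1.mul (hf.2 i)), pd_mul hf.1 (hf.2 i)]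
  ring

/-- The radial derivative `z ↦ ∇f(x + r z) · z`. -/
def radial (f : Eucl n → ℝ) (x : Eucl n) (r : ℝ) (z : Eucl n) : ℝ := fderiv ℝ f (x + r • z) z

theorem Temp1.temp0_radial {f : Eucl n → ℝ} (hf : Temp1 f) (x : Eucl n) (r : ℝ) :
    Temp0 (radial f x r) :=
  (hf.temp0_fderiv.comp (temp1_affine x r).temp0).clm_apply temp0_id

theorem radial_eq_sum (f : Eucl n → ℝ) (x : Eucl n) (r : ℝ) (z : Eucl n) :
    radial f x r z = ∑ i, pd i f (x + r • z) * z i := fderiv_eq_sum f _ _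

theorem Temp2.temp1_radial {f : Eucl n → ℝ} (hf : Temp2 f) (x : Eucl n) (r : ℝ) :
    Temp1 (radial f x r) := by
  rw [funext (radial_eq_sum f x r)]
  exact .sum fun i _ => ((hf.2 i).affine x r).mul (temp1_coord i)

theorem pd_coord (i j : Fin n) (z : Eucl n) : pd i (fun z : Eucl n => z j) z = if i = j then 1 else 0 := by
  have h : HasFDerivAt (fun z : Eucl n => z j) (EuclideanSpace.proj j : Eucl n →L[ℝ] ℝ) z :=
    (EuclideanSpace.proj j : Eucl n →L[ℝ] ℝ).hasFDerivAt
  rw [pd, h.fderiv]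
  simp [eq_comm]

theorem pd_radial {f : Eucl n → ℝ} (hf : Temp2 f)
    (hc : ∀ i j x, pd i (pd j f) x = pd j (pd i f) x) (x : Eucl n) (r : ℝ) (i : Fin n) (z : Eucl n) :
    pd i (radial f x r) z = pd i f (x + r • z) + r * radial (pd i f) x r z := by
  rw [funext (radial_eq_sum f x r), pd_sum _ fun j _ =>
    (((hf.2 j).affine x r).mul (temp1_coord j)).differentiable]
  simp_rw [fun j => pd_mul ((hf.2 j).affine x r) (temp1_coord j) i z, pd_coord,
    fun j => pd_affine (hf.2 j) x r i z, hc i, radial_eq_sum, Finset.sum_add_distrib, Finset.mul_sum]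
  simp only [mul_ite, mul_one, mul_zero, Finset.sum_ite_eq, Finset.mem_univ, if_true]
  congr 1
  exact Finset.sum_congr rfl fun j _ => by ring

/-- The Pohozaev identity for Gaussian averages. -/
theorem integral_radial_sq {f : Eucl n → ℝ} (hf : Temp2 f)
    (hc : ∀ i j x, pd i (pd j f) x = pd j (pd i f) x) (x : Eucl n) (r : ℝ) :
    ∫ z, radial f x r z ^ 2 ∂(gauss n) = r * ∫ z, plap f (x + r • z) * radial f x r z ∂(gauss n) +
      heat r (gradSq f) x + r * ∫ z, ∑ i, pd i f (x + r • z) * radial (pd i f) x r z ∂(gauss n) := by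
  have hG : ∀ i, Temp1 (fun z => pd i f (x + r • z) * radial f x r z) := fun i =>
    ((hf.2 i).affine x r).mul (hf.temp1_radial x r)
  have e1 : ∫ z, radial f x r z ^ 2 ∂(gauss n) =
      ∫ z, ∑ i, pd i (fun z => pd i f (x + r • z) * radial f x r z) z ∂(gauss n) := by
    rw [integral_finsetSum _ fun i _ => ((hG i).temp0_pd i).integrable]
    simp_rw [← integral_mul_coord_gauss (hG _)]
    rw [← integral_finsetSum _ fun i _ => ((hG i).temp0.mul (temp1_coord i).temp0).integrable]
    congr 1
    ext z
    rw [sq]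
    conv_lhs => rw [radial_eq_sum, Finset.sum_mul, ← radial_eq_sum]
    exact Finset.sum_congr rfl fun i _ => by ring
  have i1 : Temp0 (fun z => plap f (x + r • z) * radial f x r z) :=
    (hf.temp0_plap.affine x r).mul (hf.1.temp0_radial x r)
  have i2 : Temp0 (fun z => gradSq f (x + r • z)) := hf.1.temp0_gradSq.affine x r
  have i3 : Temp0 (fun z => ∑ i, pd i f (x + r • z) * radial (pd i f) x r z) :=
    .sum fun i _ => ((hf.2 i).temp0.affine x r).mul ((hf.2 i).temp0_radial x r)
  rw [e1, heat, ← integral_const_mul, ← integral_const_mul, ← integral_add, ← integral_add]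
  · congr 1
    ext z
    simp_rw [fun i => pd_mul ((hf.2 i).affine x r) (hf.temp1_radial x r) i z, pd_radial hf hc,
      fun i => pd_affine (hf.2 i) x r i z, plap, gradSq, Finset.sum_mul, Finset.mul_sum,
      ← Finset.sum_add_distrib]
    exact Finset.sum_congr rfl fun j _ => by ring
  · exact (((temp0_const r).mul i1).add i2).integrable
  · exact ((temp0_const r).mul i3).integrable
  · exact ((temp0_const r).mul i1).integrable
  · exact i2.integrable

theorem Temp2.temp1_gradSq {f : Eucl n → ℝ} (hf : Temp2 f) : Temp1 (gradSq f) :=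
  .sum fun i _ => (hf.2 i).pow 2

theorem radial_mul {f g : Eucl n → ℝ} (hf : Temp1 f) (hg : Temp1 g) (x : Eucl n) (r : ℝ)
    (z : Eucl n) : radial (fun z => f z * g z) x r z =
      f (x + r • z) * radial g x r z + g (x + r • z) * radial f x r z := by
  rw [radial, fderiv_fun_mul (hf.differentiable _) (hg.differentiable _)]
  simp [radial]

theorem radial_sq {f : Eucl n → ℝ} (hf : Temp1 f) (x : Eucl n) (r : ℝ) (z : Eucl n) :
    radial (fun z => f z ^ 2) x r z = 2 * (f (x + r • z) * radial f x r z) := by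
  simp_rw [sq]
  rw [radial_mul hf hf]
  ring

theorem radial_gradSq {f : Eucl n → ℝ} (hf : Temp2 f) (x : Eucl n) (r : ℝ) (z : Eucl n) :
    radial (gradSq f) x r z = 2 * ∑ i, pd i f (x + r • z) * radial (pd i f) x r z := by
  have e : gradSq f = fun z => ∑ i, pd i f z ^ 2 := rfl
  rw [radial, e, fderiv_fun_sum fun i _ => ((hf.2 i).pow 2).differentiable _,
    sum_apply, Finset.mul_sum]
  exact Finset.sum_congr rfl fun i _ => radial_sq (hf.2 i) x r z

theorem hasDerivAt_heat_gradSq {f : Eucl n → ℝ} (hf : Temp2 f)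
    (hc : ∀ i j x, pd i (pd j f) x = pd j (pd i f) x) (x : Eucl n) (r : ℝ) :
    HasDerivAt (fun r => r ^ 2 * heat r (gradSq f) x)
      (2 * r * (∫ z, radial f x r z ^ 2 ∂(gauss n)) -
        2 * r ^ 2 * ∫ z, plap f (x + r • z) * radial f x r z ∂(gauss n)) r := by
  have h := (hasDerivAt_pow 2 r).mul (hasDerivAt_heat_scale hf.temp1_gradSq x r)
  refine h.congr_deriv ?_
  have e : ∫ z, fderiv ℝ (gradSq f) (x + r • z) z ∂(gauss n) =
      2 * ∫ z, ∑ i, pd i f (x + r • z) * radial (pd i f) x r z ∂(gauss n) := by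
    rw [← integral_const_mul]
    congr 1
    ext z
    exact radial_gradSq hf x r z
  rw [e, integral_radial_sq hf hc x r]
  push_cast
  ring

theorem integral_mul_radial {f : Eucl n → ℝ} (hf : Temp2 f) (x : Eucl n) (r : ℝ) :
    ∫ z, f (x + r • z) * radial f x r z ∂(gauss n) =
      r * heat r (fun z => gradSq f z + f z * plap f z) x := by
  have h1 := (hasDerivAt_heat_scale hf.sq.1 x r).unique (hf.sq.hasDerivAt_heat x r)
  have e : ∫ z, fderiv ℝ (fun z => f z ^ 2) (x + r • z) z ∂(gauss n) =
      2 * ∫ z, f (x + r • z) * radial f x r z ∂(gauss n) := by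
    rw [← integral_const_mul]
    congr 1
    ext z
    exact radial_sq hf.1 x r z
  rw [e, funext hf.plap_sq, heat_const_mul] at h1
  linarith

end Pohozaev

section Almgren

variable {n : ℕ}

/-- The Gaussian mass of the pair `(u, v)`. -/
def mass (u v : Eucl n → ℝ) (x : Eucl n) (r : ℝ) : ℝ := heat r (fun z => u z ^ 2 + v z ^ 2) x

/-- The Gaussian interaction energy of the pair `(u, v)`. -/
def inter (u v : Eucl n → ℝ) (x : Eucl n) (r : ℝ) : ℝ := heat r (fun z => u z ^ 2 * v z ^ 2) x

/-- The Gaussian energy of the pair `(u, v)`. -/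
def energy (u v : Eucl n → ℝ) (x : Eucl n) (r : ℝ) : ℝ :=
  heat r (fun z => gradSq u z + gradSq v z + u z ^ 2 * v z ^ 2) x

/-- The Almgren frequency of the pair `(u, v)`. -/
def freq (u v : Eucl n → ℝ) (x : Eucl n) (r : ℝ) : ℝ := r ^ 2 * energy u v x r / mass u v x r

theorem Temp0.heat_pos {f : Eucl n → ℝ} (hf : Temp0 f) (h : ∀ x, 0 < f x) (r : ℝ) (x : Eucl n) :
    0 < heat r f x := by
  rw [heat, integral_pos_iff_support_of_nonneg (fun z => (h _).le) (hf.integrable_affine x r)]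
  have : Function.support (fun z => f (x + r • z)) = Set.univ :=
    Set.eq_univ_of_forall fun z => (h _).ne'
  rw [this]
  simp

variable {C : ℝ} {u v : Eucl n → ℝ}

namespace TempSol

theorem comm_u (h : TempSol C u v) (i j : Fin n) (x : Eucl n) :
    pd i (pd j u) x = pd j (pd i u) x := pd_comm h.smooth_u i j x

theorem temp0_mass (h : TempSol C u v) : Temp0 (fun z => u z ^ 2 + v z ^ 2) :=
  (h.temp_u.1.temp0.pow 2).add (h.temp_v.1.temp0.pow 2)

theorem temp0_inter (h : TempSol C u v) : Temp0 (fun z => u z ^ 2 * v z ^ 2) :=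
  (h.temp_u.1.temp0.pow 2).mul (h.temp_v.1.temp0.pow 2)

theorem temp0_energy (h : TempSol C u v) :
    Temp0 (fun z => gradSq u z + gradSq v z + u z ^ 2 * v z ^ 2) :=
  (h.temp_u.1.temp0_gradSq.add h.temp_v.1.temp0_gradSq).add h.temp0_inter

theorem mass_pos (h : TempSol C u v) (x : Eucl n) (r : ℝ) : 0 < mass u v x r :=
  h.temp0_mass.heat_pos (fun z => by have := h.pos_u z; positivity) r x

theorem mass_symm (u v : Eucl n → ℝ) : mass v u = mass u v := by
  unfold mass; simp_rw [add_comm]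

theorem inter_nonneg (u v : Eucl n → ℝ) (x : Eucl n) (r : ℝ) : 0 ≤ inter u v x r :=
  heat_nonneg (fun z => by positivity) r x

theorem energy_nonneg (u v : Eucl n → ℝ) (x : Eucl n) (r : ℝ) : 0 ≤ energy u v x r :=
  heat_nonneg (fun z => by have := gradSq_nonneg u z; have := gradSq_nonneg v z; positivity) r x

theorem freq_nonneg (h : TempSol C u v) (x : Eucl n) (r : ℝ) : 0 ≤ freq u v x r :=
  div_nonneg (mul_nonneg (sq_nonneg r) (energy_nonneg u v x r)) (h.mass_pos x r).le

theorem u_mul_plap (h : TempSol C u v) (z : Eucl n) : u z * plap u z = u z ^ 2 * v z ^ 2 := by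
  rw [h.eq_u]; ring

theorem v_mul_plap (h : TempSol C u v) (z : Eucl n) : v z * plap v z = u z ^ 2 * v z ^ 2 := by
  rw [h.eq_v]; ring

theorem integral_pair_radial (h : TempSol C u v) (x : Eucl n) (r : ℝ) :
    ∫ z, (u (x + r • z) * radial u x r z + v (x + r • z) * radial v x r z) ∂(gauss n) =
      r * (energy u v x r + inter u v x r) := by
  have gu := h.temp_u.1.temp0_gradSq
  have gv := h.temp_v.1.temp0_gradSq
  rw [integral_add, integral_mul_radial h.temp_u, integral_mul_radial h.temp_v]
  · simp_rw [h.u_mul_plap, h.v_mul_plap]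
    rw [heat_add gu h.temp0_inter, heat_add gv h.temp0_inter, energy,
      heat_add (gu.add gv) h.temp0_inter, heat_add gu gv, inter]
    ring
  · exact ((h.temp_u.1.temp0.affine x r).mul (h.temp_u.1.temp0_radial x r)).integrable
  · exact ((h.temp_v.1.temp0.affine x r).mul (h.temp_v.1.temp0_radial x r)).integrable

theorem hasDerivAt_mass (h : TempSol C u v) (x : Eucl n) (r : ℝ) :
    HasDerivAt (mass u v x) (2 * r * (energy u v x r + inter u v x r)) r := by
  have h1 : Temp1 (fun z => u z ^ 2 + v z ^ 2) := (h.temp_u.1.pow 2).add (h.temp_v.1.pow 2)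
  refine (hasDerivAt_heat_scale h1 x r).congr_deriv ?_
  rw [mul_assoc, ← h.integral_pair_radial, ← integral_const_mul]
  congr 1
  ext z
  rw [fderiv_fun_add ((h.temp_u.1.pow 2).differentiable _) ((h.temp_v.1.pow 2).differentiable _)]
  have e1 := radial_sq h.temp_u.1 x r z
  have e2 := radial_sq h.temp_v.1 x r z
  rw [radial] at e1 e2
  rw [add_apply, e1, e2]
  ring

theorem radial_inter (h : TempSol C u v) (x : Eucl n) (r : ℝ) (z : Eucl n) :
    radial (fun z => u z ^ 2 * v z ^ 2) x r z =
      2 * (plap u (x + r • z) * radial u x r z) + 2 * (plap v (x + r • z) * radial v x r z) := by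
  rw [radial_mul (h.temp_u.1.pow 2) (h.temp_v.1.pow 2), radial_sq h.temp_u.1, radial_sq h.temp_v.1,
    h.eq_u, h.eq_v]
  ring

theorem hasDerivAt_energy (h : TempSol C u v) (x : Eucl n) (r : ℝ) :
    HasDerivAt (fun r => r ^ 2 * energy u v x r)
      (2 * r * ∫ z, (radial u x r z ^ 2 + radial v x r z ^ 2) ∂(gauss n) + 2 * r * inter u v x r) r := by
  have gu := h.temp_u.1.temp0_gradSq
  have gv := h.temp_v.1.temp0_gradSq
  have ti : Temp1 (fun z => u z ^ 2 * v z ^ 2) := (h.temp_u.1.pow 2).mul (h.temp_v.1.pow 2)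
  have e : (fun r => r ^ 2 * energy u v x r) = fun r => r ^ 2 * heat r (gradSq u) x +
      r ^ 2 * heat r (gradSq v) x + r ^ 2 * heat r (fun z => u z ^ 2 * v z ^ 2) x := by
    ext r
    rw [energy, heat_add (gu.add gv) h.temp0_inter, heat_add gu gv]
    ring
  rw [e]
  have h3 := (hasDerivAt_pow 2 r).mul (hasDerivAt_heat_scale ti x r)
  refine (((hasDerivAt_heat_gradSq h.temp_u h.comm_u x r).add
    (hasDerivAt_heat_gradSq h.temp_v h.symm.comm_u x r)).add h3).congr_deriv ?_
  have iu : Temp0 (fun z => plap u (x + r • z) * radial u x r z) :=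
    (h.temp_u.temp0_plap.affine x r).mul (h.temp_u.1.temp0_radial x r)
  have iv : Temp0 (fun z => plap v (x + r • z) * radial v x r z) :=
    (h.temp_v.temp0_plap.affine x r).mul (h.temp_v.1.temp0_radial x r)
  have e3 : ∫ z, fderiv ℝ (fun z => u z ^ 2 * v z ^ 2) (x + r • z) z ∂(gauss n) =
      2 * ∫ z, plap u (x + r • z) * radial u x r z ∂(gauss n) +
      2 * ∫ z, plap v (x + r • z) * radial v x r z ∂(gauss n) := by
    rw [← integral_const_mul, ← integral_const_mul, ← integral_add]
    · congr 1
      ext z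
      exact h.radial_inter x r z
    · exact ((temp0_const 2).mul iu).integrable
    · exact ((temp0_const 2).mul iv).integrable
  rw [e3, integral_add, inter]
  · push_cast
    ring
  · exact ((h.temp_u.1.temp0_radial x r).pow 2).integrable
  · exact ((h.temp_v.1.temp0_radial x r).pow 2).integrable

/-- The derivative of the frequency dominates the interaction term. -/
theorem exists_hasDerivAt_freq (h : TempSol C u v) (x : Eucl n) {r : ℝ} (hr : 0 ≤ r) :
    ∃ N' : ℝ, HasDerivAt (freq u v x) N' r ∧ 2 * r * inter u v x r / mass u v x r ≤ N' := by
  have hH := h.mass_pos x r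
  refine ⟨_, (h.hasDerivAt_energy x r).div (h.hasDerivAt_mass x r) hH.ne', ?_⟩
  have cs := gauss_cauchy_schwarz_pair (h.temp_u.1.temp0.affine x r) (h.temp_u.1.temp0_radial x r)
    (h.temp_v.1.temp0.affine x r) (h.temp_v.1.temp0_radial x r)
  rw [h.integral_pair_radial] at cs
  have eH : ∫ z, (u (x + r • z) ^ 2 + v (x + r • z) ^ 2) ∂(gauss n) = mass u v x r := rfl
  rw [eH] at cs
  set W := ∫ z, (radial u x r z ^ 2 + radial v x r z ^ 2) ∂(gauss n)
  set H := mass u v x r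
  set E := energy u v x r with hE
  set J := inter u v x r with hJ
  have hJ0 : 0 ≤ J := inter_nonneg u v x r
  have hE0 : 0 ≤ E := energy_nonneg u v x r
  rw [div_le_div_iff₀ hH (by positivity)]
  have h1 : 0 ≤ 2 * r * (H * W - (r * (E + J)) ^ 2) := mul_nonneg (by positivity) (by linarith)
  have h2 : 0 ≤ 2 * r ^ 3 * J * (E + J) := by positivity
  have h3 : 2 * r * J * H ≤ (2 * r * W + 2 * r * J) * H - r ^ 2 * E * (2 * r * (E + J)) := by
    linarith
  nlinarith [mul_le_mul_of_nonneg_right h3 hH.le]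

theorem freq_monotoneOn (h : TempSol C u v) (x : Eucl n) : MonotoneOn (freq u v x) (Set.Ici 0) := by
  choose! N' hN using fun r (hr : 0 ≤ r) => h.exists_hasDerivAt_freq x hr
  refine monotoneOn_of_deriv_nonneg (convex_Ici 0)
    (fun r hr => (hN r hr).1.continuousAt.continuousWithinAt) ?_ ?_ <;> rw [interior_Ici]
  · exact fun r hr => (hN r (Set.mem_Ioi.1 hr).le).1.differentiableAt.differentiableWithinAt
  · intro r hr
    have hr : 0 < r := hr
    rw [(hN r hr.le).1.deriv]
    refine le_trans ?_ (hN r hr.le).2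
    have := inter_nonneg u v x r
    have := h.mass_pos x r
    positivity

theorem mass_monotoneOn (h : TempSol C u v) (x : Eucl n) : MonotoneOn (mass u v x) (Set.Ici 0) := by
  refine monotoneOn_of_deriv_nonneg (convex_Ici 0)
    (fun r _ => (h.hasDerivAt_mass x r).continuousAt.continuousWithinAt) 
    (fun r _ => (h.hasDerivAt_mass x r).differentiableAt.differentiableWithinAt) fun r hr => ?_
  rw [interior_Ici] at hr
  have hr : 0 < r := hr
  rw [(h.hasDerivAt_mass x r).deriv]
  have := inter_nonneg u v x r
  have := energy_nonneg u v x r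
  positivity

theorem hasDerivAt_log_mass (h : TempSol C u v) (x : Eucl n) {r : ℝ} (hr : 0 < r) :
    HasDerivAt (fun r => Real.log (mass u v x r))
      (2 * freq u v x r / r + 2 * r * inter u v x r / mass u v x r) r := by
  have hH := h.mass_pos x r
  refine ((h.hasDerivAt_mass x r).log hH.ne').congr_deriv ?_
  rw [freq]
  field_simp

theorem log_mass_sub_monotoneOn (h : TempSol C u v) (x : Eucl n) {r₀ a : ℝ} (hr₀ : 0 < r₀)
    (ha : a ≤ freq u v x r₀) :
    MonotoneOn (fun r => Real.log (mass u v x r) - 2 * a * Real.log r) (Set.Ici r₀) := by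
  have hd : ∀ r, 0 < r → HasDerivAt (fun r => Real.log (mass u v x r) - 2 * a * Real.log r)
      (2 * freq u v x r / r + 2 * r * inter u v x r / mass u v x r - 2 * a * r⁻¹) r := fun r hr =>
    (h.hasDerivAt_log_mass x hr).sub ((Real.hasDerivAt_log hr.ne').const_mul _)
  refine monotoneOn_of_deriv_nonneg (convex_Ici r₀)
    (fun r hr => (hd r (hr₀.trans_le hr)).continuousAt.continuousWithinAt) ?_ ?_ <;>
    rw [interior_Ici]
  · exact fun r hr => (hd r (hr₀.trans hr)).differentiableAt.differentiableWithinAt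
  · intro r hr
    have hr' : 0 < r := hr₀.trans hr
    rw [(hd r hr').deriv]
    have h1 : a ≤ freq u v x r := ha.trans (h.freq_monotoneOn x hr₀.le hr'.le (le_of_lt hr))
    have h2 : 2 * freq u v x r / r - 2 * a * r⁻¹ = 2 * (freq u v x r - a) / r := by
      field_simp
    have h3 : 0 ≤ 2 * (freq u v x r - a) / r := div_nonneg (by linarith) hr'.le
    have := inter_nonneg u v x r
    have := h.mass_pos x r
    have h4 : 0 ≤ 2 * r * inter u v x r / mass u v x r := by positivity
    linarith

theorem exists_mass_le (h : TempSol C u v) : ∃ K : ℝ, 0 < K ∧ ∀ x r, 0 ≤ r →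
    mass u v x r ≤ K * (1 + ‖x‖ + r) ^ 2 := by
  set m := ∫ z : Eucl n, (1 + ‖z‖) ^ 2 ∂(gauss n) with hm
  have hm0 : 0 ≤ m := integral_nonneg fun z => by positivity
  refine ⟨C ^ 2 * m + 1, by positivity, fun x r hr => ?_⟩
  have e : mass u v x r ≤ C ^ 2 * (1 + ‖x‖ + r) ^ 2 * m := by
    rw [hm, ← integral_const_mul]
    refine integral_mono (h.temp0_mass.integrable_affine x r)
      ((temp0_const _).mul (((temp0_const 1).add temp0_id.norm).pow 2)).integrable fun z => ?_
    show u (x + r • z) ^ 2 + v (x + r • z) ^ 2 ≤ _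
    have hu := h.pos_u (x + r • z)
    have hv := h.pos_v (x + r • z)
    have hC : 0 < C := by
      have := h.linear 0
      simp at this
      linarith [h.pos_u 0, h.pos_v 0]
    have hb : ‖x + r • z‖ ≤ ‖x‖ + r * ‖z‖ := (norm_add_le _ _).trans_eq (by
      rw [norm_smul, Real.norm_of_nonneg hr])
    have h1 : u (x + r • z) + v (x + r • z) ≤ C * ((1 + ‖x‖ + r) * (1 + ‖z‖)) := by
      refine (h.linear _).trans (mul_le_mul_of_nonneg_left ?_ hC.le)
      nlinarith [norm_nonneg x, norm_nonneg z, mul_nonneg (norm_nonneg x) (norm_nonneg z)]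
    calc _ ≤ (u (x + r • z) + v (x + r • z)) ^ 2 := by nlinarith
      _ ≤ (C * ((1 + ‖x‖ + r) * (1 + ‖z‖))) ^ 2 := by gcongr
      _ = _ := by ring
  nlinarith [sq_nonneg (1 + ‖x‖ + r)]

theorem freq_le_one (h : TempSol C u v) (x : Eucl n) {r : ℝ} (hr : 0 < r) : freq u v x r ≤ 1 := by
  by_contra! hN
  obtain ⟨K, hK, hb⟩ := h.exists_mass_le
  set a := freq u v x r
  set c := Real.log (mass u v x r) - 2 * a * Real.log r
  have h1 : ∀ R, max r (1 + ‖x‖) ≤ R → 2 * (a - 1) * Real.log R ≤ Real.log (4 * K) - c := by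
    intro R hR
    have hrR := (le_max_left _ _).trans hR
    have hxR := (le_max_right _ _).trans hR
    have hR0 : 0 < R := hr.trans_le hrR
    have h2 := h.log_mass_sub_monotoneOn x hr le_rfl (Set.mem_Ici.2 le_rfl) hrR hrR
    have h3 : mass u v x R ≤ 4 * K * R ^ 2 := (hb x R hR0.le).trans (by
      have : (1 + ‖x‖ + R) ^ 2 ≤ (2 * R) ^ 2 := by
        have := norm_nonneg x
        gcongr
        linarith
      nlinarith)
    have h4 := Real.log_le_log (h.mass_pos x R) h3
    rw [Real.log_mul (by positivity) (by positivity), Real.log_pow] at h4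
    push_cast at h4
    simp only at h2
    linarith
  have h5 : Filter.Tendsto (fun R => 2 * (a - 1) * Real.log R) Filter.atTop Filter.atTop :=
    Real.tendsto_log_atTop.const_mul_atTop (by linarith)
  obtain ⟨R, hR1, hR2⟩ := ((h5.eventually_gt_atTop (Real.log (4 * K) - c)).and
    (Filter.eventually_ge_atTop (max r (1 + ‖x‖)))).exists
  exact absurd (h1 R hR2) (not_le.2 hR1)

theorem log_mass_antitoneOn (h : TempSol C u v) (x : Eucl n) :
    AntitoneOn (fun r => Real.log (mass u v x r) - 2 * Real.log r - freq u v x r) (Set.Ioi 0) := by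
  choose! N' hN using fun r (hr : 0 < r) => h.exists_hasDerivAt_freq x hr.le
  have hd : ∀ r, 0 < r → HasDerivAt
      (fun r => Real.log (mass u v x r) - 2 * Real.log r - freq u v x r)
      (2 * freq u v x r / r + 2 * r * inter u v x r / mass u v x r - 2 * r⁻¹ - N' r) r := fun r hr =>
    ((h.hasDerivAt_log_mass x hr).sub ((Real.hasDerivAt_log hr.ne').const_mul _)).sub (hN r hr).1
  refine antitoneOn_of_deriv_nonpos (convex_Ioi 0)
    (fun r hr => (hd r hr).continuousAt.continuousWithinAt) ?_ ?_ <;> rw [interior_Ioi]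
  · exact fun r hr => (hd r hr).differentiableAt.differentiableWithinAt
  · intro r hr
    have hr : 0 < r := hr
    rw [(hd r hr).deriv]
    have h1 : 2 * freq u v x r / r - 2 * r⁻¹ = - (2 * (1 - freq u v x r) / r) := by
      field_simp; ring
    have h2 : 0 ≤ 2 * (1 - freq u v x r) / r := div_nonneg (by linarith [h.freq_le_one x hr]) hr.le
    linarith [(hN r hr).2]

theorem mass_le_mul (h : TempSol C u v) (x : Eucl n) {r R : ℝ} (hr : 0 < r) (hR : r ≤ R) :
    mass u v x R ≤ 3 * (R / r) ^ 2 * mass u v x r := by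
  have hR0 := hr.trans_le hR
  have h1 := h.log_mass_antitoneOn x (Set.mem_Ioi.2 hr) (Set.mem_Ioi.2 hR0) hR
  simp only at h1
  have h2 := h.freq_nonneg x r
  have h3 := h.freq_le_one x hR0
  have hm := h.mass_pos x r
  have h4 : Real.log (mass u v x R) ≤ Real.log (Real.exp 1 * ((R / r) ^ 2 * mass u v x r)) := by
    rw [Real.log_mul (by positivity) (by positivity), Real.log_exp,
      Real.log_mul (by positivity) hm.ne', Real.log_pow, Real.log_div hR0.ne' hr.ne']
    push_cast
    linarith
  rw [Real.log_le_log_iff (h.mass_pos x R) (by positivity)] at h4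
  have h5 : Real.exp 1 ≤ 3 := by linarith [Real.exp_one_lt_d9]
  have h6 : 0 ≤ (R / r) ^ 2 * mass u v x r := by positivity
  nlinarith

end TempSol

end Almgren

section Compare

variable {n : ℕ} {C : ℝ} {u v : Eucl n → ℝ}

theorem fderiv_sq_le (f : Eucl n → ℝ) (x e : Eucl n) :
    fderiv ℝ f x e ^ 2 ≤ gradSq f x * ‖e‖ ^ 2 := by
  rw [fderiv_eq_sum, EuclideanSpace.norm_sq_eq]
  simpa [gradSq] using Finset.sum_mul_sq_le_sq_mul_sq Finset.univ (fun i => pd i f x) (fun i => e i)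

namespace TempSol

theorem mass_shift (h : TempSol C u v) (x y : Eucl n) {r : ℝ} (hr : 0 < r) :
    mass u v y r ≤ Real.exp (2 * ‖y - x‖ / r) * mass u v x r := by
  set e := y - x with he
  have h1 : Temp1 (fun z => u z ^ 2 + v z ^ 2) := (h.temp_u.1.pow 2).add (h.temp_v.1.pow 2)
  have hd : ∀ t : ℝ, HasDerivAt (fun t : ℝ => Real.log (mass u v (x + t • e) r) - 2 * ‖e‖ / r * t)
      ((∫ z, fderiv ℝ (fun z => u z ^ 2 + v z ^ 2) (x + t • e + r • z) e ∂(gauss n)) /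
        mass u v (x + t • e) r - 2 * ‖e‖ / r * 1) t := fun t =>
    ((hasDerivAt_heat_line h1 r x e t).log (h.mass_pos _ r).ne').sub
      ((hasDerivAt_id t).const_mul _)
  have hb : ∀ t : ℝ, (∫ z, fderiv ℝ (fun z => u z ^ 2 + v z ^ 2) (x + t • e + r • z) e ∂(gauss n)) ≤
      2 * ‖e‖ / r * mass u v (x + t • e) r := by
    intro t
    set w := x + t • e
    have hH := h.mass_pos w r
    have tu : Temp0 (fun z => fderiv ℝ u (w + r • z) e) :=
      (h.temp_u.1.temp0_fderiv.comp (temp1_affine w r).temp0).clm_apply (temp0_const e)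
    have tv : Temp0 (fun z => fderiv ℝ v (w + r • z) e) :=
      (h.temp_v.1.temp0_fderiv.comp (temp1_affine w r).temp0).clm_apply (temp0_const e)
    have cs := gauss_cauchy_schwarz_pair (h.temp_u.1.temp0.affine w r) tu
      (h.temp_v.1.temp0.affine w r) tv
    have e1 : ∫ z, fderiv ℝ (fun z => u z ^ 2 + v z ^ 2) (w + r • z) e ∂(gauss n) =
        2 * ∫ z, (u (w + r • z) * fderiv ℝ u (w + r • z) e +
          v (w + r • z) * fderiv ℝ v (w + r • z) e) ∂(gauss n) := by
      rw [← integral_const_mul]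
      congr 1
      ext z
      rw [fderiv_fun_add ((h.temp_u.1.pow 2).differentiable _) ((h.temp_v.1.pow 2).differentiable _),
        fderiv_fun_pow _ (h.temp_u.1.differentiable _), fderiv_fun_pow _ (h.temp_v.1.differentiable _)]
      simp
      ring
    have eH : ∫ z, (u (w + r • z) ^ 2 + v (w + r • z) ^ 2) ∂(gauss n) = mass u v w r := rfl
    have e2 : ∫ z, (fderiv ℝ u (w + r • z) e ^ 2 + fderiv ℝ v (w + r • z) e ^ 2) ∂(gauss n) ≤
        ‖e‖ ^ 2 * energy u v w r := by
      rw [energy, heat, ← integral_const_mul]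
      refine integral_mono ((tu.pow 2).add (tv.pow 2)).integrable
        ((temp0_const _).mul (h.temp0_energy.affine w r)).integrable fun z => ?_
      have a1 := fderiv_sq_le u (w + r • z) e
      have a2 := fderiv_sq_le v (w + r • z) e
      have a3 : 0 ≤ ‖e‖ ^ 2 * (u (w + r • z) ^ 2 * v (w + r • z) ^ 2) := by positivity
      simp only
      linarith
    have e3 : energy u v w r ≤ mass u v w r / r ^ 2 := by
      have := h.freq_le_one w hr
      rw [freq, div_le_one hH] at this
      rw [le_div_iff₀ (by positivity)]
      linarith
    rw [e1]
    rw [eH] at cs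
    have e4 := mul_le_mul_of_nonneg_left (e2.trans (mul_le_mul_of_nonneg_left e3 (sq_nonneg ‖e‖)))
      hH.le
    have e5 : mass u v w r * (‖e‖ ^ 2 * (mass u v w r / r ^ 2)) = (‖e‖ / r * mass u v w r) ^ 2 := by
      field_simp
    have e6 := abs_le_of_sq_le_sq (cs.trans (e4.trans_eq e5)) (by positivity)
    have := (abs_le.1 e6).2
    calc _ ≤ 2 * (‖e‖ / r * mass u v w r) := by linarith
      _ = _ := by ring
  have ha : Antitone (fun t : ℝ => Real.log (mass u v (x + t • e) r) - 2 * ‖e‖ / r * t) := by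
    refine antitone_of_deriv_nonpos (fun t => (hd t).differentiableAt) fun t => ?_
    rw [(hd t).deriv, mul_one, sub_nonpos, div_le_iff₀ (h.mass_pos _ r)]
    exact hb t
  have h01 := ha (zero_le_one (α := ℝ))
  simp only [one_smul, zero_smul, add_zero, mul_one, mul_zero, sub_zero, he,
    add_sub_cancel] at h01
  have hx := h.mass_pos x r
  rw [← Real.log_le_log_iff (h.mass_pos y r) (by positivity), Real.log_mul (by positivity) hx.ne',
    Real.log_exp]
  linarith

theorem mass_le_poly (h : TempSol C u v) (x y : Eucl n) {r : ℝ} (hr : 0 < r) :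
    mass u v y r ≤ 27 * (1 + ‖y - x‖ / r) ^ 2 * mass u v x r := by
  have hd := norm_nonneg (y - x)
  have hR : 0 < r + ‖y - x‖ := by positivity
  have h1 := h.mass_monotoneOn y (Set.mem_Ici.2 hr.le) (Set.mem_Ici.2 hR.le)
    (le_add_of_nonneg_right hd)
  have h2 := h.mass_shift x y hR
  have h3 := h.mass_le_mul x hr (le_add_of_nonneg_right hd)
  have h4 : Real.exp (2 * ‖y - x‖ / (r + ‖y - x‖)) ≤ 9 := by
    have : Real.exp (2 * ‖y - x‖ / (r + ‖y - x‖)) ≤ Real.exp 2 :=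
      Real.exp_le_exp.2 (by rw [div_le_iff₀ hR]; linarith)
    have h5 : Real.exp 2 = Real.exp 1 ^ 2 := by rw [← Real.exp_nat_mul]; norm_num
    nlinarith [Real.exp_one_lt_d9, Real.exp_pos 1]
  have h5 : (r + ‖y - x‖) / r = 1 + ‖y - x‖ / r := by field_simp
  rw [h5] at h3
  have := h.mass_pos x (r + ‖y - x‖)
  calc _ ≤ _ := h1
    _ ≤ _ := h2
    _ ≤ 9 * (3 * (1 + ‖y - x‖ / r) ^ 2 * mass u v x r) := by gcongr
    _ = _ := by ring

theorem sq_add_sq_le_mass (h : TempSol C u v) (x : Eucl n) {r : ℝ} (hr : 0 ≤ r) :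
    u x ^ 2 + v x ^ 2 ≤ mass u v x r := by
  have := h.mass_monotoneOn x (Set.mem_Ici.2 le_rfl) (Set.mem_Ici.2 hr) hr
  simpa [mass, heat_zero] using this

theorem sq_le_mass (h : TempSol C u v) (x : Eucl n) {r : ℝ} (hr : 0 ≤ r) : u x ^ 2 ≤ mass u v x r :=
  (le_add_of_nonneg_right (sq_nonneg _)).trans (h.sq_add_sq_le_mass x hr)

theorem plap_nonneg (h : TempSol C u v) (x : Eucl n) : 0 ≤ plap u x := by
  rw [h.eq_u]; have := h.pos_u x; positivity

end TempSol

theorem covariance_estimate {A B X Y h₁ h₂ c : ℝ} (hA : 0 < A) (hB : 0 < B)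
    (h1 : h₁ - A ^ 2 ≤ h₁ / 4) (h2 : h₂ - B ^ 2 ≤ h₂ / 4) (hB1 : B ^ 2 ≤ h₂)
    (hX : (X - A * B) ^ 2 ≤ (h₁ - A ^ 2) * (h₂ - B ^ 2)) (hY : X ^ 2 ≤ Y)
    (hc : c ^ 2 * Y ≤ h₂ / 4) : c ^ 2 * A ^ 2 ≤ 2 := by
  have a1 : h₁ - A ^ 2 ≤ A ^ 2 / 3 := by linarith
  have a2 : h₂ - B ^ 2 ≤ B ^ 2 / 3 := by linarith
  have a3 : (X - A * B) ^ 2 ≤ (A * B / 3) ^ 2 := hX.trans (by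
    calc _ ≤ (A ^ 2 / 3) * (B ^ 2 / 3) := mul_le_mul a1 a2 (by linarith) (by positivity)
      _ = _ := by ring)
  have a4 := (abs_le.1 (abs_le_of_sq_le_sq a3 (by positivity))).1
  have a5 : (A * B / 2) ^ 2 ≤ X ^ 2 := by
    have : A * B / 2 ≤ X := by nlinarith [mul_pos hA hB]
    gcongr
  have a6 : c ^ 2 * (A * B / 2) ^ 2 ≤ h₂ / 4 :=
    (mul_le_mul_of_nonneg_left (a5.trans hY) (sq_nonneg c)).trans hc
  have a7 : c ^ 2 * A ^ 2 * B ^ 2 ≤ 2 * B ^ 2 := by nlinarith [sq_nonneg B]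
  exact le_of_mul_le_mul_right a7 (by positivity)

theorem heat_covariance {f g : Eucl n → ℝ} (hf : Temp0 f) (hg : Temp0 g) (r : ℝ) (x : Eucl n) :
    (heat r (fun z => f z * g z) x - heat r f x * heat r g x) ^ 2 ≤
      (heat r (fun z => f z ^ 2) x - heat r f x ^ 2) *
        (heat r (fun z => g z ^ 2) x - heat r g x ^ 2) := by
  have key : ∀ f g : Eucl n → ℝ, Temp0 f → Temp0 g → ∀ a b : ℝ,
      heat r (fun z => (f z - a) * (g z - b)) x =
      heat r (fun z => f z * g z) x - b * heat r f x - a * heat r g x + a * b := by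
    intro f g hf hg a b
    have e : (fun z => (f z - a) * (g z - b)) =
        fun z => f z * g z - b * f z - a * g z + a * b := by ext z; ring
    rw [e, heat_add (((hf.mul hg).sub ((temp0_const b).mul hf)).sub ((temp0_const a).mul hg))
      (temp0_const _), heat_sub ((hf.mul hg).sub ((temp0_const b).mul hf)) ((temp0_const a).mul hg),
      heat_sub (hf.mul hg) ((temp0_const b).mul hf), heat_const_mul, heat_const_mul, heat_const]
  set a := heat r f x with ha
  set b := heat r g x with hb
  have h := heat_cauchy_schwarz (hf.sub (temp0_const a)) (hg.sub (temp0_const b)) r x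
  simp_rw [sq (f _ - a), sq (g _ - b)] at h
  rw [key f g hf hg, key f f hf hf, key g g hg hg, ← ha, ← hb] at h
  simp_rw [← sq] at h
  convert h using 1 <;> ring

theorem heat_sq_le {f : Eucl n → ℝ} (hf : Temp0 f) (r : ℝ) (x : Eucl n) :
    heat r f x ^ 2 ≤ heat r (fun z => f z ^ 2) x := by
  simpa [heat_const] using heat_cauchy_schwarz hf (temp0_const 1) r x

theorem TempSol.hasDerivAt_heat_sq (h : TempSol C u v) (x : Eucl n) (r : ℝ) :
    HasDerivAt (fun r => heat r (fun z => u z ^ 2) x)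
      (2 * r * heat r (fun z => gradSq u z + u z ^ 2 * v z ^ 2) x) r := by
  refine (h.temp_u.sq.hasDerivAt_heat x r).congr_deriv ?_
  simp_rw [funext h.temp_u.plap_sq, h.u_mul_plap, heat_const_mul]
  ring

theorem TempSol.heat_sq_pos (h : TempSol C u v) (x : Eucl n) (r : ℝ) :
    0 < heat r (fun z => u z ^ 2) x :=
  (h.temp_u.1.temp0.pow 2).heat_pos (fun z => by have := h.pos_u z; positivity) r x

theorem TempSol.heat_sq_le_mass (h : TempSol C u v) (x : Eucl n) (r : ℝ) :
    heat r (fun z => u z ^ 2) x ≤ mass u v x r :=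
  heat_mono (h.temp_u.1.temp0.pow 2) h.temp0_mass
    (fun _ => le_add_of_nonneg_right (sq_nonneg _)) r x

theorem TempSol.heat_parts_le (h : TempSol C u v) (x : Eucl n) {r : ℝ}
    (hN : r ^ 2 * heat r (fun z => gradSq u z + u z ^ 2 * v z ^ 2) x ≤
      heat r (fun z => u z ^ 2) x / 4) :
    heat r (fun z => u z ^ 2) x - heat r u x ^ 2 ≤ heat r (fun z => u z ^ 2) x / 4 ∧
      r ^ 2 * heat r (fun z => u z ^ 2 * v z ^ 2) x ≤ heat r (fun z => u z ^ 2) x / 4 := by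
  have gu := h.temp_u.1.temp0_gradSq
  rw [heat_add gu h.temp0_inter] at hN
  have h1 := heat_poincare h.temp_u.1 r x
  have h2 : 0 ≤ heat r (gradSq u) x := heat_nonneg (gradSq_nonneg u) r x
  have h3 : 0 ≤ heat r (fun z => u z ^ 2 * v z ^ 2) x := inter_nonneg u v x r
  constructor <;> nlinarith [sq_nonneg r]

/-- At every point and every large scale one of the two components is small. -/
theorem TempSol.min_sq_le (h : TempSol C u v) (x : Eucl n) {ρ : ℝ} (hρ : 1 ≤ ρ) {a : ℝ} (ha : 0 < a)
    (hau : a ≤ u x) (hav : a ≤ v x) : a ^ 2 ≤ 2 / ρ ^ 8 + mass u v x (ρ ^ 8) / ρ := by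
  have hρ0 : 0 < ρ := by linarith
  have hH := h.mass_pos x (ρ ^ 8)
  have hle : a ^ 2 ≤ mass u v x (ρ ^ 8) :=
    (pow_le_pow_left₀ ha.le hau 2).trans (h.sq_le_mass x (by positivity))
  rcases hρ.eq_or_lt with rfl | hρ1
  · simp at hle ⊢; linarith
  by_contra! hlt
  have hlt2 : mass u v x (ρ ^ 8) / ρ < a ^ 2 := by
    have : (0 : ℝ) < 2 / ρ ^ 8 := by positivity
    linarith
  have hlog : 0 < Real.log ρ := Real.log_pos hρ1
  set f₁ := fun r => heat r (fun z => u z ^ 2) x with hf₁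
  set f₂ := fun r => heat r (fun z => v z ^ 2) x with hf₂
  set D₁ := fun r => heat r (fun z => gradSq u z + u z ^ 2 * v z ^ 2) x with hD₁
  set D₂ := fun r => heat r (fun z => gradSq v z + v z ^ 2 * u z ^ 2) x with hD₂
  have p₁ : ∀ r, 0 < f₁ r := fun r => h.heat_sq_pos x r
  have p₂ : ∀ r, 0 < f₂ r := fun r => h.symm.heat_sq_pos x r
  have d : ∀ r, HasDerivAt (fun r => Real.log (f₁ r) + Real.log (f₂ r))
      (2 * r * D₁ r / f₁ r + 2 * r * D₂ r / f₂ r) r := fun r =>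
    ((h.hasDerivAt_heat_sq x r).log (p₁ r).ne').add ((h.symm.hasDerivAt_heat_sq x r).log (p₂ r).ne')
  have h48 : ρ ^ 4 < ρ ^ 8 := pow_lt_pow_right₀ hρ1 (by norm_num)
  have h4 : 1 ≤ ρ ^ 4 := one_le_pow₀ hρ
  obtain ⟨c, hc, e⟩ := exists_ratio_hasDerivAt_eq_ratio_slope
    (fun r => Real.log (f₁ r) + Real.log (f₂ r)) _ h48
    (fun r _ => (d r).continuousAt.continuousWithinAt) (fun r _ => d r) Real.log (fun r => r⁻¹)
    (fun r hr => (Real.hasDerivAt_log (by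
      have := hr.1; linarith)).continuousAt.continuousWithinAt)
    (fun r hr => Real.hasDerivAt_log (by have := hr.1; linarith))
  have hc0 : 0 < c := by linarith [hc.1]
  rw [Real.log_pow, Real.log_pow] at e
  have hau2 : a ^ 2 ≤ u x ^ 2 := by gcongr
  have hav2 : a ^ 2 ≤ v x ^ 2 := by gcongr
  have l1 : Real.log (a ^ 2) ≤ Real.log (f₁ (ρ ^ 4)) := Real.log_le_log (by positivity) (hau2.trans
    (le_heat h.temp_u.sq (fun z => by
      rw [h.temp_u.plap_sq, h.u_mul_plap]; have := gradSq_nonneg u z; positivity) x (by positivity)))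
  have l2 : Real.log (a ^ 2) ≤ Real.log (f₂ (ρ ^ 4)) := Real.log_le_log (by positivity) (hav2.trans
    (le_heat h.temp_v.sq (fun z => by
      rw [h.temp_v.plap_sq, h.v_mul_plap]; have := gradSq_nonneg v z; positivity) x (by positivity)))
  have l3 : Real.log (f₁ (ρ ^ 8)) ≤ Real.log (mass u v x (ρ ^ 8)) :=
    Real.log_le_log (p₁ _) (h.heat_sq_le_mass x _)
  have l4 : Real.log (f₂ (ρ ^ 8)) ≤ Real.log (mass u v x (ρ ^ 8)) :=
    Real.log_le_log (p₂ _) ((h.symm.heat_sq_le_mass x _).trans_eq (by rw [mass_symm]))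
  have l5 : Real.log (mass u v x (ρ ^ 8)) - Real.log ρ < Real.log (a ^ 2) := by
    rw [← Real.log_div hH.ne' hρ0.ne']
    exact Real.log_lt_log (by positivity) hlt2
  have hs : c * (2 * c * D₁ c / f₁ c + 2 * c * D₂ c / f₂ c) < 1 / 2 := by
    have e1 : c * (2 * c * D₁ c / f₁ c + 2 * c * D₂ c / f₂ c) * (4 * Real.log ρ) =
        Real.log (f₁ (ρ ^ 8)) + Real.log (f₂ (ρ ^ 8)) -
          (Real.log (f₁ (ρ ^ 4)) + Real.log (f₂ (ρ ^ 4))) := by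
      have e2 : c * (2 * c * D₁ c / f₁ c + 2 * c * D₂ c / f₂ c) =
          2 * c ^ 2 * (D₁ c / f₁ c + D₂ c / f₂ c) := by ring
      rw [e2]
      field_simp at e
      push_cast at e
      linear_combination e
    by_contra! hcon
    nlinarith
  have n1 : 0 ≤ D₁ c := heat_nonneg (fun z => by have := gradSq_nonneg u z; positivity) _ _
  have n2 : 0 ≤ D₂ c := heat_nonneg (fun z => by have := gradSq_nonneg v z; positivity) _ _
  have q1 : 0 ≤ c ^ 2 * D₁ c / f₁ c := div_nonneg (by positivity) (p₁ c).le
  have q2 : 0 ≤ c ^ 2 * D₂ c / f₂ c := div_nonneg (by positivity) (p₂ c).le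
  have hs2 : c ^ 2 * D₁ c / f₁ c + c ^ 2 * D₂ c / f₂ c < 1 / 4 := by
    have : c * (2 * c * D₁ c / f₁ c + 2 * c * D₂ c / f₂ c) =
      2 * (c ^ 2 * D₁ c / f₁ c + c ^ 2 * D₂ c / f₂ c) := by ring
    linarith
  have m1 : c ^ 2 * D₁ c ≤ f₁ c / 4 := by
    have : c ^ 2 * D₁ c / f₁ c ≤ 1 / 4 := by linarith
    rw [div_le_iff₀ (p₁ c)] at this
    linarith
  have m2 : c ^ 2 * D₂ c ≤ f₂ c / 4 := by
    have : c ^ 2 * D₂ c / f₂ c ≤ 1 / 4 := by linarith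
    rw [div_le_iff₀ (p₂ c)] at this
    linarith
  have v1 := h.heat_parts_le x m1
  have v2 := h.symm.heat_parts_le x m2
  have tu := h.temp_u.1.temp0
  have tv := h.temp_v.1.temp0
  have hsq := heat_sq_le (tu.mul tv) c x
  simp_rw [mul_pow] at hsq
  simp_rw [mul_comm (v _ ^ 2)] at v2
  have fin := covariance_estimate (tu.heat_pos h.pos_u c x) (tv.heat_pos h.pos_v c x) v1.1 v2.1
    (heat_sq_le tv c x) (heat_covariance tu tv c x) hsq v2.2
  have hu1 : a ≤ heat c u x := hau.trans (le_heat h.temp_u h.plap_nonneg x hc0.le)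
  have : a ^ 2 ≤ 2 / ρ ^ 8 := by
    rw [le_div_iff₀ (by positivity)]
    have hc2 : ρ ^ 8 ≤ c ^ 2 := by
      have : ρ ^ 8 = (ρ ^ 4) ^ 2 := by ring
      rw [this]
      exact pow_le_pow_left₀ (by positivity) hc.1.le 2
    calc a ^ 2 * ρ ^ 8 ≤ heat c u x ^ 2 * c ^ 2 := by gcongr
      _ ≤ 2 := by linarith
  have : 0 < mass u v x (ρ ^ 8) / ρ := by positivity
  linarith

end Compare

section Cut

variable {n : ℕ}

theorem temp1_max_sq : Temp1 (fun t : ℝ => max t 0 ^ 2) := by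
  have hm : ∀ t : ℝ, |max t 0| ≤ |t| := fun t => by
    rcases le_total t 0 with h | h <;> simp [h]
  refine ⟨contDiff_max_pow 0, ?_, ?_⟩
  · refine ((temp0_id (X := ℝ)).pow 2).growth.of_le fun t => ?_
    simp only [Real.norm_eq_abs, abs_pow]
    exact pow_le_pow_left₀ (abs_nonneg _) (hm t) 2
  · refine ((temp0_const (X := ℝ) (2 : ℝ)).mul temp0_id).growth.of_le fun t => ?_
    rw [← norm_deriv_eq_norm_fderiv, (hasDerivAt_max_pow 0 t).deriv]
    simpa using hm t

theorem Temp1.sqrt {X : Type*} [NormedAddCommGroup X] [NormedSpace ℝ X] {f : X → ℝ} (hf : Temp1 f)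
    {c : ℝ} (hc : 0 < c) (h : ∀ x, c ≤ f x) : Temp1 (fun x => Real.sqrt (f x)) := by
  have h0 : ∀ x, 0 < f x := fun x => hc.trans_le (h x)
  refine ⟨hf.contDiff.sqrt fun x => (h0 x).ne', ?_, ?_⟩
  · refine ((temp0_const (1 : ℝ)).add hf.temp0).growth.of_le fun x => ?_
    have := h0 x
    rw [Real.norm_of_nonneg (Real.sqrt_nonneg _), Real.norm_of_nonneg (by linarith)]
    exact Real.sqrt_le_iff.2 ⟨by linarith, by nlinarith⟩
  · refine ((temp0_const (1 / (2 * Real.sqrt c))).smul hf.temp0_fderiv).growth.of_le fun x => ?_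
    rw [((hf.hasFDerivAt x).sqrt (h0 x).ne').fderiv, norm_smul, norm_smul]
    have hs := Real.sqrt_pos.2 hc
    have hs' := Real.sqrt_le_sqrt (h x)
    refine mul_le_mul_of_nonneg_right ?_ (norm_nonneg _)
    rw [Real.norm_of_nonneg (by positivity), Real.norm_of_nonneg (by positivity)]
    gcongr

theorem temp1_norm_sq : Temp1 (fun z : Eucl n => ‖z‖ ^ 2) := by
  have : Temp1 (fun z : Eucl n => ∑ i, z i ^ 2) := .sum fun i _ => (temp1_coord i).pow 2
  simpa only [← EuclideanSpace.real_norm_sq_eq] using this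

theorem pd_norm_sq (i : Fin n) (z : Eucl n) : pd i (fun z : Eucl n => ‖z‖ ^ 2) z = 2 * z i := by
  rw [pd, (hasStrictFDerivAt_norm_sq z).hasFDerivAt.fderiv]
  simp [EuclideanSpace.inner_single_right]

/-- A smoothed positive part of `U - A`, with gradient at most that of `U` up to errors in `A`. -/
def cutoff (A U : Eucl n → ℝ) (z : Eucl n) : ℝ :=
  Real.sqrt (A z ^ 2 + max (U z - A z) 0 ^ 2) - A z

theorem Temp1.cutoff {A U : Eucl n → ℝ} (hA : Temp1 A) (hU : Temp1 U) {a : ℝ} (ha : 0 < a)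
    (h : ∀ z, a ≤ A z) : Temp1 (cutoff A U) := by
  refine (Temp1.sqrt ((hA.pow 2).add (temp1_max_sq.comp (hU.sub hA))) (c := a ^ 2) (by positivity)
    fun z => ?_).sub hA
  have := pow_le_pow_left₀ ha.le (h z) 2
  have : 0 ≤ max (U z - A z) 0 ^ 2 := by positivity
  linarith

theorem pd_cutoff {A U : Eucl n → ℝ} (hA : Temp1 A) (hU : Temp1 U) (i : Fin n) {z : Eucl n}
    (h : 0 < A z) : pd i (cutoff A U) z =
      1 / (2 * Real.sqrt (A z ^ 2 + max (U z - A z) 0 ^ 2)) *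
        (2 * A z * pd i A z + 2 * max (U z - A z) 0 * (pd i U z - pd i A z)) - pd i A z := by
  have h1 := ((hasDerivAt_max_pow 0 (U z - A z)).comp_hasFDerivAt z
    ((hU.hasFDerivAt z).sub (hA.hasFDerivAt z)))
  have h2 := (((hA.hasFDerivAt z).pow 2).add h1).sqrt (by
    have : 0 ≤ max (U z - A z) 0 ^ 2 := by positivity
    simp
    positivity)
  have h3 := h2.sub (hA.hasFDerivAt z)
  have h4 : pd i (cutoff A U) z = _ := congrArg (fun L => L (EuclideanSpace.single i (1 : ℝ))) h3.fderiv
  rw [h4]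
  simp [pd]
  ring

theorem cutoff_eq_zero {A U : Eucl n → ℝ} {z : Eucl n} (h : 0 < A z) (hU : U z ≤ A z) :
    cutoff A U z = 0 := by
  rw [cutoff, max_eq_right (by linarith)]
  simp [Real.sqrt_sq h.le]

theorem pd_cutoff_eq_zero {A U : Eucl n → ℝ} (hA : Temp1 A) (hU : Temp1 U) (i : Fin n) {z : Eucl n}
    (h : 0 < A z) (hz : U z ≤ A z) : pd i (cutoff A U) z = 0 := by
  rw [pd_cutoff hA hU i h, max_eq_right (by linarith)]
  simp [Real.sqrt_sq h.le]
  field_simp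
  simp

theorem pd_cutoff_sq_le {A U : Eucl n → ℝ} (hA : Temp1 A) (hU : Temp1 U) (i : Fin n) {z : Eucl n}
    (h : 0 < A z) {η : ℝ} (hη : 0 < η) : pd i (cutoff A U) z ^ 2 ≤
      (1 + η) * pd i U z ^ 2 + 4 * (1 + 1 / η) * pd i A z ^ 2 := by
  rw [pd_cutoff hA hU i h]
  set m := max (U z - A z) 0
  have hm : 0 ≤ m := le_max_right _ _
  set S := Real.sqrt (A z ^ 2 + m ^ 2)
  have hS : 0 < S := Real.sqrt_pos.2 (by positivity)
  have hmS : m ≤ S := Real.le_sqrt_of_sq_le (by nlinarith)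
  have hAS : A z ≤ S := Real.le_sqrt_of_sq_le (by nlinarith)
  set p := pd i U z
  set q := pd i A z
  set α := m / S
  have hα0 : 0 ≤ α := by positivity
  have hα1 : α ≤ 1 := (div_le_one hS).2 hmS
  set β := A z / S
  have hβ0 : 0 ≤ β := by positivity
  have hβ1 : β ≤ 1 := (div_le_one hS).2 hAS
  have e : 1 / (2 * S) * (2 * A z * q + 2 * m * (p - q)) - q = α * p + (β - α - 1) * q := by
    simp only [α, β]; field_simp; ring
  rw [e]
  have y : ∀ s t : ℝ, (s + t) ^ 2 ≤ (1 + η) * s ^ 2 + (1 + 1 / η) * t ^ 2 := by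
    intro s t
    have : (1 + η) * s ^ 2 + (1 + 1 / η) * t ^ 2 - (s + t) ^ 2 = (η * s - t) ^ 2 / η := by
      field_simp; ring
    have : 0 ≤ (η * s - t) ^ 2 / η := by positivity
    linarith
  have b1 : (α * p) ^ 2 ≤ p ^ 2 := by
    rw [mul_pow]; exact mul_le_of_le_one_left (sq_nonneg p) (by nlinarith)
  have b2 : ((β - α - 1) * q) ^ 2 ≤ 4 * q ^ 2 := by
    rw [mul_pow]; exact mul_le_mul_of_nonneg_right (by nlinarith) (sq_nonneg q)
  calc _ ≤ _ := y _ _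
    _ ≤ (1 + η) * p ^ 2 + (1 + 1 / η) * (4 * q ^ 2) := by gcongr
    _ = _ := by ring

theorem cutoff_le {A U : Eucl n → ℝ} {z : Eucl n} (h : 0 < A z) (hU : 0 ≤ U z) :
    cutoff A U z ≤ U z := by
  rw [cutoff, sub_le_iff_le_add]
  refine Real.sqrt_le_iff.2 ⟨by linarith, ?_⟩
  rcases le_total (U z - A z) 0 with h' | h'
  · rw [max_eq_right h']; nlinarith
  · rw [max_eq_left h']; nlinarith

theorem le_cutoff (A U : Eucl n → ℝ) (z : Eucl n) : U z - 2 * A z ≤ cutoff A U z := by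
  have : U z - A z ≤ Real.sqrt (A z ^ 2 + max (U z - A z) 0 ^ 2) :=
    (le_max_left _ 0).trans (Real.le_sqrt_of_sq_le (by nlinarith))
  rw [cutoff]; linarith

theorem gradSq_cutoff_sub_le {A U V : Eucl n → ℝ} (hA : Temp1 A) (hU : Temp1 U) (hV : Temp1 V)
    (h : ∀ z, 0 < A z) (hUV : ∀ z, U z ≤ A z ∨ V z ≤ A z) {a : ℝ} (ha : 0 < a)
    (haA : ∀ z, a ≤ A z) {η : ℝ} (hη : 0 < η) (z : Eucl n) :
    gradSq (fun z => cutoff A U z - cutoff A V z) z ≤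
      (1 + η) * (gradSq U z + gradSq V z) + 4 * (1 + 1 / η) * gradSq A z := by
  simp only [gradSq]
  rw [← Finset.sum_add_distrib, Finset.mul_sum, Finset.mul_sum, ← Finset.sum_add_distrib]
  refine Finset.sum_le_sum fun i _ => ?_
  have e : pd i (fun z => cutoff A U z - cutoff A V z) z =
      pd i (cutoff A U) z - pd i (cutoff A V) z :=
    congrArg (fun L => L (EuclideanSpace.single i (1 : ℝ)))
      (((hA.cutoff hU ha haA).hasFDerivAt z).sub ((hA.cutoff hV ha haA).hasFDerivAt z)).fderiv
  rw [e]
  have h1 := pd_cutoff_sq_le hA hU i (h z) hη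
  have h2 := pd_cutoff_sq_le hA hV i (h z) hη
  have h3 : 0 ≤ (1 + η) * pd i U z ^ 2 := by positivity
  have h4 : 0 ≤ (1 + η) * pd i V z ^ 2 := by positivity
  rcases hUV z with h' | h'
  · rw [pd_cutoff_eq_zero hA hU i (h z) h']
    simp only [zero_sub, neg_sq]
    linarith
  · rw [pd_cutoff_eq_zero hA hV i (h z) h']
    simp only [sub_zero]
    linarith

theorem le_cutoff_sub_sq {A U V : Eucl n → ℝ} {z : Eucl n} (h : 0 < A z) (hU : 0 ≤ U z)
    (hV : 0 ≤ V z) (hUV : U z ≤ A z ∨ V z ≤ A z) :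
    U z ^ 2 + V z ^ 2 - 4 * (A z * U z + A z * V z) ≤ (cutoff A U z - cutoff A V z) ^ 2 := by
  have key : ∀ U V : Eucl n → ℝ, 0 ≤ U z → 0 ≤ V z → V z ≤ A z →
      U z ^ 2 + V z ^ 2 - 4 * (A z * U z + A z * V z) ≤ cutoff A U z ^ 2 := by
    intro U V hU hV hVA
    have h1 := le_cutoff A U z
    have h2 : V z ^ 2 ≤ A z * V z := by nlinarith
    have h3 : 0 ≤ A z * V z := by positivity
    have h4 : 0 ≤ A z * U z := by positivity
    rcases le_total (U z) (2 * A z) with h5 | h5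
    · nlinarith [sq_nonneg (cutoff A U z)]
    · have := pow_le_pow_left₀ (by linarith) h1 2
      nlinarith
  rcases hUV with h' | h'
  · rw [cutoff_eq_zero h h', zero_sub, neg_sq]
    linarith [key V U hV hU h']
  · rw [cutoff_eq_zero h h', sub_zero]
    exact key U V hU hV h'

end Cut

section Segregation

variable {n : ℕ}

theorem integral_mul_le_of_sq {A U : Eucl n → ℝ} (hA : Temp0 A) (hU : Temp0 U) {h : ℝ} (hh : 0 < h) :
    ∫ z, A z * U z ∂(gauss n) ≤
      (h * ∫ z, A z ^ 2 ∂(gauss n)) / 2 + (∫ z, U z ^ 2 ∂(gauss n)) / h / 2 := by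
  have e : ∫ z, (h * A z ^ 2 / 2 + U z ^ 2 / h / 2) ∂(gauss n) =
      (h * ∫ z, A z ^ 2 ∂(gauss n)) / 2 + (∫ z, U z ^ 2 ∂(gauss n)) / h / 2 := by
    rw [integral_add ((((hA.pow 2).integrable).const_mul h).div_const 2)
      (((hU.pow 2).integrable.div_const h).div_const 2), integral_div, integral_const_mul,
      integral_div, integral_div]
  rw [← e]
  refine integral_mono (hA.mul hU).integrable
    (((((hA.pow 2).integrable).const_mul h).div_const 2).add
      (((hU.pow 2).integrable.div_const h).div_const 2)) fun z => ?_
  have : h * A z ^ 2 / 2 + U z ^ 2 / h / 2 - A z * U z = (h * A z - U z) ^ 2 / h / 2 := by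
    field_simp; ring
  have : 0 ≤ (h * A z - U z) ^ 2 / h / 2 := by positivity
  simp only
  linarith

theorem exists_energy_lower (n : ℕ) : ∃ K > 0, ∀ (U V : Eucl n → ℝ) (a h : ℝ), Temp1 U → Temp1 V →
    (∀ z, 0 < U z) → (∀ z, 0 < V z) → 0 < a → 0 < h →
    (∀ z, min (U z) (V z) ≤ a * (1 + ‖z‖ ^ 2)) → ∫ z, (U z - V z) ∂(gauss n) = 0 →
    ∫ z, (U z ^ 2 + V z ^ 2) ∂(gauss n) = h ^ 2 →
    ∫ z, (gradSq U z + gradSq V z) ∂(gauss n) ≤ h ^ 2 →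
    h ^ 2 - K * (a * h + a ^ 2) ≤ ∫ z, (gradSq U z + gradSq V z) ∂(gauss n) := by
  have hB : Temp1 (fun z : Eucl n => 1 + ‖z‖ ^ 2) := (temp1_const (1 : ℝ)).add temp1_norm_sq
  set K₀ := ∫ z, (1 + ‖z‖ ^ 2) ∂(gauss n) with hK₀
  set K₁ := ∫ z, (1 + ‖z‖ ^ 2) ^ 2 ∂(gauss n) with hK₁
  set K₂ := ∫ z, gradSq (fun z : Eucl n => 1 + ‖z‖ ^ 2) z ∂(gauss n) with hK₂
  have p0 : 0 ≤ K₀ := integral_nonneg fun z => by positivity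
  have p1 : 0 ≤ K₁ := integral_nonneg fun z => by positivity
  have p2 : 0 ≤ K₂ := integral_nonneg fun z => gradSq_nonneg _ z
  refine ⟨4 * (K₁ + 1) + 4 * K₀ ^ 2 + 1 + 4 * K₂, by positivity, ?_⟩
  intro U V a h hU hV pU pV ha hh hmin h0 hH hD
  set D := ∫ z, (gradSq U z + gradSq V z) ∂(gauss n) with hDdef
  set A : Eucl n → ℝ := fun z => a * (1 + ‖z‖ ^ 2) with hAdef
  have hA : Temp1 A := hB.const_mul a
  have haA : ∀ z, a ≤ A z := fun z => le_mul_of_one_le_right ha.le (by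
    have := sq_nonneg ‖z‖; linarith)
  have pA : ∀ z, 0 < A z := fun z => ha.trans_le (haA z)
  have hUV : ∀ z, U z ≤ A z ∨ V z ≤ A z := fun z => min_le_iff.1 (hmin z)
  have tw : Temp1 (fun z => cutoff A U z - cutoff A V z) :=
    (hA.cutoff hU ha haA).sub (hA.cutoff hV ha haA)
  have P := gauss_poincare tw
  have gA : ∀ z, gradSq A z = a ^ 2 * gradSq (fun z : Eucl n => 1 + ‖z‖ ^ 2) z := fun z => by
    simp only [gradSq, hAdef, pd_const_mul hB, mul_pow, Finset.mul_sum]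
  have iA : ∫ z, A z ∂(gauss n) = a * K₀ := integral_const_mul _ _
  have iA2 : ∫ z, A z ^ 2 ∂(gauss n) = a ^ 2 * K₁ := by
    simp only [hAdef, mul_pow]; exact integral_const_mul _ _
  have igA : ∫ z, gradSq A z ∂(gauss n) = a ^ 2 * K₂ := by
    simp only [gA]; exact integral_const_mul _ _
  -- gradient bound
  have hη : 0 < a / h := by positivity
  have G : ∫ z, gradSq (fun z => cutoff A U z - cutoff A V z) z ∂(gauss n) ≤
      (1 + a / h) * D + 4 * (1 + 1 / (a / h)) * (a ^ 2 * K₂) := by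
    rw [← igA, hDdef, ← integral_const_mul, ← integral_const_mul, ← integral_add
      ((hU.temp0_gradSq.add hV.temp0_gradSq).integrable.const_mul _)
      (hA.temp0_gradSq.integrable.const_mul _)]
    exact integral_mono tw.temp0_gradSq.integrable
      (((hU.temp0_gradSq.add hV.temp0_gradSq).integrable.const_mul _).add
      (hA.temp0_gradSq.integrable.const_mul _))
      (gradSq_cutoff_sub_le hA hU hV pA hUV ha haA hη)
  -- lower bound for the square
  have tAU := hA.temp0.mul hU.temp0
  have tAV := hA.temp0.mul hV.temp0
  have tUV := (hU.temp0.pow 2).add (hV.temp0.pow 2)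
  have S1 : h ^ 2 - 4 * ((∫ z, A z * U z ∂(gauss n)) + ∫ z, A z * V z ∂(gauss n)) ≤
      ∫ z, (cutoff A U z - cutoff A V z) ^ 2 ∂(gauss n) := by
    rw [← hH, ← integral_add tAU.integrable tAV.integrable, ← integral_const_mul,
      ← integral_sub tUV.integrable ((tAU.add tAV).integrable.const_mul 4)]
    exact integral_mono (tUV.integrable.sub ((tAU.add tAV).integrable.const_mul 4))
      (tw.temp0.pow 2).integrable
      fun z => le_cutoff_sub_sq (pA z) (pU z).le (pV z).le (hUV z)
  have ht : 0 < h / a := by positivity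
  have S2 := integral_mul_le_of_sq hA.temp0 hU.temp0 ht
  have S3 := integral_mul_le_of_sq hA.temp0 hV.temp0 ht
  have hH' : (∫ z, U z ^ 2 ∂(gauss n)) + ∫ z, V z ^ 2 ∂(gauss n) = h ^ 2 := by
    rw [← hH, integral_add (hU.temp0.pow 2).integrable (hV.temp0.pow 2).integrable]
  have S4 : (∫ z, A z * U z ∂(gauss n)) + ∫ z, A z * V z ∂(gauss n) ≤ (K₁ + 1) * (a * h) := by
    rw [iA2] at S2 S3
    have e1 : h / a * (a ^ 2 * K₁) = a * h * K₁ := by field_simp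
    have e2 : (∫ z, U z ^ 2 ∂(gauss n)) / (h / a) / 2 + (∫ z, V z ^ 2 ∂(gauss n)) / (h / a) / 2 =
        a * h / 2 := by
      rw [← add_div, ← add_div, hH']; field_simp
    rw [e1] at S2 S3
    have : 0 < a * h := by positivity
    linarith
  have M : (∫ z, (cutoff A U z - cutoff A V z) ∂(gauss n)) ^ 2 ≤ (2 * (a * K₀)) ^ 2 := by
    have e : ∫ z, (cutoff A U z - cutoff A V z) ∂(gauss n) =
        ∫ z, (cutoff A U z - cutoff A V z - (U z - V z)) ∂(gauss n) := by
      rw [integral_sub tw.temp0.integrable (hU.sub hV).temp0.integrable, h0, sub_zero]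
    rw [e, ← iA, ← integral_const_mul, ← sq_abs]
    refine pow_le_pow_left₀ (abs_nonneg _) ((abs_integral_le_integral_abs).trans ?_) 2
    refine integral_mono ((tw.sub (hU.sub hV)).temp0.integrable.abs)
      (hA.temp0.integrable.const_mul 2) fun z => ?_
    have b1 := le_cutoff A U z
    have b2 := le_cutoff A V z
    have b3 := cutoff_le (A := A) (pA z) (pU z).le
    have b4 := cutoff_le (A := A) (pA z) (pV z).le
    exact abs_le.2 ⟨by linarith, by linarith⟩
  have F1 : a / h * D ≤ a * h := by
    calc a / h * D ≤ a / h * h ^ 2 := by gcongr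
      _ = a * h := by field_simp
  have F2 : 4 * (1 + 1 / (a / h)) * (a ^ 2 * K₂) = 4 * K₂ * (a * h + a ^ 2) := by
    field_simp
    ring
  rw [F2] at G
  have q1 : 0 < a * h := by positivity
  have q2 : 0 < a ^ 2 := by positivity
  have q3 : 0 ≤ K₁ * a ^ 2 := by positivity
  have q4 : 0 ≤ K₀ ^ 2 * (a * h) := by positivity
  have : h ^ 2 - 4 * ((K₁ + 1) * (a * h)) - (2 * (a * K₀)) ^ 2 ≤
      D + a * h + 4 * K₂ * (a * h + a ^ 2) := by linarith
  linarith

end Segregation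

section FreqLower

variable {n : ℕ} {C : ℝ} {u v : Eucl n → ℝ}

theorem exists_freq_lower (n : ℕ) {c : ℝ} (hc : 0 < c) : ∃ K > 0, ∀ (C : ℝ) (u v : Eucl n → ℝ),
    TempSol C u v → ∀ (x : Eucl n) (σ : ℝ), 1 ≤ σ → heat (σ ^ 16) (fun z => u z - v z) x = 0 →
    c ≤ mass u v x (σ ^ 16) → 1 - K / σ ≤ freq u v x (σ ^ 16) := by
  obtain ⟨K, hK, hb⟩ := exists_energy_lower n
  set k := Real.sqrt (2 / c + 54) with hk
  have hk0 : 0 < k := Real.sqrt_pos.2 (by positivity)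
  have hk2 : k ^ 2 = 2 / c + 54 := Real.sq_sqrt (by positivity)
  refine ⟨K * (k + k ^ 2), by positivity, ?_⟩
  intro C u v h x σ hσ h0 hcH
  have hσ0 : 0 < σ := by linarith
  set r := σ ^ 16 with hr
  have hr0 : 0 < r := by positivity
  have hH := h.mass_pos x r
  set l := Real.sqrt (mass u v x r) with hl
  have hl0 : 0 < l := Real.sqrt_pos.2 hH
  have hl2 : l ^ 2 = mass u v x r := Real.sq_sqrt hH.le
  have hD : ∫ z, (gradSq (fun z => u (x + r • z)) z + gradSq (fun z => v (x + r • z)) z) ∂(gauss n) ≤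
      r ^ 2 * energy u v x r := by
    simp only [gradSq_affine h.temp_u.1, gradSq_affine h.temp_v.1]
    simp only [← mul_add]
    rw [integral_const_mul]
    refine mul_le_mul_of_nonneg_left ?_ (by positivity)
    refine heat_mono (h.temp_u.1.temp0_gradSq.add h.temp_v.1.temp0_gradSq) h.temp0_energy
      (fun z => ?_) r x
    have : 0 ≤ u z ^ 2 * v z ^ 2 := by positivity
    linarith
  have hN := h.freq_le_one x hr0
  rw [freq, div_le_one hH] at hN
  have key := hb (fun z => u (x + r • z)) (fun z => v (x + r • z)) (k * l / σ) l
    (h.temp_u.1.affine x r) (h.temp_v.1.affine x r) (fun z => h.pos_u _) (fun z => h.pos_v _)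
    (by positivity) hl0 ?_ h0 hl2.symm (hD.trans (hN.trans_eq hl2.symm))
  · rw [freq, le_div_iff₀ hH]
    refine le_trans ?_ (key.trans hD)
    rw [← hl2]
    have e1 : (1 - K * (k + k ^ 2) / σ) * l ^ 2 = l ^ 2 - K * (k * l / σ * l + k ^ 2 * l ^ 2 / σ) := by
      field_simp
    rw [e1]
    have : (k * l / σ) ^ 2 ≤ k ^ 2 * l ^ 2 / σ := by
      rw [div_pow, mul_pow]
      refine div_le_div_of_nonneg_left (by positivity) hσ0 (by nlinarith)
    gcongr
  · intro z
    refine abs_le_of_sq_le_sq' ?_ (by positivity) |>.2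
    set y := x + r • z
    have hm := h.min_sq_le y (ρ := σ ^ 2) (one_le_pow₀ hσ) (lt_min (h.pos_u y) (h.pos_v y))
      (min_le_left _ _) (min_le_right _ _)
    rw [← pow_mul, show 2 * 8 = 16 from rfl, ← hr] at hm
    refine hm.trans ?_
    have hp := h.mass_le_poly x y hr0
    have e : ‖y - x‖ / r = ‖z‖ := by
      simp only [y, add_sub_cancel_left, norm_smul, Real.norm_of_nonneg hr0.le]
      field_simp
    rw [e, ← hl2] at hp
    have a1 : 2 / r ≤ 2 / c * l ^ 2 / σ ^ 2 := by
      have : σ ^ 2 ≤ r := pow_le_pow_right₀ hσ (by norm_num)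
      calc 2 / r ≤ 2 / σ ^ 2 := by gcongr
        _ = 2 / c * c / σ ^ 2 := by field_simp
        _ ≤ _ := by rw [← hl2] at hcH; gcongr
    have a2 : mass u v y r / σ ^ 2 ≤ 54 * (1 + ‖z‖ ^ 2) * l ^ 2 / σ ^ 2 := by
      gcongr
      refine hp.trans ?_
      have : 27 * (1 + ‖z‖) ^ 2 ≤ 54 * (1 + ‖z‖ ^ 2) := by nlinarith [sq_nonneg (1 - ‖z‖)]
      exact mul_le_mul_of_nonneg_right this (sq_nonneg l)
    have e3 : (k * l / σ * (1 + ‖z‖ ^ 2)) ^ 2 = (2 / c + 54) * (l ^ 2 / σ ^ 2) * (1 + ‖z‖ ^ 2) ^ 2 := by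
      rw [← hk2]; field_simp
    rw [e3]
    have a3 : 1 + ‖z‖ ^ 2 ≤ (1 + ‖z‖ ^ 2) ^ 2 := by nlinarith [sq_nonneg ‖z‖]
    have a4 : (1 : ℝ) ≤ (1 + ‖z‖ ^ 2) ^ 2 := by nlinarith [sq_nonneg ‖z‖]
    have a5 : 0 ≤ l ^ 2 / σ ^ 2 := by positivity
    have a6 : 0 < 2 / c := by positivity
    calc _ ≤ 2 / c * (l ^ 2 / σ ^ 2) * 1 + 54 * (l ^ 2 / σ ^ 2) * (1 + ‖z‖ ^ 2) := by
          refine (add_le_add a1 a2).trans_eq ?_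
          ring
      _ ≤ 2 / c * (l ^ 2 / σ ^ 2) * (1 + ‖z‖ ^ 2) ^ 2 +
          54 * (l ^ 2 / σ ^ 2) * (1 + ‖z‖ ^ 2) ^ 2 := by gcongr
      _ = _ := by ring

end FreqLower

section Touching

variable {n : ℕ} {C : ℝ} {u v : Eucl n → ℝ}

/-- The quadratic weight used to localise maxima of functions of linear growth. -/
def quad (ε : ℝ) (z : Eucl n) : ℝ := 1 + ε ^ 2 * ‖z‖ ^ 2

theorem quad_pos (ε : ℝ) (z : Eucl n) : 0 < quad ε z := by unfold quad; positivity

theorem one_le_quad (ε : ℝ) (z : Eucl n) : 1 ≤ quad ε z := by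
  have : 0 ≤ ε ^ 2 * ‖z‖ ^ 2 := by positivity
  unfold quad; linarith

theorem temp1_quad (ε : ℝ) : Temp1 (quad ε : Eucl n → ℝ) :=
  (temp1_const 1).add (temp1_norm_sq.const_mul _)

theorem pd_quad (ε : ℝ) (i : Fin n) : pd i (quad ε : Eucl n → ℝ) = fun z => 2 * ε ^ 2 * z i := by
  ext z
  have : pd i (quad ε : Eucl n → ℝ) z = pd i (fun z : Eucl n => ε ^ 2 * ‖z‖ ^ 2) z := by
    unfold pd quad
    rw [fderiv_const_add]
  rw [this, pd_const_mul temp1_norm_sq, pd_norm_sq]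
  ring

theorem temp2_quad (ε : ℝ) : Temp2 (quad ε : Eucl n → ℝ) :=
  ⟨temp1_quad ε, fun i => by rw [pd_quad]; exact (temp1_coord i).const_mul _⟩

theorem plap_quad (ε : ℝ) (z : Eucl n) : plap (quad ε) z = 2 * n * ε ^ 2 := by
  have e : ∀ i : Fin n, pd i (fun z : Eucl n => z i) z = 1 := fun i => by
    have : pd i (fun z : Eucl n => z i) z = _ :=
      congrArg (fun L => L (EuclideanSpace.single i (1 : ℝ)))
        (EuclideanSpace.proj i : Eucl n →L[ℝ] ℝ).fderiv
    rw [this]; simp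
  simp only [plap, pd_quad, pd_const_mul (temp1_coord _), e]
  simp
  ring

theorem heat_quad (ε : ℝ) (y : Eucl n) (s : ℝ) : heat s (quad ε) y = quad ε y + n * ε ^ 2 * s ^ 2 := by
  have hd : ∀ s, HasDerivAt (fun s => heat s (quad ε) y - n * ε ^ 2 * s ^ 2) 0 s := fun s => by
    have h1 := (temp2_quad ε).hasDerivAt_heat y s
    have h2 := (hasDerivAt_pow 2 s).const_mul (n * ε ^ 2)
    have e : plap (quad ε : Eucl n → ℝ) = fun _ => 2 * n * ε ^ 2 := funext (plap_quad ε)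
    rw [e, heat_const] at h1
    exact (h1.sub h2).congr_deriv (by push_cast; ring)
  have := is_const_of_deriv_eq_zero (fun s => (hd s).differentiableAt) (fun s => (hd s).deriv) s 0
  simp only [heat_zero] at this
  linarith

theorem TempSol.bound_pos (h : TempSol C u v) : 0 < C := by
  have h1 := h.linear 0
  have h2 := h.pos_u 0
  have h3 := h.pos_v 0
  simp only [norm_zero, add_zero, mul_one] at h1
  linarith

theorem TempSol.exists_touching (h : TempSol C u v) {ε : ℝ} (hε : 0 < ε) (hε1 : ε ≤ 1) :
    ∃ y, ‖y‖ ≤ (1 + 2 * C / v 0) / ε ^ 2 ∧ ∀ z, v z * quad ε y ≤ v y * quad ε z := by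
  have hv0 := h.pos_v 0
  have hC := h.bound_pos
  set B := (1 + 2 * C / v 0) / ε ^ 2 with hB
  have hB1 : 1 ≤ B := by
    rw [hB, le_div_iff₀ (by positivity)]
    have : ε ^ 2 ≤ 1 := pow_le_one₀ hε.le hε1
    have : 0 < 2 * C / v 0 := by positivity
    linarith
  have hout : ∀ z : Eucl n, B < ‖z‖ → v z < v 0 * quad ε z := by
    intro z hz
    have h1 := h.linear z
    have h2 := h.pos_u z
    have h3 : v 0 * ε ^ 2 * B = v 0 + 2 * C := by rw [hB]; field_simp
    have h4 : v 0 * ε ^ 2 * B * ‖z‖ ≤ v 0 * ε ^ 2 * ‖z‖ * ‖z‖ := by gcongr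
    rw [h3] at h4
    have h5 : C * (1 + ‖z‖) ≤ C * (2 * ‖z‖) := by gcongr; linarith
    have h6 : 0 < v 0 * ‖z‖ := mul_pos hv0 (by linarith)
    unfold quad
    nlinarith
  have hc : Continuous (fun z => v z / quad ε z) :=
    h.temp_v.1.temp0.cont.div (temp1_quad ε).temp0.cont fun z => (quad_pos ε z).ne'
  obtain ⟨y, hy⟩ := hc.exists_forall_ge' 0 (by
    filter_upwards [(tendsto_norm_cocompact_atTop (E := Eucl n)).eventually_gt_atTop B] with z hz
    rw [div_le_iff₀ (quad_pos ε z)]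
    have := hout z hz
    simpa [quad] using this.le)
  refine ⟨y, ?_, fun z => ?_⟩
  · by_contra! hlt
    have h1 := hy 0
    rw [le_div_iff₀ (quad_pos ε y)] at h1
    have h2 := hout y hlt
    simp only [quad, norm_zero, ne_eq, OfNat.ofNat_ne_zero, not_false_eq_true, zero_pow, mul_zero,
      add_zero, div_one] at h1 h2
    linarith
  · have := hy z
    rwa [div_le_div_iff₀ (quad_pos ε z) (quad_pos ε y)] at this

theorem quad_le_mul (ε : ℝ) (y z : Eucl n) :
    quad ε y ≤ 2 * (quad ε z * (1 + ε ^ 2 * ‖z - y‖ ^ 2)) := by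
  have h1 : ‖y‖ ≤ ‖z‖ + ‖z - y‖ := by
    have := norm_sub_norm_le y z
    rw [norm_sub_rev] at this
    linarith
  have h2 : ‖y‖ ^ 2 ≤ 2 * ‖z‖ ^ 2 + 2 * ‖z - y‖ ^ 2 := by
    nlinarith [sq_nonneg (‖z‖ - ‖z - y‖), norm_nonneg y]
  have h3 : ε ^ 2 * ‖y‖ ^ 2 ≤ ε ^ 2 * (2 * ‖z‖ ^ 2 + 2 * ‖z - y‖ ^ 2) := by gcongr
  have h4 : 0 ≤ ε ^ 2 * ‖z‖ ^ 2 * (ε ^ 2 * ‖z - y‖ ^ 2) := by positivity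
  unfold quad
  nlinarith

/-- A harmonic-type comparison of `u` at a point where `v / quad ε` is maximal. -/
theorem exists_heat_le_of_touching (n : ℕ) : ∃ K > 0, ∀ (C : ℝ) (u v : Eucl n → ℝ), TempSol C u v →
    ∀ (ε R : ℝ) (y : Eucl n), 0 < ε → 1 ≤ R → ε * R ≤ 1 →
    (∀ z, v z * quad ε y ≤ v y * quad ε z) →
    heat R (fun z => u z * quad ε z) y ≤ K * (1 + C) * ε * R ^ 2 * quad ε y := by
  obtain ⟨K, hK, hb⟩ := exists_integral_poly_weight_le n 1
  refine ⟨(2 ^ n * (4 * n) + 1 + n) + 12 * K * n, by positivity, ?_⟩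
  intro C u v h ε R y hε hR hεR hmax
  have hC := h.bound_pos
  have hR0 : 0 < R := by linarith
  have hq := quad_pos ε y
  have hq1 := one_le_quad ε y
  set S := v y with hS
  have hS0 : 0 < S := h.pos_v y
  set M := S / quad ε y with hM
  have hM0 : 0 < M := by positivity
  have hMq : M * quad ε y = S := by rw [hM]; field_simp
  have hMS : M ≤ S := by nlinarith
  have tq := (temp1_quad (n := n) ε).temp0
  have tu := h.temp_u.1.temp0
  have tv := h.temp_v.1.temp0
  set g : Eucl n → ℝ := fun z => M * quad ε z - v z with hg
  have tg : Temp0 g := ((temp0_const M).mul tq).sub tv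
  have hg0 : ∀ z, 0 ≤ g z := fun z => by
    have := hmax z
    rw [hg, sub_nonneg, hM, div_mul_eq_mul_div, le_div_iff₀ hq]
    exact this
  have hvle : ∀ s, heat s v y ≤ S + M * (n * ε ^ 2 * s ^ 2) := fun s => by
    have := heat_nonneg hg0 s y
    rw [hg, heat_sub ((temp0_const M).mul tq) tv, heat_const_mul, heat_quad] at this
    linarith
  have hlev : ∀ s, 0 ≤ s → S ≤ heat s v y := fun s hs => le_heat h.temp_v h.symm.plap_nonneg y hs
  have E1 : ∀ s, 0 ≤ s → heat s g y ≤ M * (n * ε ^ 2 * s ^ 2) := fun s hs => by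
    rw [hg, heat_sub ((temp0_const M).mul tq) tv, heat_const_mul, heat_quad]
    linarith [hlev s hs]
  have E2 : heat R (fun z => v z * u z ^ 2) y ≤ 2 ^ n * (4 * n * ε ^ 2 * M) := by
    obtain ⟨s, hs, e⟩ := exists_hasDerivAt_eq_slope (fun s => heat s v y) _
      (show R < 2 * R by linarith)
      (fun s _ => (h.temp_v.hasDerivAt_heat y s).continuousAt.continuousWithinAt)
      (fun s _ => h.temp_v.hasDerivAt_heat y s)
    have hs0 : 0 < s := by linarith [hs.1]
    rw [funext h.eq_v, eq_div_iff (by linarith)] at e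
    have h1 := hvle (2 * R)
    have h2 := hlev R hR0.le
    have h3 : 0 ≤ heat s (fun z => v z * u z ^ 2) y :=
      heat_nonneg (fun z => by have := h.pos_v z; positivity) _ _
    have h4 : R * R * heat s (fun z => v z * u z ^ 2) y ≤ R * R * (4 * n * ε ^ 2 * M) := by
      have : R * R * heat s (fun z => v z * u z ^ 2) y ≤
          R * s * heat s (fun z => v z * u z ^ 2) y := by gcongr; exact hs.1.le
      linarith
    have h5 := le_of_mul_le_mul_left h4 (by positivity)
    refine (heat_le_heat (tv.mul (tu.pow 2)) (fun z => by have := h.pos_v z; positivity) y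
      (c := s / R) (s := s) ((one_le_div hR0).2 hs.1.le) (by field_simp)).trans ?_
    gcongr
    rw [div_le_iff₀ hR0]; exact hs.2.le
  have hn0 : (0 : ℝ) ≤ n := n.cast_nonneg
  have hεR2 : ε ^ 2 * R ^ 2 ≤ 1 := by
    rw [← mul_pow]; exact pow_le_one₀ (by positivity) hεR
  have hε1 : ε ≤ 1 := by nlinarith
  have E3 : heat R (fun z => u z * v z) y ≤ ε * S * (2 ^ n * (4 * n) + 1 + n) := by
    have h1 : heat R (fun z => u z * v z) y ≤
        heat R (fun z => (1 / ε) * (v z * u z ^ 2) + ε * v z) y := by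
      refine heat_mono (tu.mul tv) (((temp0_const _).mul (tv.mul (tu.pow 2))).add
        ((temp0_const _).mul tv)) (fun z => ?_) R y
      have hv := h.pos_v z
      have : 1 / ε * (v z * u z ^ 2) + ε * v z - u z * v z =
        v z * (((u z / ε - 1) ^ 2 + (u z / ε) ^ 2 + 1) * ε / 2) := by
        field_simp
        ring
      have : 0 ≤ v z * (((u z / ε - 1) ^ 2 + (u z / ε) ^ 2 + 1) * ε / 2) := by positivity
      linarith
    rw [heat_add ((temp0_const _).mul (tv.mul (tu.pow 2))) ((temp0_const _).mul tv),
      heat_const_mul, heat_const_mul] at h1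
    refine h1.trans ?_
    have h2 : 1 / ε * heat R (fun z => v z * u z ^ 2) y ≤ ε * S * (2 ^ n * (4 * n)) := by
      calc _ ≤ 1 / ε * (2 ^ n * (4 * n * ε ^ 2 * M)) := by gcongr
        _ = ε * M * (2 ^ n * (4 * n)) := by field_simp
        _ ≤ _ := by gcongr
    have h3 : ε * heat R v y ≤ ε * (S + S * n) := by
      refine mul_le_mul_of_nonneg_left ((hvle R).trans ?_) hε.le
      have : (n : ℝ) * ε ^ 2 * R ^ 2 ≤ n := by nlinarith
      have : M * (n * ε ^ 2 * R ^ 2) ≤ S * n := by gcongr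
      linarith
    linarith
  have E4 : heat R (fun z => u z * g z) y ≤ 12 * C * K * n * ε * R ^ 2 * S := by
    set L := C * (1 + ‖y‖ + R) with hL
    have hL0 : 0 < L := by positivity
    have h1 : heat R (fun z => u z * g z) y ≤
        L * ∫ z, g (y + R • z) * (1 + ‖z‖) ^ 1 ∂(gauss n) := by
      rw [← integral_const_mul]
      refine integral_mono ((tu.mul tg).integrable_affine y R)
        (((tg.affine y R).mul (((temp0_const 1).add temp0_id.norm).pow 1)).integrable.const_mul L)
        fun z => ?_
      have a1 : u (y + R • z) ≤ L * (1 + ‖z‖) := by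
        have b1 := h.linear (y + R • z)
        have b2 := h.pos_v (y + R • z)
        have b3 : ‖y + R • z‖ ≤ ‖y‖ + R * ‖z‖ := by
          refine (norm_add_le _ _).trans ?_
          rw [norm_smul, Real.norm_of_nonneg hR0.le]
        have b4 : 1 + ‖y + R • z‖ ≤ (1 + ‖y‖ + R) * (1 + ‖z‖) := by
          have : 0 ≤ (1 + ‖y‖) * ‖z‖ := by positivity
          nlinarith
        calc u (y + R • z) ≤ C * (1 + ‖y + R • z‖) := by linarith
          _ ≤ C * ((1 + ‖y‖ + R) * (1 + ‖z‖)) := by gcongr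
          _ = _ := by rw [hL]; ring
      have := mul_le_mul_of_nonneg_right a1 (hg0 (y + R • z))
      simp only [pow_one]
      linarith
    have h2 := hb _ (tg.affine y R) fun z => hg0 _
    have h3 : ∫ z, g (y + R • (2 : ℝ) • z) ∂(gauss n) = heat (R * 2) g y := by
      simp only [heat, smul_smul]
    rw [h3] at h2
    have h4 := E1 (R * 2) (by positivity)
    have h5 : L * M ≤ C * (3 * S / ε) := by
      rw [hL, mul_assoc]
      gcongr
      rw [hM, ← mul_div_assoc, div_le_div_iff₀ hq hε]
      have c1 : ε * ‖y‖ ≤ quad ε y := by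
        unfold quad; nlinarith [sq_nonneg (ε * ‖y‖ - 1), sq_nonneg (ε * ‖y‖)]
      have : (1 + ‖y‖ + R) * ε ≤ 3 * quad ε y := by linarith
      calc _ = S * ((1 + ‖y‖ + R) * ε) := by ring
        _ ≤ S * (3 * quad ε y) := by gcongr
        _ = _ := by ring
    calc _ ≤ _ := h1
      _ ≤ L * (K * (M * (n * ε ^ 2 * (R * 2) ^ 2))) := by
          gcongr
          exact h2.trans (mul_le_mul_of_nonneg_left h4 hK.le)
      _ = (L * M) * (K * (n * ε ^ 2 * (R * 2) ^ 2)) := by ring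
      _ ≤ (C * (3 * S / ε)) * (K * (n * ε ^ 2 * (R * 2) ^ 2)) := by gcongr
      _ = _ := by field_simp; ring
  have E5 : M * heat R (fun z => u z * quad ε z) y =
      heat R (fun z => u z * v z) y + heat R (fun z => u z * g z) y := by
    rw [← heat_const_mul, ← heat_add (tu.mul tv) (tu.mul tg)]
    congr 1
    ext z
    simp only [hg]; ring
  have E6 : M * heat R (fun z => u z * quad ε z) y ≤
      M * ((2 ^ n * (4 * n) + 1 + n + 12 * K * n) * (1 + C) * ε * R ^ 2 * quad ε y) := by
    have hR2 : 1 ≤ R ^ 2 := one_le_pow₀ hR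
    have a1 : ε * S * (2 ^ n * (4 * n) + 1 + n) ≤
        ε * S * (2 ^ n * (4 * n) + 1 + n) * (R ^ 2 * (1 + C)) :=
      le_mul_of_one_le_right (by positivity) (by nlinarith)
    have a2 : 0 ≤ 12 * K * n * ε * R ^ 2 * S := by positivity
    calc _ ≤ ε * S * (2 ^ n * (4 * n) + 1 + n) * (R ^ 2 * (1 + C)) +
          12 * K * n * ε * R ^ 2 * S * (1 + C) := by rw [E5]; linarith
      _ = (M * quad ε y) * ((2 ^ n * (4 * n) + 1 + n + 12 * K * n) * (1 + C) * ε * R ^ 2) := by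
          rw [hMq]; ring
      _ = _ := by ring
  exact le_of_mul_le_mul_left E6 hM0

end Touching

section Zero

variable {n : ℕ} {C : ℝ} {u v : Eucl n → ℝ}

theorem exists_quad_mul_heat_le (n : ℕ) : ∃ K > 0, ∀ (u : Eucl n → ℝ), Temp0 u → (∀ z, 0 ≤ u z) →
    ∀ (ε r : ℝ) (y : Eucl n), 0 ≤ ε → 0 ≤ r → ε * r ≤ 1 →
    quad ε y * heat r u y ≤ K * heat (2 * r) (fun z => u z * quad ε z) y := by
  obtain ⟨K, hK, hb⟩ := exists_integral_poly_weight_le n 2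
  refine ⟨2 * K, by positivity, ?_⟩
  intro u hu hu0 ε r y hε hr hεr
  have tq := (temp1_quad (n := n) ε).temp0
  have h1 := hb _ ((hu.mul tq).affine y r) fun z => mul_nonneg (hu0 _) (quad_pos ε _).le
  have h3 : ∫ z, u (y + r • (2 : ℝ) • z) * quad ε (y + r • (2 : ℝ) • z) ∂(gauss n) =
      heat (2 * r) (fun z => u z * quad ε z) y := by
    simp only [heat, smul_smul, mul_comm r 2]
  rw [h3] at h1
  rw [mul_assoc]
  refine le_trans ?_ (mul_le_mul_of_nonneg_left h1 (by norm_num))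
  rw [heat, ← integral_const_mul, ← integral_const_mul]
  refine integral_mono ((hu.integrable_affine y r).const_mul _)
    ((((hu.mul tq).affine y r).mul (((temp0_const 1).add temp0_id.norm).pow 2)).integrable.const_mul 2)
    fun z => ?_
  have a1 := quad_le_mul ε y (y + r • z)
  rw [add_sub_cancel_left, norm_smul, Real.norm_of_nonneg hr] at a1
  have a2 : 1 + ε ^ 2 * (r * ‖z‖) ^ 2 ≤ (1 + ‖z‖) ^ 2 := by
    have : ε ^ 2 * (r * ‖z‖) ^ 2 = (ε * r) ^ 2 * ‖z‖ ^ 2 := by ring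
    have h5 : (ε * r) ^ 2 ≤ 1 := pow_le_one₀ (by positivity) hεr
    have : (ε * r) ^ 2 * ‖z‖ ^ 2 ≤ 1 * ‖z‖ ^ 2 := by gcongr
    nlinarith [norm_nonneg z]
  have hq := quad_pos ε (y + r • z)
  have a3 : quad ε y ≤ 2 * (quad ε (y + r • z) * (1 + ‖z‖) ^ 2) := a1.trans (by gcongr)
  have := mul_le_mul_of_nonneg_left a3 (hu0 (y + r • z))
  simp only
  linarith

theorem TempSol.exists_peak (h : TempSol C u v) : ∃ K > 0, ∀ r, 1 ≤ r → ∃ y,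
    ‖y‖ ≤ K * r ^ 4 ∧ v 0 ≤ v y ∧ heat r u y < heat r v y := by
  obtain ⟨K₁, hK₁, hb₁⟩ := exists_heat_le_of_touching n
  obtain ⟨K₂, hK₂, hb₂⟩ := exists_quad_mul_heat_le n
  have hC := h.bound_pos
  have hv0 := h.pos_v 0
  set L := K₂ * (K₁ * (1 + C) * 4) with hL
  have hL0 : 0 < L := by positivity
  set δ := min (1 / 2) (v 0 / (2 * L)) with hδ
  have hδ0 : 0 < δ := by positivity
  have hδ1 : δ ≤ 1 / 2 := min_le_left _ _
  have hδ2 : L * δ ≤ v 0 / 2 := by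
    have : δ ≤ v 0 / (2 * L) := min_le_right _ _
    rw [le_div_iff₀ (by positivity)] at this
    linarith
  refine ⟨(1 + 2 * C / v 0) / δ ^ 2, by positivity, fun r hr => ?_⟩
  have hr0 : 0 < r := by linarith
  have hr2 : r ≤ r ^ 2 := by nlinarith
  have hε0 : 0 < δ / r ^ 2 := by positivity
  have hεr : δ / r ^ 2 * (2 * r) ≤ 1 := by
    rw [div_mul_eq_mul_div, div_le_one (by positivity)]
    nlinarith
  have hε1 : δ / r ^ 2 ≤ 1 := by rw [div_le_one (by positivity)]; linarith
  obtain ⟨y, hy, hmax⟩ := h.exists_touching hε0 hε1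
  have hq := quad_pos (δ / r ^ 2) y
  have hvy : v 0 ≤ v y := by
    have h1 := hmax 0
    have h2 : quad (δ / r ^ 2) (0 : Eucl n) = 1 := by simp [quad]
    rw [h2, mul_one] at h1
    exact (le_mul_of_one_le_right hv0.le (one_le_quad _ y)).trans h1
  refine ⟨y, hy.trans_eq (by field_simp), hvy, ?_⟩
  have h1 := hb₁ C u v h _ (2 * r) y hε0 (by linarith) hεr hmax
  have h2 := hb₂ u h.temp_u.1.temp0 (fun z => (h.pos_u z).le) _ r y hε0.le hr0.le (by
    have : 0 < δ / r ^ 2 * r := by positivity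
    linarith)
  have h3 : quad (δ / r ^ 2) y * heat r u y ≤ quad (δ / r ^ 2) y * (v 0 / 2) := by
    calc _ ≤ _ := h2
      _ ≤ K₂ * (K₁ * (1 + C) * (δ / r ^ 2) * (2 * r) ^ 2 * quad (δ / r ^ 2) y) := by gcongr
      _ = quad (δ / r ^ 2) y * (L * δ) := by rw [hL]; field_simp; ring
      _ ≤ _ := by gcongr
  have h4 := le_of_mul_le_mul_left h3 hq
  have h5 := le_heat h.temp_v h.symm.plap_nonneg y hr0.le
  linarith

theorem TempSol.exists_heat_zero (h : TempSol C u v) : ∃ K > 0, ∃ c > 0, ∀ r, 1 ≤ r → ∃ (x : Eucl n)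
    (ρ : ℝ), r ≤ ρ ∧ ρ ≤ K * r ^ 4 ∧ ‖x‖ ≤ K * r ^ 4 ∧ heat ρ (fun z => u z - v z) x = 0 ∧
    c ≤ mass u v x ρ := by
  obtain ⟨K₁, hK₁, hb₁⟩ := h.exists_peak
  obtain ⟨K₂, hK₂, hb₂⟩ := h.symm.exists_peak
  have hu0 := h.pos_u 0
  have hv0 := h.pos_v 0
  have tuv : Temp1 (fun z => u z - v z) := h.temp_u.1.sub h.temp_v.1
  have tu := h.temp_u.1.temp0
  have tv := h.temp_v.1.temp0
  refine ⟨2 + K₁ + K₂, by positivity, min (u 0 ^ 2) (v 0 ^ 2) / Real.exp 2, by positivity, fun r hr => ?_⟩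
  have hc1 : min (u 0 ^ 2) (v 0 ^ 2) / Real.exp 2 ≤ min (u 0 ^ 2) (v 0 ^ 2) :=
    div_le_self (by positivity) (Real.one_le_exp (by norm_num))
  obtain ⟨y₁, hy₁, hv₁, hlt₁⟩ := hb₁ r hr
  obtain ⟨y₂, hy₂, hu₂, hlt₂⟩ := hb₂ r hr
  set ρ := 1 + ‖y₁‖ + ‖y₂‖ + r with hρ
  have hn₁ := norm_nonneg y₁
  have hn₂ := norm_nonneg y₂
  have hrρ : r ≤ ρ := by linarith
  have hr4 : r ≤ r ^ 4 := le_self_pow₀ hr (by norm_num)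
  have hρK : ρ ≤ (2 + K₁ + K₂) * r ^ 4 := by linarith
  have hcs : ∀ y, Continuous (fun s => heat s (fun z => u z - v z) y) := fun y =>
    continuous_iff_continuousAt.2 fun s => (hasDerivAt_heat_scale tuv y s).continuousAt
  have e₁ : heat r (fun z => u z - v z) y₁ ≤ 0 := by rw [heat_sub tu tv]; linarith
  have e₂ : 0 ≤ heat r (fun z => u z - v z) y₂ := by rw [heat_sub tu tv]; linarith
  have b₁ : ‖y₁‖ ≤ (2 + K₁ + K₂) * r ^ 4 := by linarith
  have b₂ : ‖y₂‖ ≤ (2 + K₁ + K₂) * r ^ 4 := by linarith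
  rcases le_total 0 (heat ρ (fun z => u z - v z) y₁) with d₁ | d₁
  · obtain ⟨s, hs, hs0⟩ := intermediate_value_Icc hrρ (hcs y₁).continuousOn ⟨e₁, d₁⟩
    have hm := h.symm.sq_le_mass y₁ (r := s) (by linarith [hs.1])
    rw [TempSol.mass_symm] at hm
    exact ⟨y₁, s, hs.1, hs.2.trans hρK, b₁, hs0,
      (hc1.trans (min_le_right _ _)).trans ((by gcongr : v 0 ^ 2 ≤ v y₁ ^ 2).trans hm)⟩
  rcases le_total (heat ρ (fun z => u z - v z) y₂) 0 with d₂ | d₂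
  · obtain ⟨s, hs, hs0⟩ := intermediate_value_Icc' hrρ (hcs y₂).continuousOn ⟨d₂, e₂⟩
    have hm := h.sq_le_mass y₂ (r := s) (by linarith [hs.1])
    exact ⟨y₂, s, hs.1, hs.2.trans hρK, b₂, hs0,
      (hc1.trans (min_le_left _ _)).trans ((by gcongr : u 0 ^ 2 ≤ u y₂ ^ 2).trans hm)⟩
  have hcl : Continuous (fun t : ℝ => heat ρ (fun z => u z - v z) (y₁ + t • (y₂ - y₁))) :=
    continuous_iff_continuousAt.2 fun t => (hasDerivAt_heat_line tuv ρ y₁ (y₂ - y₁) t).continuousAt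
  obtain ⟨t, ht, ht0⟩ := intermediate_value_Icc zero_le_one hcl.continuousOn
    (show (0 : ℝ) ∈ Set.Icc _ _ from ⟨by simpa using d₁, by simpa using d₂⟩)
  set x := y₁ + t • (y₂ - y₁) with hx
  have hxρ : ‖x‖ ≤ ρ := by
    have e : x = (1 - t) • y₁ + t • y₂ := by rw [hx]; module
    rw [e]
    refine (norm_add_le _ _).trans ?_
    rw [norm_smul, norm_smul, Real.norm_of_nonneg (by linarith [ht.2]), Real.norm_of_nonneg ht.1]
    have a1 : (1 - t) * ‖y₁‖ ≤ 1 * ‖y₁‖ := by gcongr; linarith [ht.1]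
    have a2 : t * ‖y₂‖ ≤ 1 * ‖y₂‖ := by gcongr; exact ht.2
    linarith
  refine ⟨x, ρ, hrρ, hρK, hxρ.trans hρK, ht0, ?_⟩
  have hρ0 : 0 < ρ := by linarith
  have hm := h.mass_shift x 0 hρ0
  rw [zero_sub, norm_neg] at hm
  have hE : Real.exp (2 * ‖x‖ / ρ) ≤ Real.exp 2 := by
    rw [Real.exp_le_exp, div_le_iff₀ hρ0]; linarith
  have hp := h.mass_pos x ρ
  rw [div_le_iff₀ (Real.exp_pos 2)]
  calc _ ≤ u 0 ^ 2 := min_le_left _ _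
    _ ≤ mass u v 0 ρ := h.sq_le_mass 0 hρ0.le
    _ ≤ _ := hm
    _ ≤ Real.exp 2 * mass u v x ρ := by gcongr
    _ = _ := mul_comm _ _

end Zero

section Nondegenerate

variable {n : ℕ} {C : ℝ} {u v : Eucl n → ℝ}

theorem TempSol.exists_log_mass_double (h : TempSol C u v) : ∃ A > 0, ∃ τ₀ : ℝ, 1 ≤ τ₀ ∧ ∀ τ, τ₀ ≤ τ →
    Real.log (mass u v 0 (τ ^ 128)) + 2 * Real.log 2 - A / τ ≤
      Real.log (mass u v 0 (2 * τ ^ 128)) := by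
  obtain ⟨K, hK, c, hc, hz⟩ := h.exists_heat_zero
  obtain ⟨K₂, hK₂, hf⟩ := exists_freq_lower n hc
  refine ⟨2 * K₂ * Real.log 2 + 3, by positivity, max 1 K, le_max_left _ _, fun τ hτ => ?_⟩
  have hτ1 : 1 ≤ τ := (le_max_left _ _).trans hτ
  have hτ0 : 0 < τ := by linarith
  have hKτ : K ≤ τ := (le_max_right _ _).trans hτ
  obtain ⟨x, ρ, h1, h2, h3, h4, h5⟩ := hz (τ ^ 16) (one_le_pow₀ hτ1)
  rw [← pow_mul, show 16 * 4 = 64 from rfl] at h2 h3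
  have hρ0 : 0 < ρ := (by positivity : 0 < τ ^ 16).trans_le h1
  set σ := ρ ^ ((1 : ℝ) / 16) with hσ
  have hσ16 : σ ^ 16 = ρ := by
    rw [hσ, ← Real.rpow_natCast, ← Real.rpow_mul hρ0.le]; norm_num
  have hσ0 : 0 < σ := by positivity
  have hτσ : τ ≤ σ := by
    rw [← hσ16] at h1
    exact le_of_pow_le_pow_left₀ (by norm_num) hσ0.le h1
  rw [← hσ16] at h4 h5
  have hfr := hf C u v h x σ (hτ1.trans hτσ) h4 h5
  rw [hσ16] at hfr
  have hfr2 : 1 - K₂ / τ ≤ freq u v x ρ := by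
    have : K₂ / σ ≤ K₂ / τ := by gcongr
    linarith
  set T := τ ^ 128 with hT
  have hT0 : 0 < T := by positivity
  have hKT : K * τ ^ 64 ≤ T / τ := by
    rw [le_div_iff₀ hτ0, hT]
    have a : K * τ ≤ τ ^ 64 := by
      calc K * τ ≤ τ * τ := by gcongr
        _ = τ ^ 2 := by ring
        _ ≤ τ ^ 64 := pow_le_pow_right₀ hτ1 (by norm_num)
    calc K * τ ^ 64 * τ = (K * τ) * τ ^ 64 := by ring
      _ ≤ τ ^ 64 * τ ^ 64 := by gcongr
      _ = _ := by ring
  have hTτ : T / τ ≤ T := div_le_self hT0.le hτ1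
  have hxT : ‖x‖ / T ≤ 1 / τ := by
    rw [div_le_div_iff₀ hT0 hτ0, one_mul]
    rw [le_div_iff₀ hτ0] at hKT
    exact (mul_le_mul_of_nonneg_right h3 hτ0.le).trans hKT
  have hm := h.log_mass_sub_monotoneOn x hρ0 hfr2 (Set.mem_Ici.2 (by linarith : ρ ≤ T))
    (Set.mem_Ici.2 (by linarith : ρ ≤ 2 * T)) (by linarith)
  simp only [Real.log_mul two_ne_zero hT0.ne'] at hm
  have s1 := h.mass_shift x 0 hT0
  have s2 := h.mass_shift 0 x (show 0 < 2 * T by positivity)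
  have g : ∀ {a b e : ℝ}, 0 < a → 0 < b → a ≤ Real.exp e * b → Real.log a ≤ e + Real.log b := by
    intro a b e ha hb hab
    have := Real.log_le_log ha hab
    rwa [Real.log_mul (Real.exp_pos e).ne' hb.ne', Real.log_exp] at this
  have l1 := g (h.mass_pos _ _) (h.mass_pos _ _) s1
  have l2 := g (h.mass_pos _ _) (h.mass_pos _ _) s2
  rw [zero_sub, norm_neg] at l1
  rw [sub_zero] at l2
  have e1 : 2 * ‖x‖ / T = 2 * (‖x‖ / T) := by ring
  have e2 : 2 * ‖x‖ / (2 * T) = ‖x‖ / T := by field_simp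
  rw [e1] at l1
  rw [e2] at l2
  have e3 : (2 * K₂ * Real.log 2 + 3) / τ = 2 * (K₂ / τ) * Real.log 2 + 3 * (1 / τ) := by ring
  rw [e3]
  linarith

/-- Iterating a doubling inequality with geometrically decaying errors. -/
theorem sub_le_of_geometric {ψ : ℕ → ℝ} {D q : ℝ} (hq : 0 < q) (hD : 0 ≤ D)
    (h : ∀ k, ψ k - D * (q ^ k - q ^ (k + 1)) ≤ ψ (k + 1)) (k : ℕ) : ψ 0 - D ≤ ψ k := by
  have key : ψ 0 - D ≤ ψ k - D * q ^ k := by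
    induction k with
    | zero => simp
    | succ k ih => linarith [h k]
  have : 0 ≤ D * q ^ k := by positivity
  linarith

theorem TempSol.exists_le_mass_zero (h : TempSol C u v) : ∃ L > 0, ∃ T₀ > 0, ∀ k : ℕ,
    L * (T₀ * 2 ^ k) ^ 2 ≤ mass u v 0 (T₀ * 2 ^ k) := by
  obtain ⟨A, hA, τ₀, hτ₀, hd⟩ := h.exists_log_mass_double
  have hτ0 : 0 < τ₀ := by linarith
  set p : ℝ := 2 ^ ((1 : ℝ) / 128) with hp
  have hp128 : p ^ 128 = 2 := by
    rw [hp, ← Real.rpow_natCast, ← Real.rpow_mul (by norm_num)]; norm_num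
  have hp1 : 1 < p := Real.one_lt_rpow (by norm_num) (by norm_num)
  have hp0 : 0 < p := by linarith
  set q := p⁻¹ with hq
  have hq0 : 0 < q := by positivity
  have hq1 : q < 1 := inv_lt_one_of_one_lt₀ hp1
  have hq1' : 0 < 1 - q := by linarith
  set T₀ := τ₀ ^ 128 with hT₀
  have hT0 : 0 < T₀ := by positivity
  set ψ : ℕ → ℝ := fun k => Real.log (mass u v 0 (T₀ * 2 ^ k)) - 2 * Real.log (T₀ * 2 ^ k) with hψ
  set D := A / τ₀ / (1 - q) with hDdef
  have hD : 0 ≤ D := by positivity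
  have step : ∀ k, ψ k - D * (q ^ k - q ^ (k + 1)) ≤ ψ (k + 1) := by
    intro k
    have h1 := hd (τ₀ * p ^ k) (le_mul_of_one_le_right hτ0.le (one_le_pow₀ hp1.le))
    have e1 : (τ₀ * p ^ k) ^ 128 = T₀ * 2 ^ k := by
      rw [mul_pow, ← pow_mul, mul_comm k, pow_mul, hp128]
    have e2 : D * (q ^ k - q ^ (k + 1)) = A / (τ₀ * p ^ k) := by
      have : D * (q ^ k - q ^ (k + 1)) = D * (1 - q) * q ^ k := by ring
      rw [this, hDdef, div_mul_cancel₀ _ hq1'.ne', hq, inv_pow]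
      field_simp
    have e3 : T₀ * 2 ^ (k + 1) = 2 * (T₀ * 2 ^ k) := by ring
    rw [e1] at h1
    simp only [hψ]
    rw [e2, e3, Real.log_mul two_ne_zero (by positivity : T₀ * 2 ^ k ≠ 0)]
    linarith
  refine ⟨Real.exp (ψ 0 - D), Real.exp_pos _, T₀, hT0, fun k => ?_⟩
  have h1 := sub_le_of_geometric hq0 hD step k
  have hT : 0 < T₀ * 2 ^ k := by positivity
  rw [← Real.log_le_log_iff (by positivity) (h.mass_pos _ _), Real.log_mul (Real.exp_pos _).ne'
    (by positivity), Real.log_exp, Real.log_pow]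
  simp only [hψ] at h1 ⊢
  push_cast
  linarith

theorem TempSol.exists_le_mass (h : TempSol C u v) : ∃ L > 0, ∀ x r, 0 < r →
    L * r ^ 2 ≤ mass u v x r := by
  obtain ⟨L, hL, T₀, hT₀, hb⟩ := h.exists_le_mass_zero
  refine ⟨L / (3 * Real.exp 2), by positivity, fun x r hr => ?_⟩
  obtain ⟨k, hk⟩ := pow_unbounded_of_one_lt ((r + ‖x‖) / T₀) (one_lt_two (α := ℝ))
  rw [div_lt_iff₀ hT₀, mul_comm] at hk
  set T := T₀ * 2 ^ k with hT
  have hx := norm_nonneg x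
  have hT0 : 0 < T := by linarith
  have h1 := hb k
  have h2 := h.mass_shift x 0 hT0
  have h3 := h.mass_le_mul x hr (by linarith : r ≤ T)
  rw [zero_sub, norm_neg] at h2
  have hE : Real.exp (2 * ‖x‖ / T) ≤ Real.exp 2 := by
    rw [Real.exp_le_exp, div_le_iff₀ hT0]; linarith
  have hp := h.mass_pos x T
  have h4 : L * T ^ 2 ≤ Real.exp 2 * (3 * (T / r) ^ 2 * mass u v x r) :=
    calc _ ≤ _ := h1
      _ ≤ _ := h2
      _ ≤ Real.exp 2 * mass u v x T := by gcongr
      _ ≤ _ := by gcongr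
  have h5 : T ^ 2 * (L * r ^ 2) ≤ T ^ 2 * (mass u v x r * (3 * Real.exp 2)) := by
    have := mul_le_mul_of_nonneg_right h4 (sq_nonneg r)
    rw [div_pow] at this
    calc _ = L * T ^ 2 * r ^ 2 := by ring
      _ ≤ _ := this
      _ = _ := by field_simp
  have h6 := le_of_mul_le_mul_left h5 (by positivity)
  rw [div_mul_eq_mul_div, div_le_iff₀ (by positivity)]
  exact h6

end Nondegenerate

section FreeBoundary

variable {n : ℕ} {C : ℝ} {u v : Eucl n → ℝ}

theorem exists_heat_weight_le (n k : ℕ) : ∃ K > 0, ∀ f : Eucl n → ℝ, Temp0 f → (∀ z, 0 ≤ f z) →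
    ∀ x r, ∫ z, f (x + r • z) * (1 + ‖z‖) ^ k ∂(gauss n) ≤ K * heat (2 * r) f x := by
  obtain ⟨K, hK, h⟩ := exists_integral_poly_weight_le n k
  refine ⟨K, hK, fun f hf h0 x r => (h _ (hf.affine x r) fun z => h0 _).trans_eq ?_⟩
  simp_rw [heat, smul_smul, mul_comm r]

theorem TempSol.le_poly_mul_sqrt_mass (h : TempSol C u v) (x z : Eucl n) {s T : ℝ} (hs : 0 ≤ s)
    (hT : 0 < T) (hsT : s ≤ T) : u (x + s • z) ≤ 6 * (1 + ‖z‖) * √(mass u v x T) := by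
  have h1 := (h.sq_le_mass (x + s • z) hT.le).trans (h.mass_le_poly x _ hT)
  rw [add_sub_cancel_left, norm_smul, Real.norm_of_nonneg hs] at h1
  have h2 : s * ‖z‖ / T ≤ ‖z‖ := by
    rw [div_le_iff₀ hT, mul_comm]; gcongr
  have hm := (h.mass_pos x T).le
  refine abs_le_of_sq_le_sq' ?_ (by positivity) |>.2
  rw [mul_pow, Real.sq_sqrt hm]
  calc _ ≤ _ := h1
    _ ≤ 27 * (1 + ‖z‖) ^ 2 * mass u v x T := by gcongr
    _ ≤ _ := by
      have : 0 ≤ (1 + ‖z‖) ^ 2 * mass u v x T := by positivity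
      nlinarith

theorem exists_sqrt_mass_mul_le (n : ℕ) : ∃ c > 0, ∃ D > 0, ∀ C (u v : Eucl n → ℝ), TempSol C u v →
    ∀ x T, 0 < T → mass u v x T ≤ 2 * heat T (fun z => u z ^ 2) x →
      √(mass u v x T) * (c - D * (T ^ 2 * mass u v x T)) ≤ u x := by
  obtain ⟨K₁, hK₁, w₁⟩ := exists_heat_weight_le n 1
  obtain ⟨K₂, hK₂, w₂⟩ := exists_heat_weight_le n 2
  refine ⟨1 / (12 * K₁), by positivity, 4 * 432 * 7 * K₂, by positivity,
    fun C u v h x T hT hm => ?_⟩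
  have hM := h.mass_pos x T
  set l := √(mass u v x T) with hl
  have hl2 : l ^ 2 = mass u v x T := Real.sq_sqrt hM.le
  have hl0 : 0 < l := Real.sqrt_pos.2 hM
  have tu := h.temp_u.1.temp0
  have tv := h.temp_v.1.temp0
  have u0 := fun z => (h.pos_u z).le
  have tw : Temp0 (fun z : Eucl n => 1 + ‖z‖) := (temp0_const 1).add temp0_id.norm
  have lower : l / (12 * K₁) ≤ heat (2 * T) u x := by
    have a : heat T (fun z => u z ^ 2) x ≤ 6 * l * (K₁ * heat (2 * T) u x) := by
      refine le_trans ?_ (mul_le_mul_of_nonneg_left (w₁ u tu u0 x T) (by positivity))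
      rw [heat, ← integral_const_mul]
      refine integral_mono ((tu.pow 2).integrable_affine x T)
        (((tu.affine x T).mul (tw.pow 1)).integrable.const_mul _) fun z => ?_
      have := h.le_poly_mul_sqrt_mass x z hT.le hT le_rfl
      have := mul_le_mul_of_nonneg_left this (u0 (x + T • z))
      simp only [pow_one]
      nlinarith
    rw [div_le_iff₀ (by positivity)]
    have : l * l ≤ l * (heat (2 * T) u x * (12 * K₁)) := by nlinarith
    exact le_of_mul_le_mul_left this hl0
  have upper : heat (2 * T) u x - u x ≤ 4 * 432 * 7 * K₂ * T ^ 2 * l ^ 3 := by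
    obtain ⟨s, ⟨hs0, hs1⟩, hs⟩ := exists_hasDerivAt_eq_slope (fun r => heat r u x)
      (fun r => r * heat r (plap u) x) (show (0 : ℝ) < 2 * T by positivity)
      (fun r _ => (h.temp_u.hasDerivAt_heat x r).continuousAt.continuousWithinAt)
      (fun r _ => h.temp_u.hasDerivAt_heat x r)
    rw [heat_zero, sub_zero, eq_div_iff (by positivity)] at hs
    have m2 : mass u v x (2 * T) ≤ 12 * l ^ 2 := by
      have := h.mass_le_mul x hT (show T ≤ 2 * T by linarith)
      rw [mul_div_assoc, div_self hT.ne'] at this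
      rw [hl2]; linarith
    have m4 : mass u v x (4 * T) ≤ 48 * l ^ 2 := by
      have := h.mass_le_mul x hT (show T ≤ 4 * T by linarith)
      rw [mul_div_assoc, div_self hT.ne'] at this
      rw [hl2]; linarith
    have b4 : heat (4 * T) u x ≤ 7 * l := by
      refine abs_le_of_sq_le_sq' ?_ (by positivity) |>.2
      have := (heat_sq_le tu (4 * T) x).trans (h.heat_sq_le_mass x _)
      nlinarith [sq_nonneg l]
    have b2 : heat (2 * s) u x ≤ 7 * l :=
      (heat_monotoneOn h.temp_u h.plap_nonneg x (Set.mem_Ici.2 (by linarith : 0 ≤ 2 * s))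
        (Set.mem_Ici.2 (by linarith : 0 ≤ 4 * T)) (by linarith)).trans b4
    have a : heat s (plap u) x ≤ 432 * l ^ 2 * (K₂ * heat (2 * s) u x) := by
      refine le_trans ?_ (mul_le_mul_of_nonneg_left (w₂ u tu u0 x s) (by positivity))
      rw [heat, ← integral_const_mul]
      simp_rw [h.eq_u]
      refine integral_mono ((tu.mul (tv.pow 2)).integrable_affine x s)
        (((tu.affine x s).mul (tw.pow 2)).integrable.const_mul _) fun z => ?_
      have e := h.symm.le_poly_mul_sqrt_mass x z hs0.le (show 0 < 2 * T by positivity) hs1.le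
      rw [TempSol.mass_symm] at e
      have e2 : v (x + s • z) ^ 2 ≤ 36 * (1 + ‖z‖) ^ 2 * mass u v x (2 * T) := by
        calc _ ≤ _ := pow_le_pow_left₀ (h.pos_v _).le e 2
          _ = _ := by rw [mul_pow, Real.sq_sqrt (h.mass_pos x _).le]; ring
      calc u (x + s • z) * v (x + s • z) ^ 2
          ≤ u (x + s • z) * (36 * (1 + ‖z‖) ^ 2 * (12 * l ^ 2)) :=
            mul_le_mul_of_nonneg_left (e2.trans (by gcongr)) (u0 _)
        _ = _ := by ring
    rw [← hs]
    have hp : 0 ≤ heat s (plap u) x := heat_nonneg h.plap_nonneg s x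
    calc s * heat s (plap u) x * (2 * T) ≤ 2 * T * (432 * l ^ 2 * (K₂ * (7 * l))) * (2 * T) := by
          gcongr
          exact a.trans (by gcongr)
      _ = _ := by ring
  rw [← hl2]
  calc _ = l / (12 * K₁) - 4 * 432 * 7 * K₂ * T ^ 2 * l ^ 3 := by ring
    _ ≤ _ := by linarith

theorem TempSol.exists_le_of_eq (h : TempSol C u v) : ∃ c > 0, ∀ x, u x = v x → c ≤ u x := by
  obtain ⟨c, hc, D, hD, hl⟩ := exists_sqrt_mass_mul_le n
  obtain ⟨L, hL, hm⟩ := h.exists_le_mass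
  set a := c / (2 * D) with ha
  have ha0 : 0 < a := by positivity
  set B := 1 + a / L with hB
  have hB1 : 1 ≤ B := by rw [hB]; linarith [show 0 < a / L by positivity]
  have hB0 : 0 < B := by linarith
  refine ⟨√a / B * (c / 2), by positivity, fun x hx => ?_⟩
  obtain ⟨T, ⟨hT0, hTB⟩, hT⟩ : a ∈ Set.image (fun T => T ^ 2 * mass u v x T) (Set.Icc 0 B) := by
    refine intermediate_value_Icc hB0.le (fun r _ => ?_) ⟨by simpa using ha0.le, ?_⟩
    · exact ((continuous_pow 2).continuousAt.mul
        (h.hasDerivAt_mass x r).continuousAt).continuousWithinAt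
    · calc a = L * (B - 1) := by rw [hB]; field_simp; ring
        _ ≤ L * B ^ 4 := by
          gcongr
          linarith [le_self_pow₀ hB1 (show 4 ≠ 0 by norm_num)]
        _ = B ^ 2 * (L * B ^ 2) := by ring
        _ ≤ _ := by gcongr; exact hm x B hB0
  simp only at hT
  have hT1 : 0 < T := hT0.lt_of_ne (by rintro rfl; simp at hT; exact ha0.ne hT)
  have key : √(mass u v x T) * (c / 2) ≤ u x := by
    have e : c - D * (T ^ 2 * mass u v x T) = c / 2 := by
      rw [hT, ha]; field_simp; ring
    have e2 : mass u v x T = heat T (fun z => u z ^ 2) x + heat T (fun z => v z ^ 2) x :=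
      heat_add (h.temp_u.1.temp0.pow 2) (h.temp_v.1.temp0.pow 2) T x
    rcases le_total (heat T (fun z => v z ^ 2) x) (heat T (fun z => u z ^ 2) x) with g | g
    · have := hl C u v h x T hT1 (by linarith)
      rwa [e] at this
    · have := hl C v u h.symm x T hT1 (by rw [TempSol.mass_symm]; linarith)
      rwa [TempSol.mass_symm, e, ← hx] at this
  refine le_trans ?_ key
  gcongr
  rw [div_le_iff₀ hB0]
  refine Real.sqrt_le_iff.2 ⟨by positivity, ?_⟩
  rw [mul_pow, Real.sq_sqrt (h.mass_pos x T).le, ← hT, mul_comm]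
  gcongr
  exact (h.mass_pos x T).le

theorem TempSol.le_integral_sq_ball (h : TempSol C u v) {c : ℝ} (hc : 0 < c) {x : Eucl n}
    (hx : c ≤ u x) : (c * ∫ z : Eucl n, kern 2 z) ^ 2 / volume.real (ball (0 : Eucl n) 1) ≤
      ∫ y in ball x 1, u y ^ 2 := by
  set κ := ∫ z : Eucl n, kern 2 z with hκ
  have hκ0 : 0 < κ := integral_kern_pos
  set V := volume.real (ball (0 : Eucl n) 1) with hV
  have hV0 : 0 < V := ENNReal.toReal_pos (measure_ball_pos _ _ one_pos).ne' measure_ball_lt_top.ne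
  have e : ∫ y in ball x 1, u y ^ 2 = ∫ z in ball (0 : Eucl n) 1, u (x + z) ^ 2 := by
    have := (measurePreserving_add_left volume x).setIntegral_preimage_emb
      (measurableEmbedding_addLeft x) (fun y => u y ^ 2) (ball x 1)
    rw [← this, preimage_add_ball, sub_self]
  rw [e]
  set W := ∫ z in ball (0 : Eucl n) 1, u (x + z) ^ 2
  set t := V / (2 * (c * κ)) with ht
  have ht0 : 0 < t := by positivity
  have cu : Continuous fun z => u (x + z) := h.smooth_u.continuous.comp (by fun_prop)
  have cu2 : Continuous fun z => t * u (x + z) ^ 2 := (cu.pow 2).const_mul t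
  have ib : ∀ f : Eucl n → ℝ, Continuous f → IntegrableOn f (ball 0 1) := fun f hf =>
    (hf.continuousOn.integrableOn_compact (isCompact_closedBall 0 1)).mono_set ball_subset_closedBall
  have k1 : c * κ ≤ ∫ z in ball (0 : Eucl n) 1, u (x + z) * kern 2 z := by
    rw [setIntegral_eq_integral_of_forall_compl_eq_zero]
    · exact (mul_le_mul_of_nonneg_right hx hκ0.le).trans
        (kern_mean_value h.smooth_u h.plap_nonneg x)
    · intro z hz
      rw [mem_ball_zero_iff, not_lt] at hz
      rw [kern_eq_zero two_ne_zero z hz, mul_zero]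
  have k2 : ∫ z in ball (0 : Eucl n) 1, u (x + z) * kern 2 z ≤
      ∫ z in ball (0 : Eucl n) 1, (t * u (x + z) ^ 2 + 1 / (4 * t)) := by
    refine integral_mono (ib _ (cu.mul (continuous_kern 2))) (ib _ (cu2.add continuous_const)) fun z => ?_
    have p := h.pos_u (x + z)
    have q := mul_le_mul_of_nonneg_left (kern_le_one 2 z) p.le
    have r : t * u (x + z) ^ 2 + 1 / (4 * t) - u (x + z) = t * (u (x + z) - 1 / (2 * t)) ^ 2 := by
      field_simp; ring
    have : 0 ≤ t * (u (x + z) - 1 / (2 * t)) ^ 2 := by positivity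
    simp only
    linarith
  have k3 : ∫ z in ball (0 : Eucl n) 1, (t * u (x + z) ^ 2 + 1 / (4 * t)) =
      t * W + V * (1 / (4 * t)) := by
    rw [integral_add (ib _ cu2) (ib _ continuous_const), integral_const_mul,
      setIntegral_const, smul_eq_mul]
  have k4 := k1.trans (k2.trans_eq k3)
  have k5 : V * (1 / (4 * t)) = c * κ / 2 := by rw [ht]; field_simp; ring
  have k6 : c * κ / 2 ≤ V / (2 * (c * κ)) * W := by rw [← ht]; linarith
  rw [div_mul_eq_mul_div, le_div_iff₀ (by positivity)] at k6
  rw [div_le_iff₀ hV0]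
  nlinarith

end FreeBoundary

/-- For an entire solution with linear growth there is a universal constant C > 0 such that
at every point of the set {u = v}, both components have mass at least C in the unit ball. -/
theorem mass_lower_bound_on_free_boundary {n : ℕ} (hn : 2 ≤ n)
    (u v : EuclideanSpace ℝ (Fin n) → ℝ) (hsol : IsSolution u v)
    (C₀ : ℝ) (hC₀ : 0 < C₀) (hgrowth : ∀ x, u x + v x ≤ C₀ * (1 + ‖x‖)) :
    ∃ C : ℝ, 0 < C ∧ ∀ x : EuclideanSpace ℝ (Fin n), u x = v x →
      C ≤ (∫ y in ball x 1, (u y) ^ 2) ∧ C ≤ (∫ y in ball x 1, (v y) ^ 2) := by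
  have h := hsol.tempSol hC₀ hgrowth
  obtain ⟨c, hc, hle⟩ := h.exists_le_of_eq
  have hV : 0 < volume.real (ball (0 : Eucl n) 1) :=
    ENNReal.toReal_pos (measure_ball_pos _ _ one_pos).ne' measure_ball_lt_top.ne
  have hκ : 0 < ∫ z : Eucl n, kern 2 z := integral_kern_pos
  exact ⟨_, by positivity, fun x hx => ⟨h.le_integral_sq_ball hc (hle x hx),
    h.symm.le_integral_sq_ball hc (hx ▸ hle x hx)⟩⟩
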